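/- arXiv:2408.10447 — 3 statements merged into one kernel-verified Lean document; each statement's English description precedes it below -/
import Mathlib

section
/- Let 0 < ω < 1 be real and let κ̄ ∈ (1,e) be the solution of κ(1 − log κ) = ω in (1,e). For every real x ≥ e, setting m̄ = ⌊κ̄·log x⌋ and ᾱ = κ̄·log(x) − m̄, and for α equal to either ᾱ or 1, one has 0 ≤ li_{ω̄,α}(x) − li_*(x) ≤ D̄ · x^(1−ω) / √(log x), where D̄ = ((κ̄ + 3)/(κ̄ − 1))·√(2π/κ̄)·e^(13/12). -/
/-- The Stieltjes asymptotic approximation of `li(x)`: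
`li_*(x) = (x/log x)·Σ_{k=0}^{n−1} k!/(log x)^k + (log x − n)·x·n!/(log x)^(n+1)`
with `n = ⌊log x⌋`. -/
noncomputable def liStar (x : ℝ) : ℝ :=
  x / Real.log x *
      ∑ k ∈ Finset.range ⌊Real.log x⌋₊, (Nat.factorial k : ℝ) / Real.log x ^ k
    + (Real.log x - ⌊Real.log x⌋₊) * x * (Nat.factorial ⌊Real.log x⌋₊ : ℝ)
      / Real.log x ^ (⌊Real.log x⌋₊ + 1)

/-- The truncated asymptotic approximation of `li(x)` with truncation parameter `κ`
and fractional coefficient `α`: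
`li_{κ,α}(x) = (x/log x)·(α·m!/(log x)^m + Σ_{k=0}^{m−1} k!/(log x)^k)` with
`m = ⌊κ·log x⌋`. -/
noncomputable def liApprox (κ α x : ℝ) : ℝ :=
  x / Real.log x *
    (α * (Nat.factorial ⌊κ * Real.log x⌋₊ : ℝ) / Real.log x ^ ⌊κ * Real.log x⌋₊
      + ∑ k ∈ Finset.range ⌊κ * Real.log x⌋₊, (Nat.factorial k : ℝ) / Real.log x ^ k)

/-- The upper Stirling bound `m! ≤ e √m (m/e)^m`. -/
lemma factorial_le_exp_mul_sqrt {m : ℕ} (hm : 1 ≤ m) :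
    (m.factorial : ℝ) ≤ Real.exp 1 * √m * (m / Real.exp 1) ^ m := by
  obtain ⟨k, rfl⟩ : ∃ k, m = k + 1 := ⟨m - 1, by omega⟩
  have h : Stirling.stirlingSeq (k + 1) ≤ Stirling.stirlingSeq 1 :=
    Stirling.stirlingSeq'_antitone (Nat.zero_le k)
  rw [Stirling.stirlingSeq_one, Stirling.stirlingSeq, div_le_iff₀ (by positivity),
    Real.sqrt_mul (by norm_num)] at h
  calc _ ≤ _ := h
    _ = _ := by field_simp

lemma exp_one_le_sqrt_two_pi_mul : Real.exp 1 ≤ √(2 * Real.pi) * Real.exp (1 / 12) := by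
  have h : Real.exp (11 / 6) ≤ 2 * Real.pi := by
    refine le_of_pow_le_pow_left₀ (n := 6) (by norm_num) (by positivity) ?_
    calc Real.exp (11 / 6) ^ 6 = Real.exp 1 ^ 11 := by
          rw [← Real.exp_nat_mul, ← Real.exp_nat_mul]; norm_num
      _ ≤ (2.7182818286 : ℝ) ^ 11 := by gcongr; exact Real.exp_one_lt_d9.le
      _ ≤ (2 * 3.1415 : ℝ) ^ 6 := by norm_num
      _ ≤ (2 * Real.pi) ^ 6 := by gcongr; exact Real.pi_gt_d4.le
  have h' : Real.exp (11 / 12) ≤ √(2 * Real.pi) := by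
    refine Real.le_sqrt_of_sq_le ?_
    rwa [← Real.exp_nat_mul, show ((2 : ℕ) : ℝ) * (11 / 12) = 11 / 6 by norm_num]
  calc Real.exp 1 = Real.exp (11 / 12) * Real.exp (1 / 12) := by
        rw [← Real.exp_add]; norm_num
    _ ≤ _ := by gcongr

lemma factorial_div_pow_succ {L : ℝ} (hL : 0 < L) (k : ℕ) :
    ((k + 1).factorial : ℝ) / L ^ (k + 1) = (k + 1) / L * (k.factorial / L ^ k) := by
  rw [Nat.factorial_succ]
  push_cast
  field_simp
  ring

/-- The terms `k!/L^k` increase from `k = ⌊L⌋` on. -/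
lemma factorial_div_pow_mono {L : ℝ} (hL : 0 < L) {k N : ℕ} (hk : ⌊L⌋₊ ≤ k) (hkN : k ≤ N) :
    (k.factorial : ℝ) / L ^ k ≤ N.factorial / L ^ N := by
  induction N, hkN using Nat.le_induction with
  | base => rfl
  | succ N hN ih =>
    refine ih.trans ?_
    rw [factorial_div_pow_succ hL]
    have h : L < N + 1 := by
      exact_mod_cast (Nat.floor_lt hL.le).mp (Nat.lt_succ_of_le (hk.trans hN))
    exact le_mul_of_one_le_left (by positivity) ((one_le_div hL).mpr h.le)

lemma sum_Ico_factorial_div_pow_le_card_mul {L : ℝ} (hL : 0 < L) {N : ℕ} (hN : ⌊L⌋₊ ≤ N) :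
    ∑ k ∈ Finset.Ico ⌊L⌋₊ N, (k.factorial : ℝ) / L ^ k
      ≤ ((N : ℝ) - ⌊L⌋₊) * (N.factorial / L ^ N) := by
  refine (Finset.sum_le_card_nsmul _ _ (N.factorial / L ^ N) fun k hk => ?_).trans_eq ?_
  · rw [Finset.mem_Ico] at hk
    exact factorial_div_pow_mono hL hk.1 hk.2.le
  · rw [Nat.card_Ico, nsmul_eq_mul, Nat.cast_sub hN]

lemma sum_Ico_factorial_div_pow_le {L : ℝ} (hL : 1 ≤ L) {N : ℕ} (hN : ⌊L⌋₊ ≤ N) :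
    ∑ k ∈ Finset.Ico ⌊L⌋₊ N, (k.factorial : ℝ) / L ^ k
      ≤ 4 * L / (N + 1 - L) * (N.factorial / L ^ N) := by
  have hL0 : 0 < L := by linarith
  have hfl : (⌊L⌋₊ : ℝ) ≤ L := Nat.floor_le hL0.le
  have hfu : L < ⌊L⌋₊ + 1 := Nat.lt_floor_add_one L
  have hn1 : (1 : ℝ) ≤ ⌊L⌋₊ := by exact_mod_cast Nat.le_floor (by exact_mod_cast hL)
  induction N, hN using Nat.le_induction with
  | base =>
    rw [Finset.Ico_self, Finset.sum_empty]
    have : 0 < (⌊L⌋₊ : ℝ) + 1 - L := by linarith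
    positivity
  | succ N hN ih =>
    have hNr : (⌊L⌋₊ : ℝ) ≤ N := by exact_mod_cast hN
    have hu1 : 0 < (N : ℝ) + 1 - L := by linarith
    have hu2 : 0 < (N : ℝ) + 1 + 1 - L := by linarith
    push_cast
    rcases le_or_gt (4 * L) ((3 * (N - L) + 2) * (N - L + 1)) with h | h
    · rw [Finset.sum_Ico_succ_top hN, factorial_div_pow_succ hL0, ← mul_assoc]
      calc _ ≤ (4 * L / (N + 1 - L) + 1) * (N.factorial / L ^ N) := by
            rw [add_mul, one_mul]; gcongr
        _ ≤ _ := by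
          gcongr
          rw [div_add_one hu1.ne', div_mul_div_comm, div_le_div_iff₀ hu1 (by positivity)]
          nlinarith
    · refine (sum_Ico_factorial_div_pow_le_card_mul hL0 (hN.trans N.le_succ)).trans ?_
      gcongr
      rw [le_div_iff₀ hu2]
      push_cast
      obtain hj | hj | hj : N = ⌊L⌋₊ ∨ N = ⌊L⌋₊ + 1 ∨ ⌊L⌋₊ + 2 ≤ N := by omega
      · rw [hj]; nlinarith
      · rw [hj] at h ⊢; push_cast at h ⊢; nlinarith
      · have : (⌊L⌋₊ : ℝ) + 2 ≤ N := by exact_mod_cast hj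
        nlinarith

/-- `y ↦ y log (y/L) - y` at `⌊κL⌋` exceeds its value at `κL` by at most `1 - log κ`. -/
lemma floor_mul_log_sub_le {κ L : ℝ} (hκ1 : 1 < κ) (hκe : κ < Real.exp 1) (hL : 1 ≤ L)
    {m : ℕ} (hm : m = ⌊κ * L⌋₊) :
    m * Real.log (m / L) - m ≤ κ * L * Real.log κ - κ * L + 1 - Real.log κ := by
  have hL0 : 0 < L := by linarith
  have hκ0 : 0 < κ := by linarith
  have hY : 0 < κ * L := by positivity
  have hmY : (m : ℝ) ≤ κ * L := hm ▸ Nat.floor_le hY.le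
  have hmY' : κ * L < m + 1 := hm ▸ Nat.lt_floor_add_one _
  have hm0 : (0 : ℝ) < m := by
    have : 1 ≤ m := hm ▸ Nat.le_floor (by push_cast; nlinarith)
    exact_mod_cast this
  have hlogκ : Real.log κ ≤ 1 := by
    rw [Real.log_le_iff_le_exp hκ0]; exact hκe.le
  rcases le_or_gt L m with h | h
  · have h1 : 0 ≤ Real.log (m / L) := Real.log_nonneg ((one_le_div hL0).mpr h)
    have h2 := Real.one_sub_inv_le_log_of_pos (div_pos hY hm0)
    have h3 : Real.log κ = Real.log (m / L) + Real.log (κ * L / m) := by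
      rw [← Real.log_mul (by positivity) (by positivity)]
      congr 1
      field_simp
    have h4 : κ * L * (1 - (κ * L / m)⁻¹) = κ * L - m := by field_simp
    have h5 := mul_le_mul_of_nonneg_left h2 hY.le
    have h6 := mul_nonneg (sub_nonneg.mpr hmY) h1
    have h7 : κ * L * Real.log κ
        = κ * L * Real.log (m / L) + κ * L * Real.log (κ * L / m) := by rw [h3]; ring
    linarith
  · have h1 : Real.log (m / L) ≤ 0 :=
      Real.log_nonpos (by positivity) ((div_le_one hL0).mpr h.le)
    have h2 := mul_nonpos_of_nonneg_of_nonpos hm0.le h1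
    have h3 := Real.one_sub_inv_le_log_of_pos hκ0
    have h4 : κ * L * (1 - κ⁻¹) = κ * L - L := by field_simp
    have h5 := mul_le_mul_of_nonneg_left h3 hY.le
    have h6 := Real.log_le_sub_one_of_pos hκ0
    nlinarith

lemma factorial_floor_div_pow_le {κ L : ℝ} (hκ1 : 1 < κ) (hκe : κ < Real.exp 1) (hL : 1 ≤ L)
    {m : ℕ} (hm : m = ⌊κ * L⌋₊) :
    (m.factorial : ℝ) / L ^ m ≤ √(2 * Real.pi / κ) * Real.exp (13 / 12) * √L
      * Real.exp (-(κ * (1 - Real.log κ) * L)) := by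
  have hL0 : 0 < L := by linarith
  have hκ0 : 0 < κ := by linarith
  have hm1 : 1 ≤ m := hm ▸ Nat.le_floor (by push_cast; nlinarith)
  have hm0 : (0 : ℝ) < m := by exact_mod_cast hm1
  have hmY : (m : ℝ) ≤ κ * L := hm ▸ Nat.floor_le (by positivity)
  have hpow : (m / Real.exp 1) ^ m / L ^ m = Real.exp (m * Real.log (m / L) - m) := by
    rw [Real.exp_sub, Real.exp_nat_mul, Real.exp_log (by positivity), div_pow, div_pow,
      ← Real.exp_nat_mul, mul_one]
    field_simp
  calc (m.factorial : ℝ) / L ^ m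
      ≤ Real.exp 1 * √m * (m / Real.exp 1) ^ m / L ^ m := by
        gcongr; exact factorial_le_exp_mul_sqrt hm1
    _ = Real.exp 1 * √m * Real.exp (m * Real.log (m / L) - m) := by rw [mul_div_assoc, hpow]
    _ ≤ (√(2 * Real.pi) * Real.exp (1 / 12)) * √(κ * L)
        * Real.exp (κ * L * Real.log κ - κ * L + 1 - Real.log κ) := by
        gcongr ?_ * √?_ * Real.exp ?_
        · exact exp_one_le_sqrt_two_pi_mul
        · exact floor_mul_log_sub_le hκ1 hκe hL hm
    _ = _ := by
        rw [show κ * L * Real.log κ - κ * L + 1 - Real.log κ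
            = -(κ * (1 - Real.log κ) * L) + 1 - Real.log κ by ring, Real.exp_sub, Real.exp_add,
          Real.exp_log hκ0, Real.sqrt_div (by positivity), Real.sqrt_mul hκ0.le,
          show (13 / 12 : ℝ) = 1 / 12 + 1 by norm_num, Real.exp_add]
        have hs : √κ * √κ = κ := Real.mul_self_sqrt hκ0.le
        have : √κ ≠ 0 := by positivity
        field_simp
        rw [pow_two, hs]

lemma liApprox_sub_liStar {κ x : ℝ} (α : ℝ) (hκ : 1 ≤ κ) (hx : 1 < x) :
    liApprox κ α x - liStar x = x / Real.log x *
      (α * ((⌊κ * Real.log x⌋₊.factorial : ℝ) / Real.log x ^ ⌊κ * Real.log x⌋₊)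
        + ∑ k ∈ Finset.Ico ⌊Real.log x⌋₊ ⌊κ * Real.log x⌋₊, (k.factorial : ℝ) / Real.log x ^ k
        - (Real.log x - ⌊Real.log x⌋₊)
          * ((⌊Real.log x⌋₊.factorial : ℝ) / Real.log x ^ ⌊Real.log x⌋₊)) := by
  have hL : 0 < Real.log x := Real.log_pos hx
  have hnm : ⌊Real.log x⌋₊ ≤ ⌊κ * Real.log x⌋₊ := Nat.floor_mono (by nlinarith)
  rw [liApprox, liStar, Finset.sum_Ico_eq_sub _ hnm]
  field_simp
  ring

/-- For `0 < ω < 1`, `κ̄ ∈ (1,e)` the solution of `κ(1−log κ) = ω`,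
every real `x ≥ e`, `m̄ = ⌊κ̄·log x⌋`, `ᾱ = κ̄·log x − m̄`, and `α ∈ {ᾱ, 1}`, one has
`0 ≤ li_{ω̄,α}(x) − li_*(x) ≤ D̄·x^(1−ω)/√(log x)` with
`D̄ = ((κ̄+3)/(κ̄−1))·√(2π/κ̄)·e^(13/12)`. -/
theorem liApprox_upper_sub_liStar_le_D (ω κ : ℝ) (hω0 : 0 < ω) (hω1 : ω < 1)
    (hκ1 : 1 < κ) (hκe : κ < Real.exp 1) (hsol : κ * (1 - Real.log κ) = ω)
    (x : ℝ) (hx : Real.exp 1 ≤ x) (α : ℝ)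
    (hα : α = κ * Real.log x - ⌊κ * Real.log x⌋₊ ∨ α = 1) :
    0 ≤ liApprox κ α x - liStar x ∧
      liApprox κ α x - liStar x ≤
        (κ + 3) / (κ - 1) * (Real.sqrt (2 * Real.pi / κ) * Real.exp (13 / 12))
          * x ^ (1 - ω) / Real.sqrt (Real.log x) := by
  have hL : 1 ≤ Real.log x := (Real.le_log_iff_exp_le (by linarith [Real.exp_pos 1])).mpr hx
  have hx1 : 1 < x := by linarith [Real.add_one_le_exp 1]
  rw [liApprox_sub_liStar α hκ1.le hx1]
  have hstirling := factorial_floor_div_pow_le hκ1 hκe hL rfl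
  rw [hsol] at hstirling
  have hxpow : x ^ (1 - ω) = x * Real.exp (-(ω * Real.log x)) := by
    rw [Real.rpow_def_of_pos (by linarith), show Real.log x * (1 - ω)
      = Real.log x + -(ω * Real.log x) by ring, Real.exp_add, Real.exp_log (by linarith)]
  rw [hxpow]
  set L := Real.log x
  have hL0 : 0 < L := by linarith
  have hnm : ⌊L⌋₊ ≤ ⌊κ * L⌋₊ := Nat.floor_mono (by nlinarith)
  have hmono := factorial_div_pow_mono hL0 le_rfl hnm
  have hsum := sum_Ico_factorial_div_pow_le hL hnm
  have hfl : (⌊L⌋₊ : ℝ) ≤ L := Nat.floor_le hL0.le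
  have hfu : L < ⌊L⌋₊ + 1 := Nat.lt_floor_add_one L
  have hml : (⌊κ * L⌋₊ : ℝ) ≤ κ * L := Nat.floor_le (by nlinarith)
  have hmu : κ * L < ⌊κ * L⌋₊ + 1 := Nat.lt_floor_add_one _
  have hα0 : 0 ≤ α := by rcases hα with h | h <;> linarith
  have hα1 : α ≤ 1 := by rcases hα with h | h <;> linarith
  have ham : 0 < (⌊κ * L⌋₊.factorial : ℝ) / L ^ ⌊κ * L⌋₊ := by positivity
  have han : 0 < (⌊L⌋₊.factorial : ℝ) / L ^ ⌊L⌋₊ := by positivity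
  constructor
  · refine mul_nonneg (by positivity) ?_
    rcases hnm.eq_or_lt with h | h
    · rw [← h, Finset.Ico_self, Finset.sum_empty]
      have : L - ⌊L⌋₊ ≤ α := by
        rcases hα with h' | h'
        · rw [h', ← h]; nlinarith
        · linarith
      nlinarith
    · have h1 := Finset.single_le_sum (f := fun k : ℕ => (k.factorial : ℝ) / L ^ k)
        (fun k _ => by positivity) (Finset.left_mem_Ico.mpr h)
      nlinarith [mul_nonneg hα0 ham.le]
  · have hcoef : 4 * L / (⌊κ * L⌋₊ + 1 - L) ≤ 4 / (κ - 1) := by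
      rw [div_le_div_iff₀ (by nlinarith) (by linarith)]
      nlinarith
    have hbound : α * ((⌊κ * L⌋₊.factorial : ℝ) / L ^ ⌊κ * L⌋₊)
        + ∑ k ∈ Finset.Ico ⌊L⌋₊ ⌊κ * L⌋₊, (k.factorial : ℝ) / L ^ k
        - (L - ⌊L⌋₊) * ((⌊L⌋₊.factorial : ℝ) / L ^ ⌊L⌋₊)
        ≤ (κ + 3) / (κ - 1) * ((⌊κ * L⌋₊.factorial : ℝ) / L ^ ⌊κ * L⌋₊) := by
      have h1 : (κ + 3) / (κ - 1) = 1 + 4 / (κ - 1) := by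
        have : κ - 1 ≠ 0 := by linarith
        field_simp
        ring
      rw [h1, add_mul]
      have h2 := mul_le_mul_of_nonneg_right hcoef ham.le
      have h3 := mul_le_mul_of_nonneg_right hα1 ham.le
      have h4 := mul_nonneg (sub_nonneg.mpr hfl) han.le
      linarith
    have hκ' : 0 ≤ (κ + 3) / (κ - 1) := div_nonneg (by linarith) (by linarith)
    have hsq : √L * √L = L := Real.mul_self_sqrt hL0.le
    have hx0 : 0 ≤ x / L := by positivity
    refine (mul_le_mul_of_nonneg_left (hbound.trans
      (mul_le_mul_of_nonneg_left hstirling hκ')) hx0).trans_eq ?_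
    have hdiv : x / L * √L = x / √L := by
      rw [div_mul_eq_mul_div, div_eq_div_iff hL0.ne' (by positivity), mul_assoc, hsq]
    rw [show ∀ a b c d : ℝ, x / L * (a * (b * c * √L * d)) = a * (b * c) * d * (x / L * √L) by
      intros; ring, hdiv]
    ring
end

section
/- Let κ̲ ∈ (0,1) be the solution of κ(1 − log κ) = 1/2 in (0,1). Then li_0(x) ≤ π(x) for all real x with e ≤ x < e^(4/κ̲). -/
/-!
# Verified computation on a logarithmic grid

The numerical part of the proof works with natural numbers that are read as arrays of `40`-bit
lanes. Lane `j` of such an array collects data on the integers near `s ^ j`, where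
`s = 1 + 2⁻¹³`. The definitions use recursors and the raw operations on `ℕ` so that the kernel
evaluates them efficiently.
-/

namespace LogGrid

noncomputable section

/-- The residue of `x` modulo `2 ^ k`. -/
def lowBits (x k : ℕ) : ℕ :=
  cond (Nat.beq (Nat.shiftRight x k) 0) x (Nat.land x (Nat.sub (Nat.shiftLeft 1 k) 1))

/-- An upper approximation of `2 ^ 60 * s ^ 2 ^ l`. -/
def gridStep (l : ℕ) : ℕ :=
  Nat.rec 1153062242095202304 (fun _ t => Nat.succ (Nat.shiftRight (Nat.mul t t) 60)) l

/-- If `v` approximates `2 ^ 60 * s ^ j`, this approximates `2 ^ 60 * s ^ (j + 2 ^ l)`. -/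
def gridNext (v l : ℕ) : ℕ := Nat.succ (Nat.shiftRight (Nat.mul v (gridStep l)) 60)

/-- The least `i` such that `2 * i + 1` exceeds `v / 2 ^ 60`. -/
def oddIndex (v : ℕ) : ℕ := Nat.shiftRight (Nat.succ (Nat.shiftRight v 60)) 1

/-- The bit mask selecting every other block of `k` bits among the lowest `4224` bits. -/
def blockMask (k : ℕ) : ℕ :=
  Nat.div (Nat.sub (Nat.shiftLeft 1 4224) 1) (Nat.succ (Nat.shiftLeft 1 k))

/-- Adds up neighbouring blocks of `k` bits. -/
def addBlocks (k x : ℕ) : ℕ :=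
  Nat.add (Nat.land x (blockMask k)) (Nat.land (Nat.shiftRight x k) (blockMask k))

/-- The number of binary digits `1` of a number below `2 ^ 4224`. -/
def popCount (x : ℕ) : ℕ :=
  Nat.mod (addBlocks 8 (addBlocks 4 (addBlocks 2 (addBlocks 1 x)))) 65535

/-- Distributes the bits of `x`, the `i`-th of which stands for the number `2 * (i + a) + 1`, to
`2 ^ l` lanes beginning at the grid point `v`. -/
def binBuild (l : ℕ) : ℕ → ℕ → ℕ → ℕ :=
  Nat.rec (fun _ _ x => popCount x)
    (fun l ih v a x => cond (Nat.beq x 0) 0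
      (Nat.add (ih v a (lowBits x (Nat.sub (oddIndex (gridNext v l)) a)))
        (Nat.shiftLeft (ih (gridNext v l) (Nat.add a (Nat.sub (oddIndex (gridNext v l)) a))
          (Nat.shiftRight x (Nat.sub (oddIndex (gridNext v l)) a)))
          (Nat.shiftLeft 40 l)))) l

/-- The number of odd integers in a segment of the sieve. -/
def segLen : ℕ := 1541000

/-- The odd primes up to `7019`. -/
def sievePrimes : List ℕ :=
  [3, 5, 7, 11, 13, 17, 19, 23, 29, 31, 37, 41, 43, 47, 53, 59, 61, 67, 71, 73, 79, 83, 89, 97,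
   101, 103, 107, 109, 113, 127, 131, 137, 139, 149, 151, 157, 163, 167, 173, 179, 181, 191, 193,
   197, 199, 211, 223, 227, 229, 233, 239, 241, 251, 257, 263, 269, 271, 277, 281, 283, 293, 307,
   311, 313, 317, 331, 337, 347, 349, 353, 359, 367, 373, 379, 383, 389, 397, 401, 409, 419, 421,
   431, 433, 439, 443, 449, 457, 461, 463, 467, 479, 487, 491, 499, 503, 509, 521, 523, 541, 547,
   557, 563, 569, 571, 577, 587, 593, 599, 601, 607, 613, 617, 619, 631, 641, 643, 647, 653, 659,
   661, 673, 677, 683, 691, 701, 709, 719, 727, 733, 739, 743, 751, 757, 761, 769, 773, 787, 797,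
   809, 811, 821, 823, 827, 829, 839, 853, 857, 859, 863, 877, 881, 883, 887, 907, 911, 919, 929,
   937, 941, 947, 953, 967, 971, 977, 983, 991, 997, 1009, 1013, 1019, 1021, 1031, 1033, 1039,
   1049, 1051, 1061, 1063, 1069, 1087, 1091, 1093, 1097, 1103, 1109, 1117, 1123, 1129, 1151,
   1153, 1163, 1171, 1181, 1187, 1193, 1201, 1213, 1217, 1223, 1229, 1231, 1237, 1249, 1259,
   1277, 1279, 1283, 1289, 1291, 1297, 1301, 1303, 1307, 1319, 1321, 1327, 1361, 1367, 1373,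
   1381, 1399, 1409, 1423, 1427, 1429, 1433, 1439, 1447, 1451, 1453, 1459, 1471, 1481, 1483,
   1487, 1489, 1493, 1499, 1511, 1523, 1531, 1543, 1549, 1553, 1559, 1567, 1571, 1579, 1583,
   1597, 1601, 1607, 1609, 1613, 1619, 1621, 1627, 1637, 1657, 1663, 1667, 1669, 1693, 1697,
   1699, 1709, 1721, 1723, 1733, 1741, 1747, 1753, 1759, 1777, 1783, 1787, 1789, 1801, 1811,
   1823, 1831, 1847, 1861, 1867, 1871, 1873, 1877, 1879, 1889, 1901, 1907, 1913, 1931, 1933,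
   1949, 1951, 1973, 1979, 1987, 1993, 1997, 1999, 2003, 2011, 2017, 2027, 2029, 2039, 2053,
   2063, 2069, 2081, 2083, 2087, 2089, 2099, 2111, 2113, 2129, 2131, 2137, 2141, 2143, 2153,
   2161, 2179, 2203, 2207, 2213, 2221, 2237, 2239, 2243, 2251, 2267, 2269, 2273, 2281, 2287,
   2293, 2297, 2309, 2311, 2333, 2339, 2341, 2347, 2351, 2357, 2371, 2377, 2381, 2383, 2389,
   2393, 2399, 2411, 2417, 2423, 2437, 2441, 2447, 2459, 2467, 2473, 2477, 2503, 2521, 2531,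
   2539, 2543, 2549, 2551, 2557, 2579, 2591, 2593, 2609, 2617, 2621, 2633, 2647, 2657, 2659,
   2663, 2671, 2677, 2683, 2687, 2689, 2693, 2699, 2707, 2711, 2713, 2719, 2729, 2731, 2741,
   2749, 2753, 2767, 2777, 2789, 2791, 2797, 2801, 2803, 2819, 2833, 2837, 2843, 2851, 2857,
   2861, 2879, 2887, 2897, 2903, 2909, 2917, 2927, 2939, 2953, 2957, 2963, 2969, 2971, 2999,
   3001, 3011, 3019, 3023, 3037, 3041, 3049, 3061, 3067, 3079, 3083, 3089, 3109, 3119, 3121,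
   3137, 3163, 3167, 3169, 3181, 3187, 3191, 3203, 3209, 3217, 3221, 3229, 3251, 3253, 3257,
   3259, 3271, 3299, 3301, 3307, 3313, 3319, 3323, 3329, 3331, 3343, 3347, 3359, 3361, 3371,
   3373, 3389, 3391, 3407, 3413, 3433, 3449, 3457, 3461, 3463, 3467, 3469, 3491, 3499, 3511,
   3517, 3527, 3529, 3533, 3539, 3541, 3547, 3557, 3559, 3571, 3581, 3583, 3593, 3607, 3613,
   3617, 3623, 3631, 3637, 3643, 3659, 3671, 3673, 3677, 3691, 3697, 3701, 3709, 3719, 3727,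
   3733, 3739, 3761, 3767, 3769, 3779, 3793, 3797, 3803, 3821, 3823, 3833, 3847, 3851, 3853,
   3863, 3877, 3881, 3889, 3907, 3911, 3917, 3919, 3923, 3929, 3931, 3943, 3947, 3967, 3989,
   4001, 4003, 4007, 4013, 4019, 4021, 4027, 4049, 4051, 4057, 4073, 4079, 4091, 4093, 4099,
   4111, 4127, 4129, 4133, 4139, 4153, 4157, 4159, 4177, 4201, 4211, 4217, 4219, 4229, 4231,
   4241, 4243, 4253, 4259, 4261, 4271, 4273, 4283, 4289, 4297, 4327, 4337, 4339, 4349, 4357,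
   4363, 4373, 4391, 4397, 4409, 4421, 4423, 4441, 4447, 4451, 4457, 4463, 4481, 4483, 4493,
   4507, 4513, 4517, 4519, 4523, 4547, 4549, 4561, 4567, 4583, 4591, 4597, 4603, 4621, 4637,
   4639, 4643, 4649, 4651, 4657, 4663, 4673, 4679, 4691, 4703, 4721, 4723, 4729, 4733, 4751,
   4759, 4783, 4787, 4789, 4793, 4799, 4801, 4813, 4817, 4831, 4861, 4871, 4877, 4889, 4903,
   4909, 4919, 4931, 4933, 4937, 4943, 4951, 4957, 4967, 4969, 4973, 4987, 4993, 4999, 5003,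
   5009, 5011, 5021, 5023, 5039, 5051, 5059, 5077, 5081, 5087, 5099, 5101, 5107, 5113, 5119,
   5147, 5153, 5167, 5171, 5179, 5189, 5197, 5209, 5227, 5231, 5233, 5237, 5261, 5273, 5279,
   5281, 5297, 5303, 5309, 5323, 5333, 5347, 5351, 5381, 5387, 5393, 5399, 5407, 5413, 5417,
   5419, 5431, 5437, 5441, 5443, 5449, 5471, 5477, 5479, 5483, 5501, 5503, 5507, 5519, 5521,
   5527, 5531, 5557, 5563, 5569, 5573, 5581, 5591, 5623, 5639, 5641, 5647, 5651, 5653, 5657,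
   5659, 5669, 5683, 5689, 5693, 5701, 5711, 5717, 5737, 5741, 5743, 5749, 5779, 5783, 5791,
   5801, 5807, 5813, 5821, 5827, 5839, 5843, 5849, 5851, 5857, 5861, 5867, 5869, 5879, 5881,
   5897, 5903, 5923, 5927, 5939, 5953, 5981, 5987, 6007, 6011, 6029, 6037, 6043, 6047, 6053,
   6067, 6073, 6079, 6089, 6091, 6101, 6113, 6121, 6131, 6133, 6143, 6151, 6163, 6173, 6197,
   6199, 6203, 6211, 6217, 6221, 6229, 6247, 6257, 6263, 6269, 6271, 6277, 6287, 6299, 6301,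
   6311, 6317, 6323, 6329, 6337, 6343, 6353, 6359, 6361, 6367, 6373, 6379, 6389, 6397, 6421,
   6427, 6449, 6451, 6469, 6473, 6481, 6491, 6521, 6529, 6547, 6551, 6553, 6563, 6569, 6571,
   6577, 6581, 6599, 6607, 6619, 6637, 6653, 6659, 6661, 6673, 6679, 6689, 6691, 6701, 6703,
   6709, 6719, 6733, 6737, 6761, 6763, 6779, 6781, 6791, 6793, 6803, 6823, 6827, 6829, 6833,
   6841, 6857, 6863, 6869, 6871, 6883, 6899, 6907, 6911, 6917, 6947, 6949, 6959, 6961, 6967,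
   6971, 6977, 6983, 6991, 6997, 7001, 7013, 7019]

/-- The number whose bits are the multiples of `q`, up to `segLen` or beyond. -/
def multiplesPattern (q : ℕ) : ℕ :=
  Nat.div (Nat.shiftLeft 1 (Nat.mul q (Nat.succ (Nat.div segLen q))))
    (Nat.sub (Nat.shiftLeft 1 q) 1)

/-- The bits `i` for which `q` divides `2 * (i + o) + 1`. -/
def multiplesMask (o q : ℕ) : ℕ :=
  Nat.shiftLeft (multiplesPattern q)
    (Nat.mod (Nat.sub (Nat.add (Nat.shiftRight q 1) q) (Nat.mod o q)) q)

/-- The bits `i` for which an element of `L` divides `2 * (i + o) + 1`, joined to the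
bits of the last argument. -/
def sieveList (o : ℕ) (L : List ℕ) : ℕ → ℕ :=
  List.rec (fun a => a)
    (fun q _ ih a => cond (Nat.beq (Nat.lor a (multiplesMask o q)) 0)
      (ih (Nat.lor a (multiplesMask o q))) (ih (Nat.lor a (multiplesMask o q)))) L

/-- The number with `segLen` binary digits `1`. -/
def segFull : ℕ := Nat.sub (Nat.shiftLeft 1 segLen) 1

/-- The bits `i < segLen` for which `2 * (i + o) + 1` is not divisible by a sieving prime. -/
def segment (o : ℕ) : ℕ := Nat.sub segFull (Nat.land (sieveList o sievePrimes 0) segFull)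

/-- The grid point `1`. -/
def gridOne : ℕ := 1152921504606846976

/-- The bits `(q - 1) / 2` for the elements `q > 40` of a list of odd numbers. -/
def oddBits (L : List ℕ) : ℕ :=
  List.rec 0 (fun q _ ih => cond (Nat.ble q 40) ih
    (Nat.lor (Nat.shiftLeft 1 (Nat.shiftRight q 1)) ih)) L

/-- The lanes of the primes from `41` to `7019` and of those in `k` segments beginning at `o`. -/
def primeLanesFrom (k : ℕ) : ℕ → ℕ :=
  Nat.rec (fun _ => binBuild 18 gridOne 0 (oddBits sievePrimes))
    (fun _ ih o => Nat.add (binBuild 18 gridOne o (segment o)) (ih (Nat.add o segLen))) k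

/-- The lanes of the primes from `41` to `49319020`. -/
def primeLanes : ℕ := primeLanesFrom 16 3510

/-- Moves lane `b` to lane `m * b`, for all `b < 2 ^ l`. -/
def dilate (m l : ℕ) : ℕ → ℕ :=
  Nat.rec (fun z => z)
    (fun l ih z => cond (Nat.beq z 0) 0
      (Nat.add (ih (lowBits z (Nat.shiftLeft 40 l)))
        (Nat.shiftLeft (ih (Nat.shiftRight z (Nat.shiftLeft 40 l)))
          (Nat.mul m (Nat.shiftLeft 40 l))))) l

/-- The number of lanes that are kept. -/
def laneCount : ℕ := 175540

/-- The lanes of the `m`-th powers of the numbers with lanes `Z`. -/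
def powerLanes (Z m : ℕ) : ℕ :=
  dilate m 18 (lowBits Z (Nat.mul 40 (Nat.succ (Nat.div (Nat.pred laneCount) m))))

/-- Drops all lanes from `laneCount` on. -/
def truncLanes (x : ℕ) : ℕ :=
  Nat.land x (Nat.sub (Nat.shiftLeft 1 (Nat.mul 40 laneCount)) 1)

/-- The lanes of the products of two numbers with lanes `Z`. -/
def products2 (Z : ℕ) : ℕ := Nat.div (truncLanes (Nat.add (Nat.mul Z Z) (powerLanes Z 2))) 2

/-- The lanes of the products of three numbers with lanes `Z`. -/
def products3 (Z : ℕ) : ℕ :=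
  Nat.div (truncLanes (Nat.add (Nat.mul Z (products2 Z))
    (Nat.add (Nat.mul (powerLanes Z 2) Z) (powerLanes Z 3)))) 3

/-- The lanes of the products of four numbers with lanes `Z`. -/
def products4 (Z : ℕ) : ℕ :=
  Nat.div (truncLanes (Nat.add (Nat.mul Z (products3 Z))
    (Nat.add (Nat.mul (powerLanes Z 2) (products2 Z))
      (Nat.add (Nat.mul (powerLanes Z 3) Z) (powerLanes Z 4))))) 4

/-- The lanes of the products of five numbers with lanes `Z`. -/
def products5 (Z : ℕ) : ℕ :=
  Nat.div (truncLanes (Nat.add (Nat.mul Z (products4 Z))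
    (Nat.add (Nat.mul (powerLanes Z 2) (products3 Z))
      (Nat.add (Nat.mul (powerLanes Z 3) (products2 Z))
        (Nat.add (Nat.mul (powerLanes Z 4) Z) (powerLanes Z 5)))))) 5

/-- The lanes of the products of two to five numbers with lanes `Z`. -/
def compositeLanes (Z : ℕ) : ℕ :=
  Nat.add (products2 Z) (Nat.add (products3 Z) (Nat.add (products4 Z) (products5 Z)))

/-- The prefix sums of the lanes of a number, over blocks of `2 ^ l` lanes. -/
def prefixSums (l : ℕ) : ℕ → ℕ :=
  Nat.rec (fun x => x)
    (fun l ih x => ih (truncLanes (Nat.add x (Nat.shiftLeft x (Nat.shiftLeft 40 l))))) l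

/-- Checks `f j v d` for all `j` with `a ≤ j < b` among `2 ^ l` consecutive `j`, where `v` is the
grid point of `j` and `d` the lane of `x` belonging to `j`. -/
def walk (f : ℕ → ℕ → ℕ → Bool) (a b l : ℕ) : ℕ → ℕ → ℕ → Bool :=
  Nat.rec (fun j v x => cond (Nat.ble a j) (cond (Nat.ble b j) true (f j v x)) true)
    (fun l ih j v x =>
      cond (or (Nat.ble b j) (Nat.ble (Nat.add j (Nat.shiftLeft 2 l)) a)) true
        (cond (ih j v (lowBits x (Nat.shiftLeft 40 l)))
          (ih (Nat.add j (Nat.shiftLeft 1 l)) (gridNext v l)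
            (Nat.shiftRight x (Nat.shiftLeft 40 l))) false)) l

/-- The numerator of `1 / t + c₁ / t ^ 2 + 2 * c₂ / t ^ 3` for `t = 2 * j / 16385`. -/
def liNum (c₁ c₂ j : ℕ) : ℕ :=
  Nat.add (Nat.mul (Nat.mul 32770 j) j)
    (Nat.add (Nat.mul c₁ (Nat.mul 268468225 j)) (Nat.mul c₂ 4398851866625))

/-- The denominator belonging to `liNum`. -/
def liDen (j : ℕ) : ℕ := Nat.mul 4 (Nat.mul j (Nat.mul j j))

/-- The numerator for the number of terms that is used in the lower range. -/
def lowNum (j : ℕ) : ℕ :=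
  cond (Nat.ble 131644 j) (liNum 1 1 j) (cond (Nat.ble 87762 j) (liNum 1 0 j) (liNum 0 0 j))

/-- The inequality checked for each `j` in the lower range. -/
def lowCheck (j v d : ℕ) : Bool :=
  Nat.ble (Nat.mul (gridNext v 0) (lowNum j))
    (Nat.shiftLeft (Nat.mul (Nat.add 12 d) (liDen j)) 60)

/-- The inequalities checked for each `j` in the upper range. -/
def highCheck (j v d : ℕ) : Bool :=
  and (Nat.ble (gridNext v 0) (Nat.shiftLeft (Nat.mul 41 49319020) 60))
    (Nat.ble (Nat.add (Nat.mul v (Nat.mul 7420738134810 (liNum 1 1 j)))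
        (Nat.shiftLeft (Nat.mul 7420738134810 (Nat.mul (Nat.add d 1430) (liDen j))) 60))
      (Nat.mul v (Nat.mul 1103619686400 (liDen j))))

/-- All inequalities of the lower range. -/
def lowRangeCheck : Bool :=
  walk lowCheck 43881 145100 18 0 gridOne (Nat.shiftLeft (prefixSums 18 primeLanes) 80)

/-- All inequalities of the upper range. -/
def highRangeCheck : Bool :=
  walk highCheck 145100 175540 18 0 gridOne (prefixSums 18 (compositeLanes primeLanes))

end

theorem lowBits_eq (x k : ℕ) : lowBits x k = x % 2 ^ k := by
  have h : lowBits x k = cond (Nat.beq (x >>> k) 0) x (x &&& ((1 <<< k) - 1)) := rfl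
  rw [h, Nat.shiftRight_eq_div_pow, Nat.one_shiftLeft, Nat.and_two_pow_sub_one_eq_mod]
  by_cases h0 : x / 2 ^ k = 0
  · rw [h0]
    exact (Nat.mod_eq_of_lt ((Nat.div_eq_zero_iff_lt (by positivity)).1 h0)).symm
  · rw [show Nat.beq (x / 2 ^ k) 0 = false from by
      rwa [Bool.eq_false_iff, ne_eq, Nat.beq_eq]]
    rfl

/-- The ratio of the logarithmic grid. -/
noncomputable def gridBase : ℝ := 8193 / 8192

/-- A ratio slightly larger than `gridBase`. -/
noncomputable def gridUpper : ℝ := gridBase * (1 + 1 / 2 ^ 60)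

/-- `v / 2 ^ 60` approximates the grid point `gridBase ^ j`. -/
def OnGrid (j v : ℕ) : Prop := 2 ^ 60 * gridBase ^ j ≤ v ∧ (v : ℝ) ≤ 2 ^ 60 * gridUpper ^ j

theorem gridBase_pos : 0 < gridBase := by norm_num [gridBase]

theorem one_lt_gridBase : 1 < gridBase := by norm_num [gridBase]

theorem gridBase_le_gridUpper : gridBase ≤ gridUpper :=
  le_mul_of_one_le_right gridBase_pos.le (by norm_num)

theorem one_lt_gridUpper : 1 < gridUpper := one_lt_gridBase.trans_le gridBase_le_gridUpper

theorem onGrid_gridOne : OnGrid 0 gridOne := by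
  norm_num [OnGrid, gridOne]

theorem cast_div_two_pow_lt (x k : ℕ) : (x : ℝ) / 2 ^ k < ((x / 2 ^ k : ℕ) : ℝ) + 1 := by
  have := Nat.lt_floor_add_one ((x : ℝ) / ((2 ^ k : ℕ) : ℝ))
  rw [Nat.floor_div_eq_div] at this
  exact_mod_cast this

theorem cast_div_two_pow_le (x k : ℕ) : ((x / 2 ^ k : ℕ) : ℝ) ≤ (x : ℝ) / 2 ^ k := by
  simpa using (Nat.cast_div_le (α := ℝ) (m := x) (n := 2 ^ k))

theorem gridStep_succ (l : ℕ) : gridStep (l + 1) = gridStep l * gridStep l / 2 ^ 60 + 1 := by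
  rw [← Nat.shiftRight_eq_div_pow]; rfl

theorem gridNext_eq (v l : ℕ) : gridNext v l = v * gridStep l / 2 ^ 60 + 1 := by
  rw [← Nat.shiftRight_eq_div_pow]; rfl

theorem gridStep_bounds (l : ℕ) : 2 ^ 60 * gridBase ^ 2 ^ l ≤ gridStep l ∧
    (gridStep l : ℝ) * (1 + 1 / 2 ^ 60) ≤ 2 ^ 60 * gridUpper ^ 2 ^ l := by
  induction l with
  | zero =>
    have : (gridStep 0 : ℝ) = 1153062242095202304 := by norm_num [gridStep]
    rw [this]
    norm_num [gridUpper, gridBase]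
  | succ l ih =>
    obtain ⟨h1, h2⟩ := ih
    have hs := gridBase_pos
    rw [gridStep_succ]
    have hT : (1 : ℝ) + 1 / 2 ^ 60 ≤ gridUpper ^ 2 ^ l := by
      refine le_trans ?_ (le_self_pow₀ one_lt_gridUpper.le (by positivity))
      norm_num [gridUpper, gridBase]
    have hlt := cast_div_two_pow_lt (gridStep l * gridStep l) 60
    have hle := cast_div_two_pow_le (gridStep l * gridStep l) 60
    have e (g : ℝ) : g ^ 2 ^ (l + 1) = g ^ 2 ^ l * g ^ 2 ^ l := by rw [← pow_add, pow_succ, mul_two]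
    rw [e, e, Nat.cast_add_one]
    generalize ((gridStep l * gridStep l / 2 ^ 60 : ℕ) : ℝ) = q at *
    push_cast at hlt hle
    generalize (gridStep l : ℝ) = t at *
    generalize gridUpper ^ 2 ^ l = T at *
    have hS : 0 < gridBase ^ 2 ^ l := by positivity
    generalize gridBase ^ 2 ^ l = S at *
    have ht : 0 ≤ t := le_trans (by positivity) h1
    constructor
    · have : (2 ^ 60 * S) * (2 ^ 60 * S) ≤ t * t := by gcongr
      nlinarith
    · have ht : 0 ≤ t * (1 + 1 / 2 ^ 60) := le_trans (by positivity)
        (mul_le_mul_of_nonneg_right h1 (by norm_num))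
      have : (t * (1 + 1 / 2 ^ 60)) * (t * (1 + 1 / 2 ^ 60)) ≤ (2 ^ 60 * T) * (2 ^ 60 * T) := by
        gcongr
      have hTT : ((1 : ℝ) + 1 / 2 ^ 60) * (1 + 1 / 2 ^ 60) ≤ T * T := by gcongr
      nlinarith

theorem OnGrid.gridNext {j v : ℕ} (h : OnGrid j v) (l : ℕ) :
    OnGrid (j + 2 ^ l) (gridNext v l) := by
  obtain ⟨h1, h2⟩ := h
  obtain ⟨g1, g2⟩ := gridStep_bounds l
  have hs := gridBase_pos
  have hT : (1 : ℝ) + 1 / 2 ^ 60 ≤ gridUpper ^ (j + 2 ^ l) := by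
    refine le_trans ?_ (le_self_pow₀ one_lt_gridUpper.le (by positivity))
    norm_num [gridUpper, gridBase]
  have hlt := cast_div_two_pow_lt (v * gridStep l) 60
  have hle := cast_div_two_pow_le (v * gridStep l) 60
  rw [OnGrid, gridNext_eq]
  rw [Nat.cast_add_one]
  generalize ((v * gridStep l / 2 ^ 60 : ℕ) : ℝ) = q at *
  push_cast at hlt hle
  rw [pow_add] at hT ⊢
  rw [pow_add]
  generalize (gridStep l : ℝ) = t at *
  have hS : 0 < gridBase ^ 2 ^ l := by positivity
  have hSj : 0 < gridBase ^ j := by positivity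
  generalize gridUpper ^ 2 ^ l = T at *
  generalize gridUpper ^ j = U at *
  generalize gridBase ^ 2 ^ l = S at *
  generalize gridBase ^ j = R at *
  have hv : (0 : ℝ) ≤ v := by positivity
  have ht : 0 ≤ t := le_trans (by positivity) g1
  constructor
  · have : (2 ^ 60 * R) * (2 ^ 60 * S) ≤ v * t := by gcongr
    nlinarith
  · have : v * (t * (1 + 1 / 2 ^ 60)) ≤ (2 ^ 60 * U) * (2 ^ 60 * T) := by
      gcongr
      exact hv.trans h2
    nlinarith

theorem land_block {k a : ℕ} (x m : ℕ) (ha : a < 2 ^ (2 * k)) :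
    (a + 2 ^ (2 * k) * x) &&& (2 ^ k - 1 + 2 ^ (2 * k) * m) =
      a % 2 ^ k + 2 ^ (2 * k) * (x &&& m) := by
  have hk : 2 ^ k - 1 < 2 ^ (2 * k) :=
    (Nat.sub_lt (by positivity) one_pos).trans_le (Nat.pow_le_pow_right two_pos (by lia))
  rw [← Nat.mod_add_div ((a + 2 ^ (2 * k) * x) &&& (2 ^ k - 1 + 2 ^ (2 * k) * m)) (2 ^ (2 * k)),
    Nat.and_mod_two_pow, Nat.and_div_two_pow, Nat.add_mul_mod_self_left,
    Nat.add_mul_mod_self_left, Nat.mod_eq_of_lt ha, Nat.mod_eq_of_lt hk,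
    Nat.and_two_pow_sub_one_eq_mod, Nat.add_mul_div_left _ _ (by positivity),
    Nat.add_mul_div_left _ _ (by positivity), Nat.div_eq_of_lt ha, Nat.div_eq_of_lt hk,
    zero_add, zero_add]

theorem land_blocks {k : ℕ} (n : ℕ) (c : ℕ → ℕ) (hc : ∀ i, c i < 2 ^ k) :
    (∑ i ∈ Finset.range (2 * n), c i * (2 ^ k) ^ i) &&&
        (∑ i ∈ Finset.range n, (2 ^ k - 1) * (2 ^ (2 * k)) ^ i) =
      ∑ i ∈ Finset.range n, c (2 * i) * (2 ^ (2 * k)) ^ i := by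
  induction n generalizing c with
  | zero => simp
  | succ n ih =>
    have hpos : 0 < 2 ^ k := by positivity
    have h2 : 2 ^ (2 * k) = 2 ^ k * 2 ^ k := by rw [two_mul, pow_add]
    have h01 : c 0 + c 1 * 2 ^ k < 2 ^ (2 * k) := by
      rw [h2]; nlinarith [hc 0, hc 1]
    have e1 : ∑ i ∈ Finset.range (2 * (n + 1)), c i * (2 ^ k) ^ i =
        (c 0 + c 1 * 2 ^ k) +
          2 ^ (2 * k) * ∑ i ∈ Finset.range (2 * n), c (i + 2) * (2 ^ k) ^ i := by
      rw [show 2 * (n + 1) = 2 * n + 1 + 1 by ring, Finset.sum_range_succ',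
        Finset.sum_range_succ', Finset.mul_sum, h2]
      simp only [zero_add, pow_zero, pow_one, mul_one]
      rw [Finset.sum_congr rfl (fun i _ => show c (i + 1 + 1) * (2 ^ k) ^ (i + 1 + 1) =
        2 ^ k * 2 ^ k * (c (i + 2) * (2 ^ k) ^ i) by ring)]
      ring
    have e2 (d : ℕ → ℕ) : ∑ i ∈ Finset.range (n + 1), d i * (2 ^ (2 * k)) ^ i =
        d 0 + 2 ^ (2 * k) * ∑ i ∈ Finset.range n, d (i + 1) * (2 ^ (2 * k)) ^ i := by
      rw [Finset.sum_range_succ', Finset.mul_sum, add_comm]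
      simp only [pow_zero, mul_one]
      congr 1
      exact Finset.sum_congr rfl fun i _ => by ring
    rw [e1, e2 (fun _ => 2 ^ k - 1), land_block _ _ h01, ih _ (fun i => hc _),
    e2 (fun i => c (2 * i)),
      Nat.add_mul_mod_self_right, Nat.mod_eq_of_lt (hc 0)]
    simp [mul_add]

theorem blockMask_eq {k n : ℕ} (hk : 0 < k) (h : 2 * k * n = 4224) :
    blockMask k = ∑ i ∈ Finset.range n, (2 ^ k - 1) * (2 ^ (2 * k)) ^ i := by
  have h0 : blockMask k = (1 <<< 4224 - 1) / (1 <<< k + 1) := rfl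
  rw [h0, Nat.one_shiftLeft, Nat.one_shiftLeft, ← h, pow_mul]
  refine Nat.div_eq_of_eq_mul_left (by positivity) ?_
  have h1 : 1 ≤ 2 ^ k := Nat.one_le_two_pow
  have key : (2 ^ k - 1) * (2 ^ k + 1) = 2 ^ (2 * k) - 1 := by
    rw [mul_comm 2 k, pow_mul, mul_comm, ← Nat.sq_sub_sq, one_pow]
  have h4 : 2 ≤ 2 ^ (2 * k) := by
    calc 2 = 2 ^ 1 := rfl
      _ ≤ _ := Nat.pow_le_pow_right two_pos (by lia)
  have h5 : (∑ i ∈ Finset.range n, (2 ^ (2 * k)) ^ i) * (2 ^ (2 * k) - 1) =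
      (2 ^ (2 * k)) ^ n - 1 := by
    rw [Nat.geomSum_eq h4, Nat.div_mul_cancel (Nat.sub_one_dvd_pow_sub_one _ _)]
  rw [← Finset.mul_sum, mul_right_comm, key, Nat.mul_comm (2 ^ (2 * k) - 1), h5]

theorem addBlocks_eq {k n : ℕ} (hk : 0 < k) (h : 2 * k * n = 4224) (c : ℕ → ℕ)
    (hc : ∀ i, c i < 2 ^ k) (hc0 : ∀ i, 2 * n ≤ i → c i = 0) :
    addBlocks k (∑ i ∈ Finset.range (2 * n), c i * (2 ^ k) ^ i) =
      ∑ i ∈ Finset.range n, (c (2 * i) + c (2 * i + 1)) * (2 ^ (2 * k)) ^ i := by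
  have h0 (x : ℕ) : addBlocks k x = (x &&& blockMask k) + ((x >>> k) &&& blockMask k) := rfl
  have hs : (∑ i ∈ Finset.range (2 * n), c i * (2 ^ k) ^ i) >>> k =
      ∑ i ∈ Finset.range (2 * n), c (i + 1) * (2 ^ k) ^ i := by
    have e : ∑ i ∈ Finset.range (2 * n), c i * (2 ^ k) ^ i =
        c 0 + 2 ^ k * ∑ i ∈ Finset.range (2 * n), c (i + 1) * (2 ^ k) ^ i := by
      have := Finset.sum_range_succ (fun i => c i * (2 ^ k) ^ i) (2 * n)
      rw [hc0 _ le_rfl, zero_mul, add_zero, Finset.sum_range_succ'] at this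
      rw [← this, Finset.mul_sum, add_comm]
      simp only [pow_zero, mul_one]
      congr 1
      exact Finset.sum_congr rfl fun i _ => by ring
    rw [Nat.shiftRight_eq_div_pow, e, Nat.add_mul_div_left _ _ (by positivity),
      Nat.div_eq_of_lt (hc 0), zero_add]
  rw [h0, hs, blockMask_eq hk h, land_blocks n c hc, land_blocks n _ (fun i => hc (i + 1)),
    ← Finset.sum_add_distrib]
  exact Finset.sum_congr rfl fun i _ => by ring

theorem sum_testBit (n x : ℕ) (hx : x < 2 ^ n) :
    x = ∑ i ∈ Finset.range n, (x.testBit i).toNat * 2 ^ i := by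
  induction n generalizing x with
  | zero => simpa using hx
  | succ n ih =>
    have := ih (x / 2) (by rw [pow_succ] at hx; lia)
    rw [Finset.sum_range_succ']
    simp only [Nat.testBit_add_one, Nat.testBit_zero, pow_zero, mul_one, pow_succ, ← mul_assoc]
    rw [← Finset.sum_mul, ← this]
    rcases Nat.mod_two_eq_zero_or_one x with h | h <;> simp [h] <;> lia

theorem sum_range_pairs (n : ℕ) (c : ℕ → ℕ) :
    ∑ i ∈ Finset.range n, (c (2 * i) + c (2 * i + 1)) = ∑ i ∈ Finset.range (2 * n), c i := by
  induction n with
  | zero => simp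
  | succ n ih =>
    rw [Finset.sum_range_succ, ih, show 2 * (n + 1) = 2 * n + 1 + 1 by ring,
      Finset.sum_range_succ, Finset.sum_range_succ, add_assoc]

/-- The sums of consecutive pairs of a sequence. -/
def pairSums (c : ℕ → ℕ) (i : ℕ) : ℕ := c (2 * i) + c (2 * i + 1)

theorem addBlocks_sum {k k' n n' : ℕ} (hk : 0 < k) (h : k' * n = 4224) (hk' : k' = 2 * k)
    (hn' : n' = 2 * n) (c : ℕ → ℕ) (hc : ∀ i, c i < 2 ^ k) (hc0 : ∀ i, n' ≤ i → c i = 0) :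
    addBlocks k (∑ i ∈ Finset.range n', c i * (2 ^ k) ^ i) =
      ∑ i ∈ Finset.range n, pairSums c i * (2 ^ k') ^ i := by
  subst hk' hn'
  exact addBlocks_eq hk h c hc hc0

theorem pairSums_bound {c : ℕ → ℕ} {b n : ℕ} (hc : ∀ i, c i ≤ b)
    (hc0 : ∀ i, 2 * n ≤ i → c i = 0) :
    (∀ i, pairSums c i ≤ 2 * b) ∧ ∀ i, n ≤ i → pairSums c i = 0 := by
  refine ⟨fun i => ?_, fun i hi => ?_⟩
  · have := hc (2 * i)
    have := hc (2 * i + 1)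
    simp only [pairSums]
    lia
  · simp only [pairSums]
    rw [hc0 _ (by lia), hc0 _ (by lia)]

set_option exponentiation.threshold 5000 in
theorem popCount_eq {x : ℕ} (hx : x < 2 ^ 4224) :
    popCount x = ∑ i ∈ Finset.range 4224, (x.testBit i).toNat := by
  have h0 : popCount x = addBlocks 8 (addBlocks 4 (addBlocks 2 (addBlocks 1 x))) % 65535 := rfl
  have hx0 := sum_testBit 4224 x hx
  have hb0 : ∀ i, (x.testBit i).toNat ≤ 1 := fun i => Bool.toNat_le _
  have hz0 : ∀ i, 2 * 2112 ≤ i → (x.testBit i).toNat = 0 := fun i hi => by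
    have hi' : x < 2 ^ i := hx.trans_le (Nat.pow_le_pow_right two_pos hi)
    simp [Nat.testBit_lt_two_pow hi']
  generalize hc : (fun i => (x.testBit i).toNat) = c₀ at *
  replace hc : ∀ i, (x.testBit i).toNat = c₀ i := fun i => congrFun hc i
  simp only [hc] at hx0 hb0 hz0 ⊢
  rw [show (2 : ℕ) = 2 ^ 1 from rfl] at hx0
  obtain ⟨hb1, hz1⟩ := pairSums_bound hb0 hz0
  obtain ⟨hb2, hz2⟩ := pairSums_bound (n := 1056) hb1 hz1
  obtain ⟨hb3, hz3⟩ := pairSums_bound (n := 528) hb2 hz2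
  rw [h0, hx0,
    addBlocks_sum (k := 1) (k' := 2) (n := 2112) one_pos rfl rfl rfl c₀
      (fun i => (hb0 i).trans_lt (by norm_num)) hz0,
    addBlocks_sum (k := 2) (k' := 4) (n := 1056) two_pos rfl rfl rfl _
      (fun i => (hb1 i).trans_lt (by norm_num)) hz1,
    addBlocks_sum (k := 4) (k' := 8) (n := 528) (by norm_num) rfl rfl rfl _
      (fun i => (hb2 i).trans_lt (by norm_num)) hz2,
    addBlocks_sum (k := 8) (k' := 16) (n := 264) (by norm_num) rfl rfl rfl _
      (fun i => (hb3 i).trans_lt (by norm_num)) hz3]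
  have hs : ∑ i ∈ Finset.range 264, pairSums (pairSums (pairSums (pairSums c₀))) i =
      ∑ i ∈ Finset.range 4224, c₀ i :=
    (sum_range_pairs 264 (pairSums (pairSums (pairSums c₀)))).trans
      ((sum_range_pairs 528 (pairSums (pairSums c₀))).trans
      ((sum_range_pairs 1056 (pairSums c₀)).trans (sum_range_pairs 2112 c₀)))
  generalize pairSums (pairSums (pairSums (pairSums c₀))) = c₄ at *
  have hmod : ∑ i ∈ Finset.range 264, c₄ i * (2 ^ 16) ^ i ≡
      ∑ i ∈ Finset.range 264, c₄ i [MOD 65535] := by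
    refine Nat.ModEq.sum fun i _ => ?_
    simpa only [one_pow, mul_one] using
      ((show 2 ^ 16 ≡ 1 [MOD 65535] by decide).pow i).mul_left (c₄ i)
  rw [hs] at hmod
  refine Eq.trans hmod (Nat.mod_eq_of_lt ?_)
  calc ∑ i ∈ Finset.range 4224, c₀ i ≤ ∑ i ∈ Finset.range 4224, 1 :=
        Finset.sum_le_sum fun i _ => hb0 i
    _ < 65535 := by simp

theorem one_add_pow_le {ε : ℝ} (hε : 0 ≤ ε) {n : ℕ} (hn : n * ε ≤ 1 / 2) :
    (1 + ε) ^ n ≤ 1 + 2 * (n * ε) := by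
  induction n with
  | zero => simp
  | succ n ih =>
    push_cast at hn ⊢
    have := ih (by linarith)
    rw [pow_succ]
    have h0 : 0 ≤ n * ε := by positivity
    nlinarith [mul_le_mul_of_nonneg_right this (show 0 ≤ 1 + ε by linarith)]

theorem gridUpper_pow_le {n : ℕ} (hn : n ≤ 2 ^ 59) :
    gridUpper ^ n ≤ gridBase ^ n * (1 + 2 * (n / 2 ^ 60)) := by
  rw [gridUpper, mul_pow]
  have h : (n : ℝ) ≤ 2 ^ 59 := by exact_mod_cast hn
  have := one_add_pow_le (ε := 1 / 2 ^ 60) (by positivity) (n := n) (by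
    rw [mul_one_div, div_le_iff₀ (by positivity)]
    linarith)
  rw [mul_one_div] at this
  exact mul_le_mul_of_nonneg_left this (pow_pos gridBase_pos n).le

theorem gridUpper_pow_sub_lt {j a : ℕ} (ha : a < 25000000) (hj : gridBase ^ j ≤ 2 * a + 1) :
    gridUpper ^ (j + 1) < 2 * a + 1 + 2 * 4224 := by
  have ha' : (a : ℝ) + 1 ≤ 25000000 := by exact_mod_cast ha
  have hB : 1 + (j : ℝ) * (1 / 8192) ≤ gridBase ^ j := by
    have := one_add_mul_le_pow (a := (1 / 8192 : ℝ)) (by norm_num) j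
    rwa [show (1 + 1 / 8192 : ℝ) = gridBase by norm_num [gridBase]] at this
  have hj' : (j : ℝ) + 1 ≤ 2 ^ 39 := by norm_num; linarith
  have hj'' : j + 1 ≤ 2 ^ 39 := by exact_mod_cast hj'
  have := gridUpper_pow_le (n := j + 1) (hj''.trans (by norm_num))
  push_cast at this
  have h2 : (1 : ℝ) + 2 * ((j + 1) / 2 ^ 60) ≤ 1 + 1 / 2 ^ 20 := by norm_num at hj' ⊢; linarith
  have hp : 0 < gridBase ^ (j + 1) := pow_pos gridBase_pos _
  have h3 := this.trans (mul_le_mul_of_nonneg_left h2 hp.le)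
  rw [pow_succ, pow_succ] at h3
  refine h3.trans_lt ?_
  have : gridBase * (1 + 1 / 2 ^ 20) < 1 + 1 / 8000 := by norm_num [gridBase]
  rw [mul_assoc]
  have hp' : 0 < gridBase ^ j := pow_pos gridBase_pos _
  nlinarith

theorem oddIndex_eq (v : ℕ) : oddIndex v = (v / 2 ^ 60 + 1) / 2 := by
  have : oddIndex v = ((v >>> 60) + 1) >>> 1 := rfl
  rw [this, Nat.shiftRight_eq_div_pow, Nat.shiftRight_eq_div_pow, pow_one]

theorem OnGrid.le_of_oddIndex_le {j v g : ℕ} (h : OnGrid j v) (hg : oddIndex v ≤ g) :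
    gridBase ^ j ≤ 2 * g + 1 := by
  have h1 := h.1
  have h2 := cast_div_two_pow_lt v 60
  rw [oddIndex_eq] at hg
  have h3 : v / 2 ^ 60 + 1 ≤ 2 * g + 1 := by lia
  have h4 : ((v / 2 ^ 60 : ℕ) : ℝ) + 1 ≤ 2 * g + 1 := by exact_mod_cast h3
  have h5 : gridBase ^ j ≤ (v : ℝ) / 2 ^ 60 := by rw [le_div_iff₀ (by positivity)]; linarith
  linarith

theorem OnGrid.ge_of_lt_oddIndex {j v g : ℕ} (h : OnGrid j v) (hg : g < oddIndex v) :
    2 * g + 1 ≤ gridUpper ^ j := by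
  have h1 := h.2
  have h2 := cast_div_two_pow_le v 60
  rw [oddIndex_eq] at hg
  have h3 : 2 * g + 1 ≤ v / 2 ^ 60 := by lia
  have h4 : (2 * g + 1 : ℝ) ≤ ((v / 2 ^ 60 : ℕ) : ℝ) := by exact_mod_cast h3
  have h5 : (v : ℝ) / 2 ^ 60 ≤ gridUpper ^ j := by rw [div_le_iff₀ (by positivity)]; linarith
  linarith

theorem binBuild_zero (v a x : ℕ) : binBuild 0 v a x = popCount x := rfl

theorem binBuild_succ (l v a x : ℕ) : binBuild (l + 1) v a x = cond (Nat.beq x 0) 0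
    (binBuild l v a (lowBits x (oddIndex (gridNext v l) - a)) +
      (binBuild l (gridNext v l) (a + (oddIndex (gridNext v l) - a))
        (x >>> (oddIndex (gridNext v l) - a))) <<< (40 <<< l)) := rfl

set_option exponentiation.threshold 5000 in
theorem popCount_eq_card {a x j : ℕ} {T : Finset ℕ}
    (ha : gridBase ^ j ≤ 2 * a + 1) (hx : ∀ i, x.testBit i = true ↔ i + a ∈ T)
    (hT : ∀ g ∈ T, a ≤ g ∧ g < 25000000 ∧ 2 * g + 1 ≤ gridUpper ^ (j + 1)) :
    popCount x = T.card := by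
  obtain ⟨n, hn⟩ : ∃ n, n = 4224 := ⟨_, rfl⟩
  have hlt : ∀ g ∈ T, g < a + n := by
    intro g hg
    obtain ⟨h1, h2, h3⟩ := hT g hg
    have := h3.trans_lt (gridUpper_pow_sub_lt (h1.trans_lt h2) ha)
    have hn' : (n : ℝ) = 4224 := by rw [hn]; norm_num
    rw [← hn'] at this
    have : (2 * g + 1 : ℕ) < 2 * a + 1 + 2 * n := by exact_mod_cast this
    lia
  have hx' : x < 2 ^ n := by
    refine Nat.lt_pow_two_of_testBit _ fun i hi => ?_
    rw [Bool.eq_false_iff, ne_eq, hx]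
    intro h
    have := hlt _ h
    lia
  rw [popCount_eq (hn ▸ hx'), ← hn]
  have e (i : ℕ) : (x.testBit i).toNat = if i + a ∈ T then 1 else 0 := by
    simp only [← hx i]
    cases x.testBit i <;> rfl
  simp only [e, ← Finset.card_filter]
  refine Finset.card_bij (fun i _ => i + a) (fun i hi => (Finset.mem_filter.1 hi).2)
    (fun i _ j _ h => by lia) fun g hg => ⟨g - a, ?_, Nat.sub_add_cancel (hT g hg).1⟩
  have := hlt g hg
  have := (hT g hg).1
  rw [Finset.mem_filter, Finset.mem_range, Nat.sub_add_cancel this]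
  exact ⟨by lia, hg⟩

theorem binBuild_spec (l : ℕ) : ∀ (v a x j : ℕ) (T : Finset ℕ), OnGrid j v →
    gridBase ^ j ≤ 2 * a + 1 → (∀ i, x.testBit i = true ↔ i + a ∈ T) →
    (∀ g ∈ T, a ≤ g ∧ g < 25000000 ∧ 2 * g + 1 ≤ gridUpper ^ (j + 2 ^ l)) →
    ∃ b : ℕ → ℕ, (∀ g ∈ T, b g < 2 ^ l ∧ gridBase ^ (j + b g) ≤ 2 * g + 1 ∧
      2 * g + 1 ≤ gridUpper ^ (j + b g + 1)) ∧
      binBuild l v a x = ∑ g ∈ T, 2 ^ (40 * b g) := by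
  induction l with
  | zero =>
    intro v a x j T hv ha hx hT
    rw [pow_zero] at hT
    refine ⟨fun _ => 0, fun g hg => ⟨by simp, ?_, by simpa using (hT g hg).2.2⟩, ?_⟩
    · have : (a : ℝ) ≤ g := by exact_mod_cast (hT g hg).1
      rw [add_zero]
      linarith
    · rw [binBuild_zero, popCount_eq_card ha hx hT]
      simp
  | succ l ih =>
    intro v a x j T hv ha hx hT
    rw [binBuild_succ]
    by_cases h0 : x = 0
    · have : T = ∅ := by
        refine Finset.eq_empty_of_forall_notMem fun g hg => ?_
        have := (hx (g - a)).2 (by rwa [Nat.sub_add_cancel (hT g hg).1])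
        simp [h0] at this
      subst this
      exact ⟨fun _ => 0, by simp, by rw [h0]; rfl⟩
    rw [show Nat.beq x 0 = false from by rwa [Bool.eq_false_iff, ne_eq, Nat.beq_eq], cond_false]
    have hw := hv.gridNext l
    set w := LogGrid.gridNext v l
    set e := oddIndex w
    have hpow : j + 2 ^ (l + 1) = j + 2 ^ l + 2 ^ l := by ring
    obtain ⟨b₁, hb₁, h₁⟩ := ih v a (lowBits x (e - a)) j (T.filter (· < e)) hv ha
      (fun i => by
        rw [lowBits_eq, Nat.testBit_mod_two_pow, Bool.and_eq_true, decide_eq_true_iff, hx,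
          Finset.mem_filter, and_comm]
        exact and_congr_right fun _ => by lia)
      (fun g hg => by
        rw [Finset.mem_filter] at hg
        exact ⟨(hT g hg.1).1, (hT g hg.1).2.1, hw.ge_of_lt_oddIndex hg.2⟩)
    obtain ⟨b₂, hb₂, h₂⟩ := ih w (a + (e - a)) (x >>> (e - a)) (j + 2 ^ l)
      (T.filter (¬ · < e)) hw (by exact_mod_cast hw.le_of_oddIndex_le (show e ≤ a + (e - a) by lia))
      (fun i => by
        rw [Nat.testBit_shiftRight, hx, Finset.mem_filter,
          show i + (a + (e - a)) = e - a + i + a by ring]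
        exact ⟨fun h => ⟨h, by lia⟩, fun h => h.1⟩)
      (fun g hg => by
        rw [Finset.mem_filter] at hg
        have := hT g hg.1
        exact ⟨by lia, this.2.1, hpow ▸ this.2.2⟩)
    refine ⟨fun g => if g < e then b₁ g else 2 ^ l + b₂ g, fun g hg => ?_, ?_⟩
    · dsimp only
      split_ifs with h
      · have := hb₁ g (Finset.mem_filter.2 ⟨hg, h⟩)
        exact ⟨this.1.trans (Nat.pow_lt_pow_right one_lt_two (Nat.lt_succ_self l)), this.2⟩
      · have := hb₂ g (Finset.mem_filter.2 ⟨hg, h⟩)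
        rw [← add_assoc, pow_succ]
        exact ⟨by lia, this.2⟩
    · rw [h₁, h₂, ← Finset.sum_filter_add_sum_filter_not T (· < e)]
      congr 1
      · exact Finset.sum_congr rfl fun g hg => by
          dsimp only
          rw [if_pos (Finset.mem_filter.1 hg).2]
      · rw [Nat.shiftLeft_eq, Finset.sum_mul]
        refine Finset.sum_congr rfl fun g hg => ?_
        dsimp only
        rw [if_neg (Finset.mem_filter.1 hg).2, Nat.shiftLeft_eq, ← pow_add, mul_add, add_comm]

theorem testBit_geomSum {q : ℕ} (hq : 0 < q) (k i : ℕ) :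
    (∑ n ∈ Finset.range k, (2 ^ q) ^ n).testBit i = true ↔ q ∣ i ∧ i < q * k := by
  induction k generalizing i with
  | zero => simp
  | succ k ih =>
    have e : ∑ n ∈ Finset.range (k + 1), (2 ^ q) ^ n =
        2 ^ q * (∑ n ∈ Finset.range k, (2 ^ q) ^ n) + 1 := by
      rw [Finset.sum_range_succ', Finset.mul_sum, pow_zero]
      congr 1
      exact Finset.sum_congr rfl fun n _ => by ring
    rw [e, Nat.testBit_two_pow_mul_add _ (Nat.one_lt_two_pow hq.ne')]
    split_ifs with h
    · rw [Nat.testBit_one_eq_true_iff_self_eq_zero]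
      constructor
      · rintro rfl
        exact ⟨dvd_zero _, by positivity⟩
      · exact fun h' => Nat.eq_zero_of_dvd_of_lt h'.1 h
    · push Not at h
      rw [ih, mul_add_one, Nat.dvd_sub_iff_left h dvd_rfl]
      exact and_congr_right fun _ => by lia

theorem multiplesPattern_eq {q : ℕ} (hq : 2 ≤ q) : multiplesPattern q =
    ∑ n ∈ Finset.range (segLen / q + 1), (2 ^ q) ^ n := by
  have h : multiplesPattern q = (1 <<< (q * (segLen / q + 1))) / (1 <<< q - 1) := rfl
  have h4 : 2 ^ 2 ≤ 2 ^ q := Nat.pow_le_pow_right two_pos hq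
  generalize segLen / q + 1 = k at *
  rw [h, Nat.one_shiftLeft, Nat.one_shiftLeft, pow_mul]
  have h5 : (∑ i ∈ Finset.range k, (2 ^ q) ^ i) * (2 ^ q - 1) = (2 ^ q) ^ k - 1 := by
    rw [Nat.geomSum_eq (by lia), Nat.div_mul_cancel (Nat.sub_one_dvd_pow_sub_one _ _)]
  have h6 : 0 < (2 ^ q) ^ k := by positivity
  rw [show (2 ^ q) ^ k = 1 + (2 ^ q - 1) * ∑ i ∈ Finset.range k, (2 ^ q) ^ i by
    rw [mul_comm, h5]; lia, Nat.add_mul_div_left _ _ (by lia), Nat.div_eq_of_lt (by lia), zero_add]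

theorem testBit_multiplesMask {o q i : ℕ} (hq : 3 ≤ q) (hodd : Odd q) (hi : i < segLen) :
    (multiplesMask o q).testBit i = true ↔ q ∣ 2 * (i + o) + 1 := by
  have h : multiplesMask o q =
      multiplesPattern q <<< (((q >>> 1) + q - o % q) % q) := rfl
  rw [h, multiplesPattern_eq (by lia), Nat.shiftRight_eq_div_pow, pow_one]
  generalize hr : (q / 2 + q - o % q) % q = r
  have hrq : r < q := hr ▸ Nat.mod_lt _ (by lia)
  have hlt : i < q * (segLen / q + 1) := hi.trans (Nat.lt_mul_div_succ _ (by lia))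
  rw [Nat.testBit_shiftLeft, Bool.and_eq_true, decide_eq_true_iff, testBit_geomSum (by lia)]
  obtain ⟨c, rfl⟩ := hodd
  have hc : (2 * c + 1) / 2 = c := by lia
  rw [hc] at hr
  have hro : r + o ≡ c [MOD 2 * c + 1] := by
    have h1 : r ≡ c + (2 * c + 1) - o % (2 * c + 1) [MOD 2 * c + 1] :=
      hr ▸ Nat.mod_modEq _ _
    have h2 : o ≡ o % (2 * c + 1) [MOD 2 * c + 1] := (Nat.mod_modEq _ _).symm
    have h3 := h1.add h2
    have : o % (2 * c + 1) < 2 * c + 1 := Nat.mod_lt _ (by lia)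
    rw [Nat.sub_add_cancel (by lia)] at h3
    exact h3.trans (by simp [Nat.ModEq])
  have key : 2 * c + 1 ∣ 2 * (i + o) + 1 ↔ i ≡ r [MOD 2 * c + 1] := by
    have hcop : Nat.gcd (2 * c + 1) 2 = 1 := by simp
    constructor
    · intro hd
      have h1 : 2 * (i + o) + 1 ≡ 2 * c + 1 [MOD 2 * c + 1] :=
        ((Nat.modEq_zero_iff_dvd.2 hd)).trans (Nat.modEq_zero_iff_dvd.2 dvd_rfl).symm
      have h2 := Nat.ModEq.cancel_left_of_coprime hcop (Nat.ModEq.add_right_cancel' 1 h1)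
      exact Nat.ModEq.add_right_cancel' o (h2.trans hro.symm)
    · intro hd
      have h1 := (((hd.add_right o).trans hro).mul_left 2).add_right 1
      exact Nat.modEq_zero_iff_dvd.1 (h1.trans (Nat.modEq_zero_iff_dvd.2 dvd_rfl))
  rw [key]
  constructor
  · rintro ⟨h1, h2, h3⟩
    exact ((Nat.modEq_iff_dvd' h1).2 h2).symm
  · intro h1
    have h2 : r ≤ i := by
      by_contra hlt
      have := Nat.ModEq.eq_of_lt_of_lt h1 (by lia) hrq
      lia
    exact ⟨h2, (Nat.modEq_iff_dvd' h2).1 h1.symm, by lia⟩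

theorem sieveList_cons (o q : ℕ) (L : List ℕ) (a : ℕ) :
    sieveList o (q :: L) a = sieveList o L (a ||| multiplesMask o q) := by
  have : sieveList o (q :: L) a = cond (Nat.beq (Nat.lor a (multiplesMask o q)) 0)
      (sieveList o L (Nat.lor a (multiplesMask o q)))
      (sieveList o L (Nat.lor a (multiplesMask o q))) := rfl
  rw [this, Bool.cond_self]
  rfl

theorem testBit_sieveList (o i : ℕ) (L : List ℕ) (a : ℕ) :
    (sieveList o L a).testBit i = true ↔
      a.testBit i = true ∨ ∃ q ∈ L, (multiplesMask o q).testBit i = true := by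
  induction L generalizing a with
  | nil =>
    have : sieveList o [] a = a := rfl
    simp [this]
  | cons q L ih =>
    rw [sieveList_cons, ih, Nat.testBit_or, Bool.or_eq_true]
    simp [or_assoc]

theorem sub_shiftLeft_one (n : ℕ) : Nat.sub (Nat.shiftLeft 1 n) 1 = 2 ^ n - 1 := by
  rw [← Nat.one_shiftLeft]
  rfl

theorem testBit_segment (o i : ℕ) : (segment o).testBit i = true ↔
    i < segLen ∧ ¬ (sieveList o sievePrimes 0).testBit i = true := by
  unfold segment segFull
  rw [sub_shiftLeft_one]
  generalize segLen = n
  generalize sieveList o sievePrimes 0 = y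
  have e : Nat.sub (2 ^ n - 1) (Nat.land y (2 ^ n - 1)) = 2 ^ n - ((y &&& (2 ^ n - 1)) + 1) := by
    rw [add_comm, ← Nat.sub_sub]
    rfl
  have hlt : y &&& (2 ^ n - 1) < 2 ^ n := by
    rw [Nat.and_two_pow_sub_one_eq_mod]
    exact Nat.mod_lt _ (by positivity)
  rw [e, Nat.testBit_two_pow_sub_succ hlt, Nat.and_two_pow_sub_one_eq_mod,
    Nat.testBit_mod_two_pow]
  by_cases h : i < n <;> simp [h]

/-- Trial division of `n` by the odd primes up to `83`. -/
def trialDivision (n : ℕ) : Bool :=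
  [3, 5, 7, 11, 13, 17, 19, 23, 29, 31, 37, 41, 43, 47, 53, 59, 61, 67, 71, 73, 79, 83].all
    fun r => n == r || n % r != 0

set_option maxRecDepth 100000 in
theorem sievePrimes_eq : sievePrimes = (List.range' 3 3510 2).filter trialDivision := by
  decide +kernel

theorem trialDivision_iff {n : ℕ} (h1 : 3 ≤ n) (h2 : n < 7921) (hodd : Odd n) :
    trialDivision n = true ↔ n.Prime := by
  have hspec : trialDivision n = true ↔ ∀ r ∈ [3, 5, 7, 11, 13, 17, 19, 23, 29, 31, 37, 41, 43,
      47, 53, 59, 61, 67, 71, 73, 79, 83], n = r ∨ ¬ r ∣ n := by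
    simp [trialDivision, Nat.dvd_iff_mod_eq_zero]
  rw [hspec]
  constructor
  · intro h
    by_contra hn
    have hp := Nat.minFac_prime (show n ≠ 1 by lia)
    have hsq := Nat.minFac_sq_le_self (by lia) hn
    have hd := Nat.minFac_dvd n
    have hne : n.minFac ≠ n := fun he => hn (he ▸ hp)
    generalize n.minFac = p at *
    have hp89 : p < 89 := by nlinarith
    have hp2 : p ≠ 2 := by
      rintro rfl
      exact (Nat.not_even_iff_odd.2 hodd) (even_iff_two_dvd.2 hd)
    have hmem : p ∈ [3, 5, 7, 11, 13, 17, 19, 23, 29, 31, 37, 41, 43, 47, 53, 59, 61, 67, 71, 73,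
        79, 83] := by
      have : ∀ p < 89, p.Prime → p ≠ 2 → p ∈ [3, 5, 7, 11, 13, 17, 19, 23, 29, 31, 37, 41, 43,
        47, 53, 59, 61, 67, 71, 73, 79, 83] := by decide +kernel
      exact this p hp89 hp hp2
    rcases h p hmem with h' | h'
    · exact hne h'.symm
    · exact h' hd
  · intro hn r hr
    by_cases hd : r ∣ n
    · rcases hn.eq_one_or_self_of_dvd r hd with h | h
      · subst h
        simp at hr
      · exact Or.inl h.symm
    · exact Or.inr hd

theorem mem_sievePrimes {q : ℕ} :
    q ∈ sievePrimes ↔ q.Prime ∧ 3 ≤ q ∧ q < 7023 := by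
  rw [sievePrimes_eq, List.mem_filter, List.mem_range']
  constructor
  · rintro ⟨⟨i, hi, rfl⟩, h⟩
    rw [trialDivision_iff (by lia) (by lia) ⟨i + 1, by ring⟩] at h
    exact ⟨h, by lia, by lia⟩
  · rintro ⟨hp, h1, h2⟩
    have hodd := hp.odd_of_ne_two (by lia)
    refine ⟨?_, (trialDivision_iff h1 (by lia) hodd).2 hp⟩
    obtain ⟨c, rfl⟩ := hodd
    exact ⟨c - 1, by lia, by lia⟩

theorem prime_7021_lt {q : ℕ} (hq : q ∈ sievePrimes) : q < 7021 := by
  have h := mem_sievePrimes.1 hq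
  have : ∀ q < 7023, 7021 ≤ q → ¬ q.Prime := by
    intro q h1 h2
    interval_cases q <;> norm_num
  by_contra hlt
  exact this q h.2.2 (by lia) h.1

theorem testBit_segment_iff {o i : ℕ} (ho : 3510 ≤ o) (ho' : o + segLen ≤ 24659510) :
    (segment o).testBit i = true ↔ i < segLen ∧ (2 * (i + o) + 1).Prime := by
  rw [testBit_segment, testBit_sieveList]
  refine and_congr_right fun hi => ?_
  rw [Nat.zero_testBit]
  simp only [Bool.false_eq_true, false_or, not_exists, not_and]
  generalize hn : 2 * (i + o) + 1 = n
  have hdvd {q : ℕ} (hq : q ∈ sievePrimes) :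
      (multiplesMask o q).testBit i = true ↔ q ∣ n := by
    have := mem_sievePrimes.1 hq
    rw [testBit_multiplesMask this.2.1 (this.1.odd_of_ne_two (by lia)) hi, hn]
  have hn1 : 7021 ≤ n := by lia
  have hn2 : n < 7023 * 7023 := by lia
  have hodd : ¬ 2 ∣ n := by lia
  constructor
  · intro h
    by_contra hnp
    have hp := Nat.minFac_prime (show n ≠ 1 by lia)
    have hsq := Nat.minFac_sq_le_self (by lia) hnp
    have hd := Nat.minFac_dvd n
    generalize n.minFac = p at *
    have hp2 : p ≠ 2 := fun h2 => hodd (h2 ▸ hd)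
    have h3 : p < 7023 := by nlinarith
    have hmem : p ∈ sievePrimes := mem_sievePrimes.2 ⟨hp, by have := hp.two_le; lia, h3⟩
    exact h p hmem ((hdvd hmem).2 hd)
  · intro hp q hq h
    have := (mem_sievePrimes.1 hq)
    rcases hp.eq_one_or_self_of_dvd q ((hdvd hq).1 h) with h1 | h1
    · lia
    · have := prime_7021_lt hq
      lia

theorem oddBits_cons (q : ℕ) (L : List ℕ) :
    oddBits (q :: L) = cond (Nat.ble q 40) (oddBits L) ((1 <<< (q >>> 1)) ||| oddBits L) := rfl

theorem testBit_oddBits (L : List ℕ) (i : ℕ) :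
    (oddBits L).testBit i = true ↔ ∃ q ∈ L, 40 < q ∧ q / 2 = i := by
  induction L with
  | nil =>
    have : oddBits [] = 0 := rfl
    simp [this]
  | cons q L ih =>
    rw [oddBits_cons]
    simp only [List.mem_cons, exists_eq_or_imp]
    by_cases h : q ≤ 40
    · rw [Nat.ble_eq_true_of_le h, cond_true, ih, or_iff_right (fun h' => by lia)]
    · rw [show Nat.ble q 40 = false by rwa [Bool.eq_false_iff, ne_eq, Nat.ble_eq], cond_false,
        Nat.testBit_or, Bool.or_eq_true, ih, Nat.one_shiftLeft, Nat.shiftRight_eq_div_pow, pow_one,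
        Nat.testBit_two_pow, decide_eq_true_iff]
      exact or_congr_left ⟨fun h' => ⟨by lia, h'⟩, fun h' => h'.2⟩

/-- `x` consists of lanes, in the range up to `gridBase ^ 2 ^ 18`, that count the numbers
`2 * g + 1` for `g ∈ T`. -/
def IsLanesOf (T : Finset ℕ) (x : ℕ) : Prop :=
  ∃ b : ℕ → ℕ, (∀ g ∈ T, b g < 2 ^ 18 ∧ gridBase ^ b g ≤ 2 * g + 1 ∧
    2 * g + 1 ≤ gridUpper ^ (b g + 1)) ∧ x = ∑ g ∈ T, 2 ^ (40 * b g)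

theorem IsLanesOf.union {S T : Finset ℕ} {x y : ℕ} (hx : IsLanesOf S x) (hy : IsLanesOf T y)
    (h : Disjoint S T) : IsLanesOf (S ∪ T) (x + y) := by
  obtain ⟨b, hb, rfl⟩ := hx
  obtain ⟨c, hc, rfl⟩ := hy
  refine ⟨fun g => if g ∈ S then b g else c g, fun g hg => ?_, ?_⟩
  · dsimp only
    split_ifs with hS
    · exact hb g hS
    · exact hc g ((Finset.mem_union.1 hg).resolve_left hS)
  · rw [Finset.sum_union h]
    congr 1
    · exact Finset.sum_congr rfl fun g hg => by simp only [if_pos hg]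
    · exact Finset.sum_congr rfl fun g hg => by
        simp only [if_neg (Finset.disjoint_right.1 h hg)]

theorem le_gridUpper_pow {g : ℕ} (hg : g < 25000000) : (2 * g + 1 : ℝ) ≤ gridUpper ^ 2 ^ 18 := by
  have h1 : (2 : ℝ) ≤ gridBase ^ 2 ^ 13 := by
    have := one_add_mul_le_pow (a := (1 / 8192 : ℝ)) (by norm_num) (2 ^ 13)
    rw [show (1 + 1 / 8192 : ℝ) = gridBase by norm_num [gridBase]] at this
    norm_num at this ⊢
    exact this
  have h2 : (2 : ℝ) ^ 32 ≤ gridBase ^ 2 ^ 18 := by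
    rw [show 2 ^ 18 = 2 ^ 13 * 32 by norm_num, pow_mul]
    gcongr
  have h3 : gridBase ^ 2 ^ 18 ≤ gridUpper ^ 2 ^ 18 :=
    pow_le_pow_left₀ gridBase_pos.le gridBase_le_gridUpper _
  have h4 : (g : ℝ) < 25000000 := by exact_mod_cast hg
  have h5 : (50000001 : ℝ) ≤ 2 ^ 32 := by norm_num
  linarith

theorem isLanesOf_binBuild {a x : ℕ} {T : Finset ℕ} (hx : ∀ i, x.testBit i = true ↔ i + a ∈ T)
    (hT : ∀ g ∈ T, a ≤ g ∧ g < 25000000) : IsLanesOf T (binBuild 18 gridOne a x) := by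
  obtain ⟨b, hb, h⟩ := binBuild_spec 18 gridOne a x 0 T onGrid_gridOne (by simp) hx fun g hg =>
    ⟨(hT g hg).1, (hT g hg).2, by rw [zero_add]; exact le_gridUpper_pow (hT g hg).2⟩
  exact ⟨b, fun g hg => by simpa using hb g hg, h⟩

theorem segLen_eq : segLen = 1541000 := rfl

theorem primeLanesFrom_zero (o : ℕ) :
    primeLanesFrom 0 o = binBuild 18 gridOne 0 (oddBits sievePrimes) := rfl

theorem primeLanesFrom_succ (k o : ℕ) : primeLanesFrom (k + 1) o =
    binBuild 18 gridOne o (segment o) + primeLanesFrom k (o + segLen) := rfl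

theorem isLanesOf_oddBits : IsLanesOf ((Finset.Ico 20 3510).filter fun g => (2 * g + 1).Prime)
    (binBuild 18 gridOne 0 (oddBits sievePrimes)) := by
  refine isLanesOf_binBuild (fun i => ?_) fun g hg => ?_
  · rw [testBit_oddBits, Finset.mem_filter, Finset.mem_Ico, add_zero]
    constructor
    · rintro ⟨q, hq, h40, rfl⟩
      have h1 := mem_sievePrimes.1 hq
      have h2 := prime_7021_lt hq
      obtain ⟨c, rfl⟩ := h1.1.odd_of_ne_two (by lia)
      rw [show (2 * c + 1) / 2 = c by lia]
      exact ⟨by lia, h1.1⟩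
    · rintro ⟨h1, h2⟩
      exact ⟨2 * i + 1, mem_sievePrimes.2 ⟨h2, by lia, by lia⟩, by lia, by lia⟩
  · rw [Finset.mem_filter, Finset.mem_Ico] at hg
    lia

theorem isLanesOf_segment {o : ℕ} (ho : 3510 ≤ o) (ho' : o + segLen ≤ 24659510) :
    IsLanesOf ((Finset.Ico o (o + segLen)).filter fun g => (2 * g + 1).Prime)
      (binBuild 18 gridOne o (segment o)) := by
  have h := fun i => testBit_segment_iff (i := i) ho ho'
  generalize segment o = x at h ⊢
  generalize segLen = n at h ho' ⊢
  refine isLanesOf_binBuild (fun i => ?_) fun g hg => ?_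
  · rw [h, Finset.mem_filter, Finset.mem_Ico]
    exact and_congr_left fun _ => by lia
  · rw [Finset.mem_filter, Finset.mem_Ico] at hg
    lia

theorem IsLanesOf.union_Ico {o n m y z : ℕ} (ho : 3510 ≤ o) {p : ℕ → Prop} [DecidablePred p]
    (h₁ : IsLanesOf ((Finset.Ico o (o + n)).filter p) y)
    (h₂ : IsLanesOf ((Finset.Ico (o + n) (o + n + m) ∪ Finset.Ico 20 3510).filter p) z) :
    IsLanesOf ((Finset.Ico o (o + (m + n)) ∪ Finset.Ico 20 3510).filter p) (y + z) := by
  have h := h₁.union h₂ (by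
    rw [Finset.disjoint_left]
    intro g hg
    simp only [Finset.mem_filter, Finset.mem_Ico, Finset.mem_union] at hg ⊢
    lia)
  rwa [← Finset.filter_union, ← Finset.union_assoc,
    Finset.Ico_union_Ico_eq_Ico (Nat.le_add_right _ _) (Nat.le_add_right _ _), add_assoc,
    add_comm n m] at h

theorem isLanesOf_primeLanesFrom (k : ℕ) : ∀ o, 3510 ≤ o → o + k * segLen ≤ 24659510 →
    IsLanesOf (((Finset.Ico o (o + k * segLen)) ∪ Finset.Ico 20 3510).filter
      fun g => (2 * g + 1).Prime) (primeLanesFrom k o) := by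
  induction k with
  | zero =>
    intro o _ _
    rw [primeLanesFrom_zero, zero_mul, add_zero, Finset.Ico_self, Finset.empty_union]
    exact isLanesOf_oddBits
  | succ k ih =>
    intro o ho ho'
    rw [primeLanesFrom_succ, add_mul, one_mul]
    rw [add_mul, one_mul, add_comm (k * segLen), ← add_assoc] at ho'
    exact (isLanesOf_segment ho (le_of_add_le_left ho')).union_Ico ho
      (ih (o + segLen) (ho.trans (Nat.le_add_right _ _)) ho')

/-- The primes from `41` up to `49319020`. -/
def gridPrimes : Finset ℕ := (Finset.range 49319020).filter fun p => 41 ≤ p ∧ p.Prime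

theorem mem_gridPrimes {p : ℕ} : p ∈ gridPrimes ↔ p < 49319020 ∧ 41 ≤ p ∧ p.Prime := by
  rw [gridPrimes, Finset.mem_filter, Finset.mem_range]

theorem exists_primeLanes : ∃ b : ℕ → ℕ, (∀ p ∈ gridPrimes, b p < 2 ^ 18 ∧
    gridBase ^ b p ≤ p ∧ p ≤ gridUpper ^ (b p + 1)) ∧
    primeLanes = ∑ p ∈ gridPrimes, 2 ^ (40 * b p) := by
  obtain ⟨b, hb, h⟩ := isLanesOf_primeLanesFrom 16 3510 le_rfl (by rw [segLen_eq])
  have hmem (g : ℕ) : g ∈ ((Finset.Ico 3510 (3510 + 16 * segLen)) ∪ Finset.Ico 20 3510).filter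
      (fun g => (2 * g + 1).Prime) ↔ g < 24659510 ∧ 20 ≤ g ∧ (2 * g + 1).Prime := by
    rw [segLen_eq, Finset.mem_filter, Finset.mem_union, Finset.mem_Ico, Finset.mem_Ico]
    exact ⟨fun h => ⟨by lia, by lia, h.2⟩, fun h => ⟨by lia, h.2.2⟩⟩
  have hodd {p : ℕ} (hp : p ∈ gridPrimes) : 2 * (p / 2) + 1 = p := by
    rw [mem_gridPrimes] at hp
    obtain ⟨c, rfl⟩ := hp.2.2.odd_of_ne_two (by lia)
    lia
  have hhalf {p : ℕ} (hp : p ∈ gridPrimes) : p / 2 ∈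
      ((Finset.Ico 3510 (3510 + 16 * segLen)) ∪ Finset.Ico 20 3510).filter
      (fun g => (2 * g + 1).Prime) := by
    rw [hmem, hodd hp]
    have := mem_gridPrimes.1 hp
    exact ⟨by lia, by lia, this.2.2⟩
  refine ⟨fun p => b (p / 2), fun p hp => ?_, ?_⟩
  · have h1 := hb _ (hhalf hp)
    have h2 : (2 * ((p / 2 : ℕ) : ℝ) + 1) = p := by exact_mod_cast hodd hp
    rwa [h2] at h1
  · refine h.trans (Finset.sum_bij' (fun g _ => 2 * g + 1) (fun p _ => p / 2) (fun g hg => ?_)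
      (fun p hp => hhalf hp) (fun g _ => by lia) (fun p hp => hodd hp) (fun g _ => ?_))
    · rw [hmem] at hg
      exact mem_gridPrimes.2 ⟨by lia, by lia, hg.2.2⟩
    · dsimp only
      rw [show (2 * g + 1) / 2 = g by lia]

section Lanes

variable {α : Type*} {T : Finset α} {b : α → ℕ} {n : ℕ}

theorem sum_lanes_lt (h : ∀ i < n, (T.filter fun t => b t = i).card < 2 ^ 40) :
    ∑ t ∈ T with b t < n, 2 ^ (40 * b t) < 2 ^ (40 * n) := by
  have e : ∑ t ∈ T with b t < n, 2 ^ (40 * b t) =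
      ∑ i ∈ Finset.range n, (T.filter fun t => b t = i).card * 2 ^ (40 * i) := by
    rw [← Finset.sum_fiberwise_of_maps_to (t := Finset.range n) (g := b) (by simp)]
    refine Finset.sum_congr rfl fun i hi => ?_
    rw [Finset.filter_filter, Finset.card_eq_sum_ones, Finset.sum_mul]
    have : T.filter (fun t => b t < n ∧ b t = i) = T.filter fun t => b t = i := by
      refine Finset.filter_congr fun t _ => ?_
      have := Finset.mem_range.1 hi
      exact ⟨fun h => h.2, fun h => ⟨by lia, h⟩⟩
    rw [this]
    refine Finset.sum_congr rfl fun t ht => ?_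
    rw [(Finset.mem_filter.1 ht).2, one_mul]
  rw [e]
  clear e
  induction n with
  | zero => simp
  | succ n ih =>
    have h1 := ih fun i hi => h i (by lia)
    have h2 := h n (by lia)
    rw [Finset.sum_range_succ, show 40 * (n + 1) = 40 + 40 * n by ring, pow_add]
    generalize (T.filter fun t => b t = n).card = c at *
    have h3 : (c + 1) * 2 ^ (40 * n) ≤ 2 ^ 40 * 2 ^ (40 * n) := Nat.mul_le_mul_right _ h2
    lia

theorem sum_lanes_eq (T : Finset α) (b : α → ℕ) (n : ℕ) : ∑ t ∈ T, 2 ^ (40 * b t) =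
    ∑ t ∈ T with b t < n, 2 ^ (40 * b t) +
      2 ^ (40 * n) * ∑ t ∈ T with ¬ b t < n, 2 ^ (40 * (b t - n)) := by
  rw [← Finset.sum_filter_add_sum_filter_not T (b · < n), Finset.mul_sum]
  congr 1
  refine Finset.sum_congr rfl fun t ht => ?_
  rw [← pow_add]
  have := (Finset.mem_filter.1 ht).2
  congr 1
  lia

theorem sum_lanes_mod (h : ∀ i < n, (T.filter fun t => b t = i).card < 2 ^ 40) :
    (∑ t ∈ T, 2 ^ (40 * b t)) % 2 ^ (40 * n) = ∑ t ∈ T with b t < n, 2 ^ (40 * b t) := by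
  rw [sum_lanes_eq T b n, Nat.add_mul_mod_self_left, Nat.mod_eq_of_lt (sum_lanes_lt h)]

theorem sum_lanes_div (h : ∀ i < n, (T.filter fun t => b t = i).card < 2 ^ 40) :
    (∑ t ∈ T, 2 ^ (40 * b t)) / 2 ^ (40 * n) =
      ∑ t ∈ T with ¬ b t < n, 2 ^ (40 * (b t - n)) := by
  rw [sum_lanes_eq T b n, Nat.add_mul_div_left _ _ (by positivity),
    Nat.div_eq_of_lt (sum_lanes_lt h), zero_add]

theorem sum_lanes_div_mod (h : ∀ i ≤ n, (T.filter fun t => b t = i).card < 2 ^ 40) :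
    (∑ t ∈ T, 2 ^ (40 * b t)) / 2 ^ (40 * n) % 2 ^ 40 = (T.filter fun t => b t = n).card := by
  rw [sum_lanes_div fun i hi => h i hi.le]
  have e := sum_lanes_mod (T := T.filter fun t => ¬ b t < n) (b := fun t => b t - n) (n := 1)
    (fun i hi => by
      obtain rfl : i = 0 := by lia
      refine lt_of_le_of_lt (Finset.card_le_card fun t ht => ?_) (h n le_rfl)
      rw [Finset.mem_filter, Finset.mem_filter] at ht
      exact Finset.mem_filter.2 ⟨ht.1.1, by lia⟩)
  rw [mul_one] at e
  rw [e, Finset.filter_filter, Finset.card_eq_sum_ones]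
  refine Finset.sum_congr (Finset.filter_congr fun t _ => by lia) fun t ht => ?_
  rw [(Finset.mem_filter.1 ht).2, Nat.sub_self, mul_zero, pow_zero]

end Lanes

theorem dilate_succ (m l z : ℕ) : dilate m (l + 1) z = cond (Nat.beq z 0) 0
    (dilate m l (lowBits z (40 <<< l)) +
      (dilate m l (z >>> (40 <<< l))) <<< (m * (40 <<< l))) := rfl

theorem dilate_zero_right (m l : ℕ) : dilate m l 0 = 0 := by
  cases l <;> rfl

theorem dilate_sum_lanes {α : Type*} (m l : ℕ) (T : Finset α) (b : α → ℕ) (hT : T.card < 2 ^ 40)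
    (hb : ∀ t ∈ T, b t < 2 ^ l) :
    dilate m l (∑ t ∈ T, 2 ^ (40 * b t)) = ∑ t ∈ T, 2 ^ (40 * (m * b t)) := by
  induction l generalizing T b with
  | zero =>
    have h0 : ∀ t ∈ T, b t = 0 := fun t ht => by simpa using hb t ht
    refine Finset.sum_congr rfl fun t ht => ?_
    rw [h0 t ht, mul_zero, mul_zero, mul_zero]
  | succ l ih =>
    have hcard (p : α → Prop) [DecidablePred p] : (T.filter p).card < 2 ^ 40 :=
      (Finset.card_filter_le _ _).trans_lt hT
    by_cases h0 : ∑ t ∈ T, 2 ^ (40 * b t) = 0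
    · rw [h0, dilate_zero_right]
      have : T = ∅ := by
        refine Finset.eq_empty_of_forall_notMem fun t ht => ?_
        have := Finset.sum_eq_zero_iff.1 h0 t ht
        exact absurd this (by positivity)
      rw [this, Finset.sum_empty]
    · rw [dilate_succ, show Nat.beq (∑ t ∈ T, 2 ^ (40 * b t)) 0 = false by
        rwa [Bool.eq_false_iff, ne_eq, Nat.beq_eq], cond_false, lowBits_eq,
        Nat.shiftRight_eq_div_pow, Nat.shiftLeft_eq 40, sum_lanes_mod fun i _ => hcard _,
        sum_lanes_div fun i _ => hcard _, ih _ b (hcard _) (fun t ht => (Finset.mem_filter.1 ht).2),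
        ih _ (fun t => b t - 2 ^ l) (hcard _) (fun t ht => ?_),
        ← Finset.sum_filter_add_sum_filter_not T (b · < 2 ^ l), Nat.shiftLeft_eq, Finset.sum_mul]
      · congr 1
        refine Finset.sum_congr rfl fun t ht => ?_
        have := (Finset.mem_filter.1 ht).2
        rw [← pow_add, ← mul_left_comm, ← mul_add, ← mul_add, Nat.sub_add_cancel (by lia),
          mul_left_comm]
      · rw [Finset.mem_filter] at ht
        have := hb t ht.1
        rw [pow_succ] at this
        lia

theorem truncLanes_eq (x : ℕ) : truncLanes x = x % 2 ^ (40 * laneCount) := by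
  rw [← Nat.and_two_pow_sub_one_eq_mod, ← sub_shiftLeft_one]
  rfl

theorem powerLanes_sum_lanes {α : Type*} {m : ℕ} (hm : 0 < m) (T : Finset α) (b : α → ℕ)
    (hT : T.card < 2 ^ 40) : powerLanes (∑ t ∈ T, 2 ^ (40 * b t)) m ≡
      ∑ t ∈ T, 2 ^ (40 * (m * b t)) [MOD 2 ^ (40 * laneCount)] := by
  have hcard (p : α → Prop) [DecidablePred p] : (T.filter p).card < 2 ^ 40 :=
    (Finset.card_filter_le _ _).trans_lt hT
  have h : powerLanes (∑ t ∈ T, 2 ^ (40 * b t)) m = dilate m 18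
    (lowBits (∑ t ∈ T, 2 ^ (40 * b t)) (40 * ((laneCount - 1) / m + 1))) := rfl
  have hiff (x : ℕ) : x < (laneCount - 1) / m + 1 ↔ m * x < laneCount := by
    rw [Nat.lt_succ_iff, Nat.le_div_iff_mul_le hm, mul_comm]
    have : laneCount = 175540 := rfl
    lia
  rw [h, lowBits_eq, sum_lanes_mod fun i _ => hcard _, dilate_sum_lanes _ _ _ _ (hcard _)]
  · have := (Nat.mod_modEq (∑ t ∈ T, 2 ^ (40 * (m * b t))) (2 ^ (40 * laneCount)))
    rw [sum_lanes_mod fun i _ => hcard _] at this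
    simp only [hiff]
    exact this
  · intro t ht
    have h1 := (Finset.mem_filter.1 ht).2
    rw [hiff] at h1
    have : laneCount = 175540 := rfl
    have := Nat.le_mul_of_pos_left (b t) hm
    lia

theorem prefixSums_succ (l x : ℕ) : prefixSums (l + 1) x =
    prefixSums l (truncLanes (x + x <<< (40 <<< l))) := rfl

theorem prefixSums_modEq (l x : ℕ) : prefixSums l x ≡
    x * ∑ d ∈ Finset.range (2 ^ l), 2 ^ (40 * d) [MOD 2 ^ (40 * laneCount)] := by
  induction l generalizing x with
  | zero =>
    have : prefixSums 0 x = x := rfl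
    simp [this, Nat.ModEq]
  | succ l ih =>
    rw [prefixSums_succ]
    refine (ih _).trans ?_
    rw [truncLanes_eq]
    refine ((Nat.mod_modEq _ _).mul_right _).trans (Eq.congr_right ?_ |>.mpr rfl)
    rw [pow_succ, mul_two, Finset.sum_range_add, Nat.shiftLeft_eq, Nat.shiftLeft_eq, mul_add,
      add_mul]
    congr 2
    rw [mul_assoc, Finset.mul_sum, Finset.mul_sum, Finset.mul_sum]
    exact Finset.sum_congr rfl fun d _ => by rw [mul_add, pow_add]

theorem prefixSums_lane {α : Type*} (T : Finset α) (b : α → ℕ) {x J : ℕ} (hJ : J < laneCount)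
    (hx : x ≡ ∑ t ∈ T, 2 ^ (40 * b t) [MOD 2 ^ (40 * laneCount)])
    (hT : (T.filter fun t => b t ≤ J).card < 2 ^ 40) :
    prefixSums 18 x / 2 ^ (40 * J) % 2 ^ 40 = (T.filter fun t => b t ≤ J).card := by
  have h1 := (prefixSums_modEq 18 x).trans (hx.mul_right _)
  have hJ' : J < 2 ^ 18 := hJ.trans (by decide)
  have hmod {y z : ℕ} (h : y ≡ z [MOD 2 ^ (40 * laneCount)]) :
      y / 2 ^ (40 * J) % 2 ^ 40 = z / 2 ^ (40 * J) % 2 ^ 40 := by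
    have h2 : y ≡ z [MOD 2 ^ (40 * J) * 2 ^ 40] := h.of_dvd (by
      rw [← pow_add]
      exact pow_dvd_pow _ (by lia))
    rw [← Nat.mod_mul_right_div_self, ← Nat.mod_mul_right_div_self z, h2]
  have e : (∑ t ∈ T, 2 ^ (40 * b t)) * ∑ d ∈ Finset.range (2 ^ 18), 2 ^ (40 * d) =
      ∑ q ∈ T ×ˢ Finset.range (2 ^ 18), 2 ^ (40 * (b q.1 + q.2)) := by
    rw [Finset.sum_mul_sum, Finset.sum_product]
    refine Finset.sum_congr rfl fun t _ => Finset.sum_congr rfl fun d _ => ?_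
    rw [← pow_add, mul_add]
  have hc {i : ℕ} (hi : i ≤ J) : ((T ×ˢ Finset.range (2 ^ 18)).filter
      fun q => b q.1 + q.2 = i).card = (T.filter fun t => b t ≤ i).card := by
    refine Finset.card_bij' (fun q _ => q.1) (fun t _ => (t, i - b t)) ?_ ?_ ?_ ?_
    · intro q hq
      rw [Finset.mem_filter, Finset.mem_product] at hq
      exact Finset.mem_filter.2 ⟨hq.1.1, by lia⟩
    · intro t ht
      rw [Finset.mem_filter] at ht
      rw [Finset.mem_filter, Finset.mem_product, Finset.mem_range]
      exact ⟨⟨ht.1, by dsimp only; lia⟩, by dsimp only; lia⟩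
    · intro q hq
      rw [Finset.mem_filter] at hq
      ext
      · rfl
      · dsimp only; lia
    · intro t _
      rfl
  rw [hmod h1, e, sum_lanes_div_mod, hc le_rfl]
  intro i hi
  rw [hc hi]
  refine lt_of_le_of_lt (Finset.card_le_card fun t ht => ?_) hT
  rw [Finset.mem_filter] at ht ⊢
  exact ⟨ht.1, by lia⟩

theorem walk_zero (f : ℕ → ℕ → ℕ → Bool) (a b j v x : ℕ) : walk f a b 0 j v x =
    cond (Nat.ble a j) (cond (Nat.ble b j) true (f j v x)) true := rfl

theorem walk_succ (f : ℕ → ℕ → ℕ → Bool) (a b l j v x : ℕ) : walk f a b (l + 1) j v x =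
    cond (or (Nat.ble b j) (Nat.ble (j + 2 <<< l) a)) true
      (cond (walk f a b l j v (lowBits x (40 <<< l)))
        (walk f a b l (j + 1 <<< l) (gridNext v l) (x >>> (40 <<< l))) false) := rfl

theorem walk_spec (f : ℕ → ℕ → ℕ → Bool) (a b l : ℕ) : ∀ j v x, OnGrid j v →
    walk f a b l j v x = true → ∀ i < 2 ^ l, a ≤ j + i → j + i < b →
    x < 2 ^ (40 * 2 ^ l) →
    ∃ w, OnGrid (j + i) w ∧ f (j + i) w (x / 2 ^ (40 * i) % 2 ^ 40) = true := by
  induction l with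
  | zero =>
    intro j v x hv h i hi ha hb hx
    obtain rfl : i = 0 := by simpa using hi
    rw [walk_zero, Nat.ble_eq_true_of_le (by lia), cond_true,
      show Nat.ble b j = false by rw [Bool.eq_false_iff, ne_eq, Nat.ble_eq]; lia, cond_false] at h
    refine ⟨v, hv, ?_⟩
    rw [pow_zero, mul_one] at hx
    rwa [mul_zero, pow_zero, Nat.div_one, Nat.mod_eq_of_lt hx]
  | succ l ih =>
    intro j v x hv h i hi ha hb hx
    rw [pow_succ] at hi
    rw [walk_succ, Nat.shiftLeft_eq 40, Nat.one_shiftLeft, Nat.shiftLeft_eq 2,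
      show Nat.ble b j = false by rw [Bool.eq_false_iff, ne_eq, Nat.ble_eq]; lia,
      show Nat.ble (j + 2 * 2 ^ l) a = false by rw [Bool.eq_false_iff, ne_eq, Nat.ble_eq]; lia,
      Bool.or_false, cond_false, Bool.cond_false_right, Bool.and_eq_true, lowBits_eq,
      Nat.shiftRight_eq_div_pow] at h
    rcases lt_or_ge i (2 ^ l) with hil | hil
    · obtain ⟨w, hw, hf⟩ := ih j v _ hv h.1 i hil ha hb (Nat.mod_lt _ (by positivity))
      refine ⟨w, hw, ?_⟩
      have : x % 2 ^ (40 * 2 ^ l) / 2 ^ (40 * i) % 2 ^ 40 = x / 2 ^ (40 * i) % 2 ^ 40 := by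
        rw [← Nat.mod_mul_right_div_self, ← Nat.mod_mul_right_div_self x, Nat.mod_mod_of_dvd]
        rw [← pow_add]
        exact pow_dvd_pow _ (by lia)
      rwa [this] at hf
    · have e : j + 2 ^ l + (i - 2 ^ l) = j + i := by lia
      obtain ⟨w, hw, hf⟩ := ih (j + 2 ^ l) (gridNext v l) _ (hv.gridNext l) h.2 (i - 2 ^ l)
        (by lia) (by lia) (by lia) (by
          rw [Nat.div_lt_iff_lt_mul (by positivity), ← pow_add]
          refine hx.trans_eq ?_
          congr 1
          ring)
      rw [e] at hw hf
      refine ⟨w, hw, ?_⟩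
      rw [Nat.div_div_eq_div_mul, ← pow_add, ← mul_add, Nat.add_sub_cancel' hil] at hf
      exact hf

section CompleteHomogeneous

variable {α : Type*} [DecidableEq α]

/-- The complete homogeneous symmetric polynomial of degree `k`, evaluated at the values of `f`
on `T`. -/
def completeSum (f : α → ℕ) (T : Finset α) (k : ℕ) : ℕ :=
  ∑ m ∈ T.sym k, ((m : Multiset α).map f).prod

theorem completeSum_zero (f : α → ℕ) (T : Finset α) : completeSum f T 0 = 1 := by
  rw [completeSum, Finset.sym_zero, Finset.sum_singleton]
  rfl

theorem completeSum_insert (f : α → ℕ) {T : Finset α} {a : α} (ha : a ∉ T) (k : ℕ) :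
    completeSum f (insert a T) (k + 1) =
      completeSum f T (k + 1) + f a * completeSum f (insert a T) k := by
  rw [completeSum, ← Finset.sum_filter_not_add_sum_filter _ (fun m => a ∈ m)]
  congr 1
  · refine Finset.sum_congr ?_ fun _ _ => rfl
    ext m
    rw [Finset.mem_filter, Finset.mem_sym_iff, Finset.mem_sym_iff]
    constructor
    · rintro ⟨h1, h2⟩ x hx
      rcases Finset.mem_insert.1 (h1 x hx) with rfl | h
      · exact absurd hx h2
      · exact h
    · exact fun h => ⟨fun x hx => Finset.mem_insert_of_mem (h x hx), fun h' => ha (h a h')⟩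
  · rw [completeSum, Finset.mul_sum]
    symm
    refine Finset.sum_bij (fun m _ => Sym.cons a m) ?_ ?_ ?_ ?_
    · intro m hm
      rw [Finset.mem_sym_iff] at hm
      rw [Finset.mem_filter, Finset.mem_sym_iff]
      refine ⟨fun x hx => ?_, Sym.mem_cons_self a m⟩
      rcases Sym.mem_cons.1 hx with rfl | h
      · exact Finset.mem_insert_self _ _
      · exact hm x h
    · intro m _ m' _ h
      exact Sym.cons_inj_right a m m' |>.1 h
    · intro m hm
      rw [Finset.mem_filter, Finset.mem_sym_iff] at hm
      refine ⟨m.erase a hm.2, ?_, Sym.cons_erase hm.2⟩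
      rw [Finset.mem_sym_iff]
      intro x hx
      refine hm.1 x ?_
      rw [← Sym.cons_erase hm.2]
      exact Sym.mem_cons_of_mem hx
    · intro m _
      rw [Sym.coe_cons, Multiset.map_cons, Multiset.prod_cons]

/-- Newton's identities for the complete homogeneous polynomials of degree at most five. -/
theorem newton_completeSum (f : α → ℕ) (T : Finset α) :
    let H := completeSum f T
    let p := fun j : ℕ => ∑ t ∈ T, f t ^ j
    H 1 = p 1 ∧ 2 * H 2 = p 1 * H 1 + p 2 ∧ 3 * H 3 = p 1 * H 2 + p 2 * H 1 + p 3 ∧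
      4 * H 4 = p 1 * H 3 + p 2 * H 2 + p 3 * H 1 + p 4 ∧
      5 * H 5 = p 1 * H 4 + p 2 * H 3 + p 3 * H 2 + p 4 * H 1 + p 5 := by
  intro H p
  simp only [H, p]
  clear H p
  induction T using Finset.induction with
  | empty => simp [completeSum]
  | insert a T ha ih =>
    obtain ⟨h1, h2, h3, h4, h5⟩ := ih
    have e1 := completeSum_insert f ha 0
    have e2 := completeSum_insert f ha 1
    have e3 := completeSum_insert f ha 2
    have e4 := completeSum_insert f ha 3
    have e5 := completeSum_insert f ha 4
    rw [completeSum_zero] at e1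
    simp only [zero_add, mul_one, one_add_one_eq_two, Nat.reduceAdd] at e1 e2 e3 e4 e5
    simp only [Finset.sum_insert ha]
    generalize completeSum f (insert a T) = K at *
    generalize completeSum f T = H at *
    generalize ∑ t ∈ T, f t ^ 1 = p₁ at *
    generalize ∑ t ∈ T, f t ^ 2 = p₂ at *
    generalize ∑ t ∈ T, f t ^ 3 = p₃ at *
    generalize ∑ t ∈ T, f t ^ 4 = p₄ at *
    generalize ∑ t ∈ T, f t ^ 5 = p₅ at *
    generalize f a = x at *
    have g1 : K 1 = x ^ 1 + p₁ := by
      rw [e1, h1]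
      ring
    have g2 : 2 * K 2 = (x ^ 1 + p₁) * K 1 + (x ^ 2 + p₂) := by
      linear_combination h2 + x * g1 + (2 : ℕ) * e2 - p₁ * e1
    have g3 : 3 * K 3 = (x ^ 1 + p₁) * K 2 + (x ^ 2 + p₂) * K 1 + (x ^ 3 + p₃) := by
      linear_combination h3 + x * g2 + (3 : ℕ) * e3 - p₁ * e2 - p₂ * e1
    have g4 : 4 * K 4 = (x ^ 1 + p₁) * K 3 + (x ^ 2 + p₂) * K 2 + (x ^ 3 + p₃) * K 1 +
        (x ^ 4 + p₄) := by
      linear_combination h4 + x * g3 + (4 : ℕ) * e4 - p₁ * e3 - p₂ * e2 - p₃ * e1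
    refine ⟨g1, g2, g3, g4, ?_⟩
    linear_combination h5 + x * g4 + (5 : ℕ) * e5 - p₁ * e4 - p₂ * e3 - p₃ * e2 - p₄ * e1

end CompleteHomogeneous

section Products

variable {α : Type*} [DecidableEq α] {T : Finset α} {b : α → ℕ}

/-- The sum of the values of `b` on a multiset. -/
def weight (b : α → ℕ) {k : ℕ} (m : Sym α k) : ℕ := ((m : Multiset α).map b).sum

theorem completeSum_two_pow (b : α → ℕ) (T : Finset α) (k : ℕ) :
    completeSum (fun t => 2 ^ (40 * b t)) T k = ∑ m ∈ T.sym k, 2 ^ (40 * weight b m) := by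
  refine Finset.sum_congr rfl fun m _ => ?_
  rw [weight]
  generalize (m : Multiset α) = s
  induction s using Multiset.induction with
  | empty => simp
  | cons a s ih =>
    rw [Multiset.map_cons, Multiset.prod_cons, ih, Multiset.map_cons, Multiset.sum_cons, ← pow_add,
      mul_add]

theorem truncLanes_div {k x : ℕ} (hk : 0 < k) (hk' : k ≤ 5)
    (hx : x ≡ k * completeSum (fun t => 2 ^ (40 * b t)) T k [MOD 2 ^ (40 * laneCount)])
    (hT : ((T.sym k).filter fun m => weight b m < laneCount).card < 2 ^ 36) :
    truncLanes x / k ≡ completeSum (fun t => 2 ^ (40 * b t)) T k [MOD 2 ^ (40 * laneCount)] := by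
  have hcard (i : ℕ) (hi : i < laneCount) :
      ((T.sym k).filter fun m => weight b m = i).card < 2 ^ 36 :=
    lt_of_le_of_lt (Finset.card_le_card fun m hm => by
      rw [Finset.mem_filter] at hm ⊢
      exact ⟨hm.1, by lia⟩) hT
  have e : k * completeSum (fun t => 2 ^ (40 * b t)) T k =
      ∑ q ∈ Finset.range k ×ˢ T.sym k, 2 ^ (40 * weight b q.2) := by
    rw [completeSum_two_pow, Finset.sum_product]
    simp only [Finset.sum_const, Finset.card_range, smul_eq_mul]
  have hf (p : ℕ → Prop) [DecidablePred p] :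
      (Finset.range k ×ˢ T.sym k).filter (fun q => p (weight b q.2)) =
      Finset.range k ×ˢ (T.sym k).filter fun m => p (weight b m) := by
    ext q
    simp only [Finset.mem_filter, Finset.mem_product, and_assoc]
  have h1 : truncLanes x = k * ∑ m ∈ T.sym k with weight b m < laneCount,
      2 ^ (40 * weight b m) := by
    rw [truncLanes_eq, hx, e, sum_lanes_mod, hf (· < laneCount), Finset.sum_product]
    · simp only [Finset.sum_const, Finset.card_range, smul_eq_mul]
    intro i hi
    rw [hf (· = i), Finset.card_product, Finset.card_range]
    have := hcard i hi
    have := Nat.mul_le_mul_right ((T.sym k).filter fun m => weight b m = i).card hk'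
    lia
  rw [h1, Nat.mul_div_cancel_left _ hk, completeSum_two_pow, ← sum_lanes_mod]
  · exact Nat.mod_modEq _ _
  · exact fun i hi => (hcard i hi).trans (by norm_num)

theorem compositeLanes_modEq (hT : T.card < 2 ^ 40)
    (h : ∀ k ≤ 5, ((T.sym k).filter fun m => weight b m < laneCount).card < 2 ^ 36) :
    compositeLanes (∑ t ∈ T, 2 ^ (40 * b t)) ≡
      ∑ k ∈ Finset.Icc 2 5, ∑ m ∈ T.sym k, 2 ^ (40 * weight b m)
      [MOD 2 ^ (40 * laneCount)] := by
  obtain ⟨h1, h2, h3, h4, h5⟩ := newton_completeSum (fun t => 2 ^ (40 * b t)) T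
  have hp (j : ℕ) (hj : 0 < j) : powerLanes (∑ t ∈ T, 2 ^ (40 * b t)) j ≡
      ∑ t ∈ T, (2 ^ (40 * b t)) ^ j [MOD 2 ^ (40 * laneCount)] := by
    refine (powerLanes_sum_lanes hj T b hT).trans (congrArg (· % 2 ^ (40 * laneCount)) ?_)
    refine Finset.sum_congr rfl fun t _ => ?_
    rw [← pow_mul]
    congr 1
    ring
  have hz : ∑ t ∈ T, 2 ^ (40 * b t) ≡ ∑ t ∈ T, (2 ^ (40 * b t)) ^ 1
      [MOD 2 ^ (40 * laneCount)] := by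
    simp only [pow_one, Nat.ModEq.refl]
  have hz' : ∑ t ∈ T, 2 ^ (40 * b t) ≡ completeSum (fun t => 2 ^ (40 * b t)) T 1
      [MOD 2 ^ (40 * laneCount)] := h1 ▸ hz
  have q2 := hp 2 (by norm_num)
  have q3 := hp 3 (by norm_num)
  have q4 := hp 4 (by norm_num)
  have q5 := hp 5 (by norm_num)
  generalize ∑ t ∈ T, 2 ^ (40 * b t) = Z at *
  have d2 : products2 Z ≡ completeSum (fun t => 2 ^ (40 * b t)) T 2 [MOD 2 ^ (40 * laneCount)] :=
    truncLanes_div (by norm_num) (by norm_num) (h2 ▸ (hz.mul hz').add q2) (h 2 (by norm_num))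
  have d3 : products3 Z ≡ completeSum (fun t => 2 ^ (40 * b t)) T 3 [MOD 2 ^ (40 * laneCount)] :=
    truncLanes_div (by norm_num) (by norm_num) (by
      rw [h3, add_assoc]
      exact (hz.mul d2).add ((q2.mul hz').add q3)) (h 3 (by norm_num))
  have d4 : products4 Z ≡ completeSum (fun t => 2 ^ (40 * b t)) T 4 [MOD 2 ^ (40 * laneCount)] :=
    truncLanes_div (by norm_num) (by norm_num) (by
      rw [h4, add_assoc, add_assoc]
      exact (hz.mul d3).add ((q2.mul d2).add ((q3.mul hz').add q4))) (h 4 (by norm_num))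
  have d5 : products5 Z ≡ completeSum (fun t => 2 ^ (40 * b t)) T 5 [MOD 2 ^ (40 * laneCount)] :=
    truncLanes_div (by norm_num) (by norm_num) (by
      rw [h5, add_assoc, add_assoc, add_assoc]
      exact (hz.mul d4).add ((q2.mul d3).add ((q3.mul d2).add ((q4.mul hz').add q5))))
      (h 5 (by norm_num))
  simp only [← completeSum_two_pow]
  rw [show Finset.Icc 2 5 = {2, 3, 4, 5} from rfl, Finset.sum_insert (by simp),
    Finset.sum_insert (by simp), Finset.sum_insert (by simp), Finset.sum_singleton]
  exact d2.add (d3.add (d4.add d5))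

end Products

theorem gridBase_pow_le_exp (n : ℕ) : gridBase ^ n ≤ Real.exp (n / 8192) := by
  have h : gridBase ≤ Real.exp (1 / 8192) :=
    le_trans (by norm_num [gridBase]) (Real.add_one_le_exp (1 / 8192))
  refine (pow_le_pow_left₀ gridBase_pos.le h n).trans_eq ?_
  rw [← Real.exp_nat_mul]
  ring_nf

theorem gridUpper_pow_lt {n : ℕ} (hn : n ≤ 175545) : gridUpper ^ n < 2 ^ 36 := by
  have hn' : (n : ℝ) ≤ 175545 := by exact_mod_cast hn
  have h1 : gridBase ^ n ≤ 2 ^ 32 := by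
    refine (gridBase_pow_le_exp n).trans ?_
    refine (Real.exp_le_exp.2 (show (n : ℝ) / 8192 ≤ (22 : ℕ) * 1 by norm_num; linarith)).trans ?_
    rw [Real.exp_nat_mul]
    refine (pow_le_pow_left₀ (Real.exp_pos _).le Real.exp_one_lt_d9.le 22).trans ?_
    norm_num
  have h2 : (1 + 2 * (n / 2 ^ 60) : ℝ) ≤ 2 := by
    norm_num
    linarith
  calc gridUpper ^ n ≤ gridBase ^ n * (1 + 2 * (n / 2 ^ 60)) :=
        gridUpper_pow_le (hn.trans (by norm_num))
    _ ≤ 2 ^ 32 * 2 := by gcongr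
    _ < 2 ^ 36 := by norm_num

theorem multiset_prod_injOn {S : Set (Multiset ℕ)} (hS : ∀ m ∈ S, ∀ p ∈ m, p.Prime) :
    S.InjOn Multiset.prod := by
  intro m hm m' hm' h
  rw [← UniqueFactorizationMonoid.normalizedFactors_prod_of_prime
      fun p hp => (hS m hm p hp).prime,
    ← UniqueFactorizationMonoid.normalizedFactors_prod_of_prime
      fun p hp => (hS m' hm' p hp).prime]
  exact congrArg _ h

theorem multiset_prod_le_pow {b : ℕ → ℕ} {m : Multiset ℕ}
    (h : ∀ p ∈ m, (p : ℝ) ≤ gridUpper ^ (b p + 1)) :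
    (m.prod : ℝ) ≤ gridUpper ^ ((m.map b).sum + m.card) := by
  induction m using Multiset.induction with
  | empty => simp
  | cons p m ih =>
    rw [Multiset.prod_cons, Multiset.map_cons, Multiset.sum_cons, Multiset.card_cons]
    have := mul_le_mul (h p (Multiset.mem_cons_self p m))
      (ih fun q hq => h q (Multiset.mem_cons_of_mem hq)) (by positivity)
      (by have := one_lt_gridUpper; positivity)
    rw [← pow_add] at this
    rw [Nat.cast_mul]
    exact this.trans_eq (congrArg _ (by ring))

theorem pow_le_multiset_prod {b : ℕ → ℕ} {m : Multiset ℕ}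
    (h : ∀ p ∈ m, gridBase ^ b p ≤ (p : ℝ)) : gridBase ^ (m.map b).sum ≤ (m.prod : ℝ) := by
  induction m using Multiset.induction with
  | empty => simp
  | cons p m ih =>
    rw [Multiset.prod_cons, Multiset.map_cons, Multiset.sum_cons, pow_add, Nat.cast_mul]
    exact mul_le_mul (h p (Multiset.mem_cons_self p m))
      (ih fun q hq => h q (Multiset.mem_cons_of_mem hq)) (pow_nonneg gridBase_pos.le _)
      (by positivity)

theorem card_multisets_lt {b : ℕ → ℕ} (hb : ∀ p ∈ gridPrimes, (p : ℝ) ≤ gridUpper ^ (b p + 1))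
    {ι : Type*} {S : Finset ι} (g : ι → Multiset ℕ) (hg : Set.InjOn g S)
    (hS : ∀ i ∈ S, (∀ p ∈ g i, p ∈ gridPrimes) ∧ ((g i).map b).sum + (g i).card ≤ 175545) :
    S.card < 2 ^ 36 := by
  have hprime : ∀ m ∈ g '' S, ∀ p ∈ m, p.Prime := by
    rintro m ⟨i, hi, rfl⟩ p hp
    exact (mem_gridPrimes.1 ((hS i hi).1 p hp)).2.2
  have h : S.card ≤ (Finset.Ico 1 (2 ^ 36)).card := by
    refine Finset.card_le_card_of_injOn (fun i => (g i).prod) (fun i hi => ?_) fun i hi i' hi' h =>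
      hg hi hi' (multiset_prod_injOn hprime ⟨i, hi, rfl⟩ ⟨i', hi', rfl⟩ h)
    obtain ⟨h1, h2⟩ := hS i hi
    rw [Finset.mem_coe, Finset.mem_Ico]
    constructor
    · exact Nat.pos_of_ne_zero (Multiset.prod_ne_zero fun h0 =>
        absurd (mem_gridPrimes.1 (h1 0 h0)).2.1 (by norm_num))
    · have := (multiset_prod_le_pow fun p hp => hb p (h1 p hp)).trans_lt (gridUpper_pow_lt h2)
      exact_mod_cast this
  rw [Nat.card_Ico] at h
  lia

/-- The multisets of two to five elements of `gridPrimes`. -/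
def gridComposites : Finset (Σ k, Sym ℕ k) := (Finset.Icc 2 5).sigma fun k => gridPrimes.sym k

theorem gridComposites_eq :
    gridComposites = (Finset.Icc 2 5).sigma fun k => gridPrimes.sym k := rfl

attribute [irreducible] gridComposites

theorem mem_gridComposites {q : Σ k, Sym ℕ k} :
    q ∈ gridComposites ↔ (2 ≤ q.1 ∧ q.1 ≤ 5) ∧ ∀ p ∈ q.2, p ∈ gridPrimes := by
  rw [gridComposites_eq, Finset.mem_sigma, Finset.mem_Icc, Finset.mem_sym_iff]

theorem sigma_sym_ext {q q' : Σ k, Sym ℕ k} (h : (q.2 : Multiset ℕ) = q'.2) : q = q' := by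
  obtain ⟨k, m, hm⟩ := q
  obtain ⟨k', m', hm'⟩ := q'
  obtain rfl : m = m' := h
  obtain rfl : k = k' := hm.symm.trans hm'
  rfl

theorem card_gridComposites_lt {b : ℕ → ℕ}
    (hb : ∀ p ∈ gridPrimes, (p : ℝ) ≤ gridUpper ^ (b p + 1)) {J : ℕ} (hJ : J < laneCount) :
    (gridComposites.filter fun q => weight b q.2 ≤ J).card < 2 ^ 36 := by
  refine card_multisets_lt hb (fun q : Σ k, Sym ℕ k => (q.2 : Multiset ℕ))
    (fun q _ q' _ h => sigma_sym_ext h) ?_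
  intro q hq
  obtain ⟨hq, hw⟩ := Finset.mem_filter.1 hq
  obtain ⟨⟨-, hk⟩, hp⟩ := mem_gridComposites.1 hq
  refine ⟨hp, ?_⟩
  rw [Sym.card_coe]
  have hJ' : J < 175540 := hJ
  exact (Nat.add_le_add hw hk).trans (by lia)

theorem compositeLanes_lane {b : ℕ → ℕ}
    (hb : ∀ p ∈ gridPrimes, (p : ℝ) ≤ gridUpper ^ (b p + 1)) {J : ℕ} (hJ : J < laneCount) :
    prefixSums 18 (compositeLanes (∑ p ∈ gridPrimes, 2 ^ (40 * b p))) / 2 ^ (40 * J) % 2 ^ 40 =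
      (gridComposites.filter fun q => weight b q.2 ≤ J).card := by
  refine prefixSums_lane gridComposites (fun q => weight b q.2) hJ ?_
    ((card_gridComposites_lt hb hJ).trans (by norm_num))
  rw [gridComposites_eq, Finset.sum_sigma]
  refine compositeLanes_modEq ?_ fun k hk => ?_
  · refine lt_of_le_of_lt (Finset.card_filter_le _ _) ?_
    rw [Finset.card_range]
    norm_num
  · refine card_multisets_lt hb (fun m : Sym ℕ k => (m : Multiset ℕ))
      (fun m _ m' _ h => Sym.coe_injective h) fun m hm => ?_
    rw [Finset.mem_filter, Finset.mem_sym_iff, weight, laneCount] at hm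
    refine ⟨hm.1, ?_⟩
    rw [Sym.card_coe]
    lia

theorem primeLanes_lane {b : ℕ → ℕ} {J : ℕ} (hJ : J < laneCount) :
    prefixSums 18 (∑ p ∈ gridPrimes, 2 ^ (40 * b p)) / 2 ^ (40 * J) % 2 ^ 40 =
      (gridPrimes.filter fun p => b p ≤ J).card := by
  refine prefixSums_lane gridPrimes b hJ rfl ?_
  refine lt_of_le_of_lt ((Finset.card_filter_le _ _).trans (Finset.card_filter_le _ _)) ?_
  rw [Finset.card_range]
  norm_num

theorem prefixSums_lt {l : ℕ} (hl : 0 < l) (x : ℕ) : prefixSums l x < 2 ^ (40 * laneCount) := by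
  obtain ⟨l, rfl⟩ := Nat.exists_eq_add_of_lt hl
  rw [zero_add]
  clear hl
  induction l generalizing x with
  | zero =>
    have : prefixSums (0 + 1) x = truncLanes (x + x <<< (40 <<< 0)) := rfl
    rw [this, truncLanes_eq]
    exact Nat.mod_lt _ (by positivity)
  | succ l ih =>
    rw [prefixSums_succ]
    exact ih _

/-- The positive integers up to `N` that are coprime to `P`. -/
def coprimeUpTo (P N : ℕ) : Finset ℕ := (Finset.Icc 1 N).filter fun n => n.Coprime P

theorem mem_coprimeUpTo {P N n : ℕ} : n ∈ coprimeUpTo P N ↔ (1 ≤ n ∧ n ≤ N) ∧ n.Coprime P := by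
  rw [coprimeUpTo, Finset.mem_filter, Finset.mem_Icc]

theorem card_coprimeUpTo_mul {P p : ℕ} (hp : p.Prime) (h : p.Coprime P) (N : ℕ) :
    (coprimeUpTo (p * P) N).card + (coprimeUpTo P (N / p)).card = (coprimeUpTo P N).card := by
  rw [← Finset.card_filter_add_card_filter_not (s := coprimeUpTo P N) (fun n => n.Coprime p)]
  congr 1
  · congr 1
    ext n
    rw [Finset.mem_filter, mem_coprimeUpTo, mem_coprimeUpTo, Nat.coprime_mul_iff_right]
    tauto
  · refine Finset.card_bij (fun n _ => p * n) ?_ ?_ ?_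
    · intro n hn
      rw [mem_coprimeUpTo] at hn
      rw [Finset.mem_filter, mem_coprimeUpTo]
      refine ⟨⟨⟨Nat.mul_pos hp.pos hn.1.1, ?_⟩, Nat.Coprime.mul_left h hn.2⟩, ?_⟩
      · rw [mul_comm]
        exact (Nat.le_div_iff_mul_le hp.pos).1 hn.1.2
      · intro hc
        exact hp.one_lt.ne' (Nat.eq_one_of_dvd_coprimes hc (dvd_mul_right p n) dvd_rfl)
    · intro n _ n' _ hnn
      exact Nat.eq_of_mul_eq_mul_left hp.pos hnn
    · intro n hn
      rw [Finset.mem_filter, mem_coprimeUpTo, Nat.coprime_comm (m := p), hp.coprime_iff_not_dvd,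
        not_not] at hn
      obtain ⟨⟨⟨h1, h2⟩, h3⟩, m, rfl⟩ := hn
      refine ⟨m, ?_, rfl⟩
      rw [mem_coprimeUpTo]
      refine ⟨⟨Nat.pos_of_ne_zero fun h0 => by simp [h0] at h1, ?_⟩, h3.coprime_mul_left⟩
      rw [Nat.le_div_iff_mul_le hp.pos, mul_comm]
      exact h2

/-- The number of integers up to `N` coprime to `P` lies between `N * δ - a` and `N * δ + b`. -/
def CoprimeBound (P : ℕ) (δ a b : ℝ) : Prop :=
  ∀ N : ℕ, N * δ - a ≤ (coprimeUpTo P N).card ∧ ((coprimeUpTo P N).card : ℝ) ≤ N * δ + b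

theorem coprimeBound_one : CoprimeBound 1 1 0 0 := by
  intro N
  have : coprimeUpTo 1 N = Finset.Icc 1 N := by
    simp [coprimeUpTo]
  simp [this]

theorem CoprimeBound.mul {P : ℕ} {δ a b : ℝ} (h : CoprimeBound P δ a b) (hδ : 0 ≤ δ) {p : ℕ}
    (hp : p.Prime) (hP : p.Coprime P) {δ' a' b' : ℝ} (hδ' : δ' = δ * ((p - 1) / p))
    (ha' : a + b = a') (hb' : a + b + δ' = b') : CoprimeBound (p * P) δ' a' b' := by
  intro N
  have hp0 : (0 : ℝ) < p := by exact_mod_cast hp.pos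
  have e : ((coprimeUpTo (p * P) N).card : ℝ) + (coprimeUpTo P (N / p)).card =
      (coprimeUpTo P N).card := by exact_mod_cast card_coprimeUpTo_mul hp hP N
  obtain ⟨h1, h2⟩ := h N
  obtain ⟨h3, h4⟩ := h (N / p)
  have h5 : ((N / p : ℕ) : ℝ) ≤ N / p := Nat.cast_div_le
  have h6 : ((N : ℝ) - (p - 1)) / p ≤ (N / p : ℕ) := by
    rw [div_le_iff₀ hp0]
    have := Nat.div_add_mod N p
    have h7 := Nat.mod_lt N hp.pos
    have h8 : N + 1 ≤ N / p * p + p := by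
      rw [mul_comm]
      lia
    have h9 : (N : ℝ) + 1 ≤ (N / p : ℕ) * p + p := by exact_mod_cast h8
    linarith
  have h7 := mul_le_mul_of_nonneg_right h5 hδ
  have h8 := mul_le_mul_of_nonneg_right h6 hδ
  have e1 : (N : ℝ) * δ' = N * δ - N / p * δ := by
    rw [hδ']
    field_simp
  have e2 : ((N : ℝ) - (p - 1)) / p * δ = N / p * δ - δ' := by
    rw [hδ']
    field_simp
  constructor <;> linarith

theorem coprimeBound_primorial :
    CoprimeBound 7420738134810 (1103619686400 / 7420738134810) 1427 1428 := by
  have h2 := coprimeBound_one.mul zero_le_one Nat.prime_two (by norm_num) rfl rfl rfl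
  norm_num at h2
  have h3 := h2.mul (by norm_num) Nat.prime_three (by norm_num) rfl rfl rfl
  norm_num at h3
  have h5 := h3.mul (by norm_num) Nat.prime_five (by norm_num) rfl rfl rfl
  norm_num at h5
  have h7 := h5.mul (by norm_num) (show Nat.Prime 7 by norm_num) (by norm_num) rfl rfl rfl
  norm_num at h7
  have h11 := h7.mul (by norm_num) (show Nat.Prime 11 by norm_num) (by norm_num) rfl rfl rfl
  norm_num at h11
  have h13 := h11.mul (by norm_num) (show Nat.Prime 13 by norm_num) (by norm_num) rfl rfl rfl
  norm_num at h13
  have h17 := h13.mul (by norm_num) (show Nat.Prime 17 by norm_num) (by norm_num) rfl rfl rfl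
  norm_num at h17
  have h19 := h17.mul (by norm_num) (show Nat.Prime 19 by norm_num) (by norm_num) rfl rfl rfl
  norm_num at h19
  have h23 := h19.mul (by norm_num) (show Nat.Prime 23 by norm_num) (by norm_num) rfl rfl rfl
  norm_num at h23
  have h29 := h23.mul (by norm_num) (show Nat.Prime 29 by norm_num) (by norm_num) rfl rfl rfl
  norm_num at h29
  have h31 := h29.mul (by norm_num) (show Nat.Prime 31 by norm_num) (by norm_num) rfl rfl rfl
  norm_num at h31
  have h37 := h31.mul (by norm_num) (show Nat.Prime 37 by norm_num) (by norm_num) rfl rfl rfl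
  norm_num at h37
  intro N
  have := h37 N
  norm_num at this ⊢
  constructor <;> linarith

theorem le_of_prime_of_coprime {p n : ℕ} (hp : p.Prime) (hpn : p ∣ n)
    (hn : n.Coprime 7420738134810) : 41 ≤ p := by
  by_contra! h
  have h1 : ¬ p ∣ 7420738134810 := fun h =>
    hp.one_lt.ne' (Nat.eq_one_of_dvd_coprimes hn hpn h)
  interval_cases p <;> first | (norm_num at hp; done) | norm_num at h1

theorem card_composites_le {b : ℕ → ℕ} (hb : ∀ p ∈ gridPrimes, gridBase ^ b p ≤ (p : ℝ))
    {N J : ℕ} (hN : (N : ℝ) < gridBase ^ (J + 1)) (hN' : N < 41 * 49319020) :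
    ((coprimeUpTo 7420738134810 N).filter fun n => n ≠ 1 ∧ ¬ n.Prime).card ≤
      (gridComposites.filter fun q => weight b q.2 ≤ J).card := by
  refine Finset.card_le_card_of_injOn
    (fun n => ⟨n.primeFactorsList.length, ⟨n.primeFactorsList, rfl⟩⟩) (fun n hn => ?_) ?_
  · rw [Finset.mem_coe, Finset.mem_filter, mem_coprimeUpTo] at hn
    obtain ⟨⟨⟨h1, h2⟩, h3⟩, h4, h5⟩ := hn
    have hn0 : n ≠ 0 := by lia
    have hge : ∀ p ∈ n.primeFactorsList, 41 ≤ p := fun p hp =>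
      le_of_prime_of_coprime (Nat.prime_of_mem_primeFactorsList hp)
        (Nat.dvd_of_mem_primeFactorsList hp) h3
    have hgrid : ∀ p ∈ n.primeFactorsList, p ∈ gridPrimes := by
      intro p hp
      have hpp := Nat.prime_of_mem_primeFactorsList hp
      rw [mem_gridPrimes]
      refine ⟨?_, hge p hp, hpp⟩
      obtain ⟨m, rfl⟩ := Nat.dvd_of_mem_primeFactorsList hp
      have hm1 : m ≠ 1 := by
        rintro rfl
        rw [mul_one] at h5
        exact h5 hpp
      have hm : 41 ≤ m.minFac := le_of_prime_of_coprime (Nat.minFac_prime hm1)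
        ((Nat.minFac_dvd m).trans (dvd_mul_left m p)) h3
      have hm' : 41 ≤ m := hm.trans (Nat.minFac_le (Nat.pos_of_ne_zero fun h => by simp [h] at hn0))
      by_contra! hlt
      have := Nat.mul_le_mul hlt hm'
      lia
    have hprod := Nat.prod_primeFactorsList hn0
    rw [Finset.mem_coe, Finset.mem_filter, mem_gridComposites]
    refine ⟨⟨⟨?_, ?_⟩, hgrid⟩, ?_⟩
    · dsimp only
      by_contra! h
      rcases hl : n.primeFactorsList with _ | ⟨p, _ | ⟨q, L⟩⟩
      · rw [hl] at hprod
        exact h4 (by simpa using hprod.symm)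
      · rw [hl] at hprod
        refine h5 ?_
        rw [← hprod, List.prod_singleton]
        exact Nat.prime_of_mem_primeFactorsList (n := n) (by simp [hl])
      · simp [hl] at h
    · dsimp only
      by_contra! h
      have h6 := List.pow_card_le_prod n.primeFactorsList 41 hge
      rw [hprod] at h6
      have := Nat.pow_le_pow_right (show 0 < 41 by norm_num) h
      norm_num at this
      lia
    · have h6 := pow_le_multiset_prod (b := b) (m := n.primeFactorsList) fun p hp =>
        hb p (hgrid p hp)
      rw [Multiset.prod_coe, hprod] at h6
      have h7 : (n : ℝ) ≤ N := by exact_mod_cast h2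
      exact Nat.lt_succ_iff.1 ((pow_lt_pow_iff_right₀ one_lt_gridBase).1 (by
        exact (h6.trans h7).trans_lt hN))
  · intro n hn n' hn' h
    rw [Finset.mem_coe, Finset.mem_filter, mem_coprimeUpTo] at hn hn'
    have h' : (n.primeFactorsList : Multiset ℕ) = n'.primeFactorsList :=
      congrArg (fun q : Σ k, Sym ℕ k => (q.2 : Multiset ℕ)) h
    have := congrArg Multiset.prod h'
    rwa [Multiset.prod_coe, Multiset.prod_coe, Nat.prod_primeFactorsList (by lia),
      Nat.prod_primeFactorsList (by lia)] at this

theorem primeCounting_ge {N : ℕ} (hN : 37 ≤ N) {s : Finset ℕ}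
    (hs : ∀ p ∈ s, 41 ≤ p ∧ p ≤ N ∧ p.Prime) : 12 + s.card ≤ N.primeCounting := by
  have h : (Nat.primesBelow 38 ∪ s).card ≤ N.primeCounting := by
    rw [Nat.primeCounting, ← Nat.primesBelow_card_eq_primeCounting']
    refine Finset.card_le_card fun p hp => ?_
    rw [Nat.mem_primesBelow]
    rcases Finset.mem_union.1 hp with hp | hp
    · rw [Nat.mem_primesBelow] at hp
      exact ⟨by lia, hp.2⟩
    · exact ⟨by have := hs p hp; lia, (hs p hp).2.2⟩
  rw [Finset.card_union_of_disjoint] at h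
  · rwa [show (Nat.primesBelow 38).card = 12 by decide] at h
  · rw [Finset.disjoint_left]
    intro p hp hp'
    have := hs p hp'
    have := Nat.lt_of_mem_primesBelow hp
    lia

theorem le_primeCounting_add_card {b : ℕ → ℕ} (hb : ∀ p ∈ gridPrimes, gridBase ^ b p ≤ (p : ℝ))
    {N J : ℕ} (hN : (N : ℝ) < gridBase ^ (J + 1)) (hN' : N < 41 * 49319020) (hN'' : 37 ≤ N) :
    (N : ℝ) * (1103619686400 / 7420738134810) - 1416 ≤
      N.primeCounting + (gridComposites.filter fun q => weight b q.2 ≤ J).card := by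
  have h1 := (coprimeBound_primorial N).1
  have h2 := card_composites_le hb hN hN'
  have h3 := primeCounting_ge hN'' (s := (coprimeUpTo 7420738134810 N).filter Nat.Prime) (by
    intro p hp
    rw [Finset.mem_filter, mem_coprimeUpTo] at hp
    exact ⟨le_of_prime_of_coprime hp.2 dvd_rfl hp.1.2, hp.1.1.2, hp.2⟩)
  have h4 : (coprimeUpTo 7420738134810 N).card ≤
      1 + ((coprimeUpTo 7420738134810 N).filter Nat.Prime).card +
        ((coprimeUpTo 7420738134810 N).filter fun n => n ≠ 1 ∧ ¬ n.Prime).card := by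
    have : coprimeUpTo 7420738134810 N ⊆
        {1} ∪ (coprimeUpTo 7420738134810 N).filter Nat.Prime ∪
          (coprimeUpTo 7420738134810 N).filter fun n => n ≠ 1 ∧ ¬ n.Prime := by
      intro n hn
      simp only [Finset.mem_union, Finset.mem_filter, Finset.mem_singleton]
      tauto
    refine (Finset.card_le_card this).trans ((Finset.card_union_le _ _).trans ?_)
    gcongr
    exact Finset.card_union_le _ _
  have h5 : (coprimeUpTo 7420738134810 N).card + 11 ≤ N.primeCounting +
      (gridComposites.filter fun q => weight b q.2 ≤ J).card := by lia
  have h6 : ((coprimeUpTo 7420738134810 N).card : ℝ) + 11 ≤ N.primeCounting +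
      (gridComposites.filter fun q => weight b q.2 ≤ J).card := by exact_mod_cast h5
  linarith

attribute [irreducible] lowRangeCheck highRangeCheck primeLanes

theorem exp_le_gridBase_pow (n : ℕ) : Real.exp (2 * n / 16385) ≤ gridBase ^ n := by
  have h := Real.le_log_one_add_of_nonneg (show (0 : ℝ) ≤ 1 / 8192 by norm_num)
  rw [show (1 + 1 / 8192 : ℝ) = gridBase by norm_num [gridBase],
    Real.le_log_iff_exp_le gridBase_pos] at h
  refine le_trans (le_of_eq ?_) (pow_le_pow_left₀ (Real.exp_pos _).le h n)
  rw [← Real.exp_nat_mul]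
  congr 1
  ring

theorem le_gridBase_pow {J : ℕ} (hJ : 43881 ≤ J) : 37 ≤ gridBase ^ J := by
  have hJ' : (43881 : ℝ) ≤ J := by exact_mod_cast hJ
  refine le_trans ?_ (exp_le_gridBase_pow J)
  refine le_trans ?_ (Real.exp_le_exp.2 (show ((5 : ℕ) : ℝ) * 1 ≤ 2 * J / 16385 by
    norm_num; linarith))
  rw [Real.exp_nat_mul]
  refine le_trans ?_ (pow_le_pow_left₀ (by norm_num) Real.exp_one_gt_d9.le 5)
  norm_num

theorem liNum_div_liDen (c₁ c₂ : ℕ) {j : ℕ} (hj : 0 < j) : (liNum c₁ c₂ j : ℝ) / liDen j =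
    1 / (2 * j / 16385) + c₁ / (2 * j / 16385) ^ 2 + 2 * c₂ / (2 * j / 16385) ^ 3 := by
  have h1 : liNum c₁ c₂ j = 32770 * j * j + (c₁ * (268468225 * j) + c₂ * 4398851866625) := rfl
  have h2 : liDen j = 4 * (j * (j * j)) := rfl
  have h3 : (j : ℝ) ≠ 0 := by positivity
  rw [h1, h2]
  push_cast
  field_simp
  ring

theorem liDen_pos {j : ℕ} (hj : 0 < j) : 0 < liDen j := by
  have h2 : liDen j = 4 * (j * (j * j)) := rfl
  rw [h2]
  positivity

theorem lowNum_eq (j : ℕ) : lowNum j =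
    if 131644 ≤ j then liNum 1 1 j else if 87762 ≤ j then liNum 1 0 j else liNum 0 0 j := by
  have h : lowNum j = cond (Nat.ble 131644 j) (liNum 1 1 j)
    (cond (Nat.ble 87762 j) (liNum 1 0 j) (liNum 0 0 j)) := rfl
  rw [h]
  simp only [cond_eq_ite, Nat.ble_eq]

theorem le_of_lowCheck {j v d : ℕ} (h : lowCheck j v d = true) :
    gridNext v 0 * lowNum j ≤ (12 + d) * liDen j * 2 ^ 60 := by
  have h' : gridNext v 0 * lowNum j ≤ ((12 + d) * liDen j) <<< 60 := Nat.le_of_ble_eq_true h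
  rwa [Nat.shiftLeft_eq] at h'

theorem le_of_highCheck {j v d : ℕ} (h : highCheck j v d = true) :
    gridNext v 0 ≤ 41 * 49319020 * 2 ^ 60 ∧
      v * (7420738134810 * liNum 1 1 j) + 7420738134810 * ((d + 1430) * liDen j) * 2 ^ 60 ≤
        v * (1103619686400 * liDen j) := by
  rw [highCheck, Bool.and_eq_true] at h
  have h1 : gridNext v 0 ≤ (41 * 49319020) <<< 60 := Nat.le_of_ble_eq_true h.1
  have h2 : v * (7420738134810 * liNum 1 1 j) +
      (7420738134810 * ((d + 1430) * liDen j)) <<< 60 ≤ v * (1103619686400 * liDen j) :=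
    Nat.le_of_ble_eq_true h.2
  rw [Nat.shiftLeft_eq] at h1 h2
  exact ⟨h1, h2⟩

theorem exists_lowCheck_of_walk {P : ℕ}
    (hcheck : walk lowCheck 43881 145100 18 0 gridOne (P.shiftLeft 80) = true)
    (hlt : P < 2 ^ (40 * laneCount)) {i d : ℕ} (hi : 43881 ≤ i + 2) (hi' : i + 2 < 145100)
    (hlane : P / 2 ^ (40 * i) % 2 ^ 40 = d) :
    ∃ w, OnGrid (i + 2) w ∧ lowCheck (i + 2) w d = true := by
  have hshift : P.shiftLeft 80 = P * 2 ^ 80 := Nat.shiftLeft_eq P 80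
  rw [hshift] at hcheck
  have hlt' : P * 2 ^ 80 < 2 ^ (40 * 2 ^ 18) := by
    refine (Nat.mul_lt_mul_of_pos_right hlt (by positivity)).trans_le ?_
    rw [← pow_add]
    exact Nat.pow_le_pow_right (by norm_num) (by rw [laneCount]; norm_num)
  obtain ⟨w, hw, hf⟩ := walk_spec lowCheck 43881 145100 18 0 gridOne (P * 2 ^ 80)
    onGrid_gridOne hcheck (i + 2) (by lia) (by lia) (by lia) hlt'
  have hlane' : P * 2 ^ 80 / 2 ^ (40 * (i + 2)) % 2 ^ 40 = d := by
    rw [← hlane, mul_add, pow_add]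
    exact congrArg (· % 2 ^ 40) (Nat.mul_div_mul_right _ _ (by positivity))
  rw [hlane', zero_add] at hf
  rw [zero_add] at hw
  exact ⟨w, hw, hf⟩

theorem exists_lowCheck (hcheck : lowRangeCheck = true) {i : ℕ} (hi : 43881 ≤ i + 2)
    (hi' : i + 2 < 145100) {b : ℕ → ℕ} (hlanes : primeLanes = ∑ p ∈ gridPrimes, 2 ^ (40 * b p)) :
    ∃ w, OnGrid (i + 2) w ∧
      lowCheck (i + 2) w (gridPrimes.filter fun p => b p ≤ i).card = true := by
  have hi'' : i < laneCount := by
    rw [laneCount]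
    lia
  rw [lowRangeCheck, hlanes] at hcheck
  exact exists_lowCheck_of_walk hcheck (prefixSums_lt (by norm_num) _) hi hi'
    (primeLanes_lane hi'')

theorem lowRange_primeCounting (hcheck : lowRangeCheck = true) {J : ℕ} (hJ : 43881 ≤ J)
    (hJ' : J < 145100) {x : ℝ} (hx : gridBase ^ J ≤ x) :
    gridBase ^ (J + 1) * (lowNum J / liDen J) ≤ (⌊x⌋₊.primeCounting : ℝ) := by
  obtain ⟨b, hb, hlanes⟩ := exists_primeLanes
  obtain ⟨i, rfl⟩ : ∃ i, J = i + 2 := ⟨J - 2, by lia⟩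
  obtain ⟨w, hw, hf⟩ := exists_lowCheck hcheck hJ hJ' hlanes
  have hf' := le_of_lowCheck hf
  have hx37 := (le_gridBase_pow hJ).trans hx
  have hx0 : 0 ≤ x := by linarith
  have hcard := primeCounting_ge (N := ⌊x⌋₊) (Nat.le_floor (by exact_mod_cast hx37))
    (s := gridPrimes.filter fun p => b p ≤ i) (by
      intro p hp
      obtain ⟨hp, hpi⟩ := Finset.mem_filter.1 hp
      obtain ⟨-, h41, hpp⟩ := mem_gridPrimes.1 hp
      refine ⟨h41, Nat.le_floor ?_, hpp⟩
      have hi : (i : ℝ) + 2 < 145100 := by exact_mod_cast hJ'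
      calc (p : ℝ) ≤ gridUpper ^ (b p + 1) := (hb p hp).2.2
        _ ≤ gridUpper ^ (i + 1) := pow_le_pow_right₀ one_lt_gridUpper.le (by lia)
        _ ≤ gridBase ^ (i + 1) * (1 + 2 * ((i + 1 : ℕ) / 2 ^ 60)) :=
          gridUpper_pow_le (by norm_num; lia)
        _ ≤ gridBase ^ (i + 1) * gridBase := by
          refine mul_le_mul_of_nonneg_left ?_ (pow_nonneg gridBase_pos.le _)
          rw [gridBase]
          push_cast
          norm_num
          linarith
        _ = gridBase ^ (i + 2) := (pow_succ _ _).symm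
        _ ≤ x := hx)
  have hnext := (hw.gridNext 0).1
  rw [pow_zero] at hnext
  have hf'' : (LogGrid.gridNext w 0 : ℝ) * lowNum (i + 2) ≤
      ((12 + (gridPrimes.filter fun p => b p ≤ i).card : ℕ) : ℝ) * liDen (i + 2) * 2 ^ 60 := by
    exact_mod_cast hf'
  have hden : (0 : ℝ) < liDen (i + 2) := by exact_mod_cast liDen_pos (by lia)
  have hcard' : ((12 + (gridPrimes.filter fun p => b p ≤ i).card : ℕ) : ℝ) ≤
      ⌊x⌋₊.primeCounting := by exact_mod_cast hcard
  refine le_trans ?_ hcard'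
  rw [← mul_div_assoc, div_le_iff₀ hden]
  have := mul_le_mul_of_nonneg_right hnext (Nat.cast_nonneg (α := ℝ) (lowNum (i + 2)))
  have h60 : (0 : ℝ) < 2 ^ 60 := by positivity
  refine le_of_mul_le_mul_left ?_ h60
  calc (2 : ℝ) ^ 60 * (gridBase ^ (i + 2 + 1) * lowNum (i + 2))
      = 2 ^ 60 * gridBase ^ (i + 2 + 1) * lowNum (i + 2) := by ring
    _ ≤ _ := this.trans hf''
    _ = _ := by ring

theorem exists_highCheck (hcheck : highRangeCheck = true) {J : ℕ} (hJ : 145100 ≤ J)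
    (hJ' : J < 175540) {b : ℕ → ℕ} (hb : ∀ p ∈ gridPrimes, (p : ℝ) ≤ gridUpper ^ (b p + 1))
    (hlanes : primeLanes = ∑ p ∈ gridPrimes, 2 ^ (40 * b p)) :
    ∃ w, OnGrid J w ∧
      highCheck J w (gridComposites.filter fun q => weight b q.2 ≤ J).card = true := by
  rw [highRangeCheck, hlanes] at hcheck
  have hlt := prefixSums_lt (l := 18) (by norm_num)
    (compositeLanes (∑ p ∈ gridPrimes, 2 ^ (40 * b p)))
  have hlane := compositeLanes_lane hb (show J < laneCount from hJ')
  obtain ⟨w, hw, hf⟩ := walk_spec highCheck 145100 175540 18 0 gridOne _ onGrid_gridOne hcheck J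
    (by lia) (by lia) (by lia)
    (hlt.trans_le (Nat.pow_le_pow_right (by norm_num) (by rw [laneCount]; norm_num)))
  rw [hlane, zero_add] at hf
  rw [zero_add] at hw
  exact ⟨w, hw, hf⟩

/-- The inequality checked in the upper range, transferred from the grid point `w` to `x`. -/
theorem mul_le_of_grid_inequality {w d n D x c r : ℝ} (hw : 0 ≤ w) (hd : 0 ≤ d) (hn : 0 ≤ n)
    (hD : 0 < D) (hr : 0 < r) (hcr : c ≤ r)
    (h : w * (r * n) + r * ((d + 1430) * D) * 2 ^ 60 ≤ w * (c * D))
    (hwx : w ≤ 2 ^ 60 * (x + 1)) : d + 1429 ≤ x * (c / r) - x * (n / D) := by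
  obtain ⟨γ, hγ⟩ : ∃ γ : ℝ, γ = c / r - n / D := ⟨_, rfl⟩
  have h60 : (0 : ℝ) < 2 ^ 60 := by positivity
  generalize (2 : ℝ) ^ 60 = S at h hwx h60
  have hV : (d + 1430) * S ≤ w * γ := by
    have : w * γ * (r * D) = w * (c * D) - w * (r * n) := by
      rw [hγ]
      field_simp
    refine le_of_mul_le_mul_right ?_ (mul_pos hr hD)
    rw [this]
    linarith
  have hγ0 : 0 ≤ γ := by
    by_contra! h'
    have h1 := mul_nonpos_of_nonneg_of_nonpos hw h'.le
    have h2 : 0 < (d + 1430) * S := by positivity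
    linarith
  have hγ1 : γ ≤ 1 := by
    have h1 : 0 ≤ n / D := by positivity
    have h2 : c / r ≤ 1 := (div_le_one hr).2 hcr
    linarith
  have h3 : d + 1430 ≤ (x + 1) * γ := by
    have := hV.trans (mul_le_mul_of_nonneg_right hwx hγ0)
    refine le_of_mul_le_mul_right (this.trans_eq ?_) h60
    ring
  rw [← mul_sub, ← hγ]
  linarith

theorem OnGrid.le_of_pow_le {J w : ℕ} (hw : OnGrid J w) (hJ : J < 175540) {x : ℝ}
    (hx : gridBase ^ J ≤ x) (hx' : x < 41 * 49319020) : (w : ℝ) ≤ 2 ^ 60 * (x + 1) := by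
  refine hw.2.trans (mul_le_mul_of_nonneg_left ?_ (by positivity))
  refine (gridUpper_pow_le (by norm_num; lia)).trans ?_
  have hJ' : (J : ℝ) ≤ 175540 := by exact_mod_cast hJ.le
  have h1 := mul_le_mul hx'.le hJ' (Nat.cast_nonneg J) (by norm_num)
  refine (mul_le_mul_of_nonneg_right hx (by positivity)).trans ?_
  have h2 : x * (1 + 2 * (J / 2 ^ 60)) = x + x * J * (2 / 2 ^ 60) := by ring
  rw [h2]
  have h3 := mul_le_mul_of_nonneg_right h1 (show (0 : ℝ) ≤ 2 / 2 ^ 60 by positivity)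
  refine add_le_add_right (h3.trans ?_) x
  norm_num

theorem highRange_primeCounting (hcheck : highRangeCheck = true) {J : ℕ} (hJ : 145100 ≤ J)
    (hJ' : J < 175540) {x : ℝ} (hx : gridBase ^ J ≤ x) (hx' : x < gridBase ^ (J + 1)) :
    x * (liNum 1 1 J / liDen J) ≤ (⌊x⌋₊.primeCounting : ℝ) := by
  obtain ⟨b, hb, hlanes⟩ := exists_primeLanes
  obtain ⟨w, hw, hf⟩ := exists_highCheck hcheck hJ hJ' (fun p hp => (hb p hp).2.2) hlanes
  obtain ⟨hf1, hf2⟩ := le_of_highCheck hf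
  have hnext := (hw.gridNext 0).1
  rw [pow_zero] at hnext
  have hx37 := (le_gridBase_pow (show 43881 ≤ J by lia)).trans hx
  have hx0 : 0 ≤ x := by linarith
  have hNx : (⌊x⌋₊ : ℝ) ≤ x := Nat.floor_le hx0
  have hxN : x < ⌊x⌋₊ + 1 := Nat.lt_floor_add_one x
  have hxlt : x < 41 * 49319020 := by
    have h1 : (LogGrid.gridNext w 0 : ℝ) ≤ 41 * 49319020 * 2 ^ 60 := by exact_mod_cast hf1
    refine hx'.trans_le (le_of_mul_le_mul_left ((hnext.trans h1).trans_eq (mul_comm _ _)) ?_)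
    positivity
  have hcount := le_primeCounting_add_card (b := b) (N := ⌊x⌋₊) (J := J)
    (fun p hp => (hb p hp).2.1) (hNx.trans_lt hx')
    (by exact_mod_cast hNx.trans_lt hxlt) (Nat.le_floor (by exact_mod_cast hx37))
  have hden : (0 : ℝ) < liDen J := Nat.cast_pos.2 (liDen_pos (by lia))
  have hf2' := Nat.cast_le (α := ℝ).2 hf2
  simp only [-Nat.reducePow, Nat.cast_add, Nat.cast_mul, Nat.cast_pow, Nat.cast_ofNat] at hf2'
  have key := mul_le_of_grid_inequality (Nat.cast_nonneg w) (Nat.cast_nonneg _)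
    (Nat.cast_nonneg (liNum 1 1 J)) hden (by norm_num)
    (by norm_num) hf2' (hw.le_of_pow_le hJ' hx hxlt)
  generalize x * ((liNum 1 1 J : ℝ) / liDen J) = y at key ⊢
  linarith

theorem inv_bounds {κ : ℝ} (hκ0 : 0 < κ) (hκ1 : κ < 1) (hsol : κ * (1 - Real.log κ) = 1 / 2) :
    5.35662 < κ⁻¹ ∧ κ⁻¹ < 5.35672 := by
  obtain ⟨t, ht⟩ : ∃ t, t = κ⁻¹ := ⟨_, rfl⟩
  have ht1 : 1 < t := ht ▸ (one_lt_inv₀ hκ0).2 hκ1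
  have ht0 : 0 < t := by linarith
  have hlog : Real.log t = t / 2 - 1 := by
    rw [ht, Real.log_inv]
    field_simp
    linarith
  rw [← ht]
  have hlo : (5.35662 : ℝ) / 2 - 1 < Real.log 5.35662 := by
    rw [Real.lt_log_iff_exp_lt (by norm_num),
      show (5.35662 : ℝ) / 2 - 1 = 1 + 0.67831 by norm_num, Real.exp_add]
    have h1 := Real.exp_bound' (x := 0.67831) (by norm_num) (by norm_num) (n := 9) (by norm_num)
    have h2 := Real.exp_one_lt_d9
    have h3 := mul_le_mul h2.le h1 (Real.exp_pos _).le (by norm_num)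
    refine h3.trans_lt ?_
    norm_num [Finset.sum_range_succ, Nat.factorial]
  have hhi : Real.log 5.35672 < 5.35672 / 2 - 1 := by
    rw [Real.log_lt_iff_lt_exp (by norm_num),
      show (5.35672 : ℝ) / 2 - 1 = 1 + 0.67836 by norm_num, Real.exp_add]
    have h1 := Real.sum_le_exp_of_nonneg (x := 0.67836) (by norm_num) 9
    have h2 := Real.exp_one_gt_d9
    have h3 := mul_le_mul h2.le h1 (by positivity) (Real.exp_pos _).le
    refine lt_of_lt_of_le ?_ h3
    norm_num [Finset.sum_range_succ, Nat.factorial]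
  constructor
  · by_contra! h
    rcases le_or_gt t 2 with h2 | h2
    · have := Real.log_pos ht1
      linarith
    · have h3 := Real.log_le_sub_one_of_pos (show 0 < 5.35662 / t by positivity)
      rw [Real.log_div (by norm_num) ht0.ne'] at h3
      have h4 : 5.35662 / t ≤ 5.35662 / 2 + 1 - t / 2 := by
        rw [div_le_iff₀ ht0]
        nlinarith
      linarith
  · by_contra! h
    have h3 := Real.log_le_sub_one_of_pos (show 0 < t / 5.35672 by positivity)
    rw [Real.log_div ht0.ne' (by norm_num)] at h3
    have h4 : t / 5.35672 - 1 ≤ (t - 5.35672) / 2 := by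
      rw [sub_le_iff_le_add, div_le_iff₀ (by norm_num)]
      linarith
    linarith

theorem sum_factorial_le {L Λ : ℝ} (hΛ : 0 < Λ) (hL : Λ ≤ L) {m c₁ c₂ : ℕ} (hm : m ≤ 3)
    (h₁ : 2 ≤ m → c₁ = 1) (h₂ : 3 ≤ m → c₂ = 1) :
    1 / L * ∑ k ∈ Finset.range m, (Nat.factorial k : ℝ) / L ^ k ≤
      1 / Λ + c₁ / Λ ^ 2 + 2 * c₂ / Λ ^ 3 := by
  have hL0 : 0 < L := hΛ.trans_le hL
  have e (k : ℕ) : 1 / L * ((Nat.factorial k : ℝ) / L ^ k) ≤ Nat.factorial k / Λ ^ (k + 1) := by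
    rw [div_mul_div_comm, one_mul, mul_comm L, ← pow_succ]
    gcongr
  have e0 := e 0
  have e1 := e 1
  have e2 := e 2
  simp only [Nat.factorial, Nat.cast_one, zero_add, pow_one, Nat.reduceAdd,
    Nat.succ_eq_add_one, mul_one, Nat.cast_ofNat] at e0 e1 e2
  have p0 : 0 ≤ 1 / Λ := by positivity
  have p1 : 0 ≤ (c₁ : ℝ) / Λ ^ 2 := by positivity
  have p2 : 0 ≤ 2 * (c₂ : ℝ) / Λ ^ 3 := by positivity
  rw [Finset.mul_sum]
  interval_cases m
  · rw [Finset.sum_range_zero]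
    positivity
  · simp only [Finset.sum_range_succ, Finset.sum_range_zero, Nat.factorial, Nat.cast_one]
    linarith
  · rw [h₁ le_rfl] at p1 ⊢
    simp only [Finset.sum_range_succ, Finset.sum_range_zero, Nat.factorial, Nat.cast_one,
      Nat.succ_eq_add_one, zero_add, mul_one, pow_one] at *
    linarith
  · rw [h₁ (by norm_num)] at p1 ⊢
    rw [h₂ le_rfl] at p2 ⊢
    simp only [Finset.sum_range_succ, Finset.sum_range_zero, Nat.factorial, Nat.cast_one,
      Nat.reduceAdd, Nat.succ_eq_add_one, zero_add, mul_one, pow_one,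
      Nat.cast_ofNat] at *
    linarith

theorem liApprox_zero_le {κ x : ℝ} {J c₁ c₂ : ℕ} (hJ : 0 < J) (hx : 0 ≤ x)
    (hL : 2 * J / 16385 ≤ Real.log x) (hm : ⌊κ * Real.log x⌋₊ ≤ 3)
    (h₁ : 2 ≤ ⌊κ * Real.log x⌋₊ → c₁ = 1) (h₂ : 3 ≤ ⌊κ * Real.log x⌋₊ → c₂ = 1) :
    liApprox κ 0 x ≤ x * (liNum c₁ c₂ J / liDen J) := by
  rw [liApprox, zero_mul, zero_div, zero_add, liNum_div_liDen c₁ c₂ hJ, div_eq_mul_one_div,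
    mul_assoc]
  exact mul_le_mul_of_nonneg_left (sum_factorial_le (by positivity) hL hm h₁ h₂) hx

theorem liApprox_le_primeCounting (hlow : lowRangeCheck = true) (hhigh : highRangeCheck = true)
    {κ : ℝ} (hκ0 : 0 < κ) (hκ1 : κ < 1) (hsol : κ * (1 - Real.log κ) = 1 / 2) {x : ℝ}
    (hx : Real.exp 1 ≤ x) (hx' : x < Real.exp (4 / κ)) :
    liApprox κ 0 x ≤ (⌊x⌋₊.primeCounting : ℝ) := by
  obtain ⟨ht1, ht2⟩ := inv_bounds hκ0 hκ1 hsol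
  have hx0 : 0 < x := (Real.exp_pos 1).trans_le hx
  have hL4 : Real.log x < 4 / κ := (Real.log_lt_iff_lt_exp hx0).2 hx'
  have hx1 : 1 ≤ x := le_trans (by norm_num) ((Real.add_one_le_exp 1).trans hx)
  obtain ⟨J, hJx, hxJ⟩ := exists_nat_pow_near hx1 one_lt_gridBase
  have hΛ : 2 * J / 16385 ≤ Real.log x :=
    (Real.le_log_iff_exp_le hx0).2 ((exp_le_gridBase_pow J).trans hJx)
  have hLJ : Real.log x < (J + 1) / 8192 := by
    rw [Real.log_lt_iff_lt_exp hx0]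
    exact_mod_cast hxJ.trans_le (gridBase_pow_le_exp (J + 1))
  have hge (k : ℕ) (hk : 0 < k) (h : k ≤ ⌊κ * Real.log x⌋₊) : (k : ℝ) * 5.35662 * 8192 < J + 1 := by
    have h1 := (Nat.le_floor_iff' hk.ne').1 h
    have h2 : k * κ⁻¹ ≤ Real.log x := by
      rw [← div_eq_mul_inv, div_le_iff₀' hκ0]
      exact h1
    have h3 : (0 : ℝ) < k := by exact_mod_cast hk
    nlinarith
  have hJhi : J < 175540 := by
    rw [div_eq_mul_inv] at hL4
    have : (J : ℝ) < 175540 := by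
      norm_num at ht2
      linarith
    exact_mod_cast this
  have hm : ⌊κ * Real.log x⌋₊ ≤ 3 := by
    refine Nat.lt_succ_iff.1 ((Nat.floor_lt' (by norm_num)).2 ?_)
    rw [lt_div_iff₀ hκ0] at hL4
    rw [mul_comm]
    exact_mod_cast hL4
  rcases Nat.eq_zero_or_pos ⌊κ * Real.log x⌋₊ with h0 | h0
  · rw [liApprox, h0]
    simp
  have hJ1 : 43881 ≤ J := by
    have := hge 1 one_pos h0
    norm_num at this
    have : (43880 : ℝ) < J := by linarith
    exact_mod_cast this
  have hJ2 : 2 ≤ ⌊κ * Real.log x⌋₊ → 87762 ≤ J := by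
    intro h
    have := hge 2 two_pos h
    norm_num at this
    have : (87761 : ℝ) < J := by linarith
    exact_mod_cast this
  have hJ3 : 3 ≤ ⌊κ * Real.log x⌋₊ → 131644 ≤ J := by
    intro h
    have := hge 3 three_pos h
    norm_num at this
    have : (131643 : ℝ) < J := by linarith
    exact_mod_cast this
  rcases lt_or_ge J 145100 with hJ | hJ
  · refine le_trans ?_ (lowRange_primeCounting hlow hJ1 hJ hJx)
    refine le_trans ?_ (mul_le_mul_of_nonneg_right hxJ.le
      (div_nonneg (Nat.cast_nonneg _) (Nat.cast_nonneg _)))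
    rw [lowNum_eq]
    split_ifs with h3 h2
    · exact liApprox_zero_le (by lia) hx0.le hΛ hm (fun _ => rfl) fun _ => rfl
    · exact liApprox_zero_le (by lia) hx0.le hΛ hm (fun _ => rfl) fun h => absurd (hJ3 h) h3
    · exact liApprox_zero_le (by lia) hx0.le hΛ hm (fun h => absurd (hJ2 h) h2)
        fun h => absurd (hJ3 h) h3
  · refine le_trans ?_ (highRange_primeCounting hhigh hJ hJhi hJx hxJ)
    exact liApprox_zero_le (by lia) hx0.le hΛ hm (fun _ => rfl) fun _ => rfl

theorem checks : and lowRangeCheck highRangeCheck = true := by decide +kernel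

end LogGrid

/-- With `κ̲ ∈ (0,1)` the solution of `κ(1−log κ) = 1/2`,
`li₀(x) ≤ π(x)` for all real `x` with `e ≤ x < e^(4/κ̲)`, where `π` is the prime
counting function and `li₀(x) = li_{κ̲,0}(x)`. -/
theorem li0_le_primeCounting (κ : ℝ) (hκ0 : 0 < κ) (hκ1 : κ < 1)
    (hsol : κ * (1 - Real.log κ) = 1 / 2) (x : ℝ) (hx : Real.exp 1 ≤ x)
    (hx' : x < Real.exp (4 / κ)) :
    liApprox κ 0 x ≤ (Nat.primeCounting ⌊x⌋₊ : ℝ) := by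
  have h := LogGrid.checks
  rw [Bool.and_eq_true] at h
  exact LogGrid.liApprox_le_primeCounting h.1 h.2 hκ0 hκ1 hsol hx hx'
end

section
/- Let κ̲ ∈ (0,1) be the solution of κ(1 − log κ) = 1/2 in (0,1). Then li̲(x) ≤ π(x) for all real x with e ≤ x < e^(3/κ̲). -/
section Sieve

/-- Trial elements `d, …, d + n - 1`, keeping those coprime to the product `P` of all earlier ones
kept. Starting from `d = 2`, `P = 1` this lists the primes below `n + 2`. -/
def primeList : ℕ → ℕ → ℕ → List ℕ
  | 0, _, _ => []
  | n + 1, d, P =>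
    bif Nat.beq (Nat.gcd d P) 1 then d :: primeList n (d + 1) (P * d) else primeList n (d + 1) P

/-- The number with binary ones exactly at `o, o + p, …, o + (k - 1) p`. -/
def progressionMask (p o k : ℕ) : ℕ := ((2 ^ (p * k) - 1) / (2 ^ p - 1)) <<< o

/-- Bit `i < W` of `sieveMask A W l` is set as soon as some element of `l` divides `A + i`. -/
def sieveMask (A W : ℕ) (l : List ℕ) : ℕ :=
  l.foldr (fun p S ↦ progressionMask p ((p - A % p) % p) (W / p + 1) ||| S) 0

/-- `∑ j < m, ((v >>> j) &&& M)`. -/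
def foldBits (v M : ℕ) : ℕ → ℕ
  | 0 => 0
  | j + 1 => foldBits v M j + ((v >>> j) &&& M)

/-- A lower bound for the number of zeros among the bits `off, …, off + B - 1` of `S`. -/
def countZeros (S off B : ℕ) : ℕ :=
  foldBits (2 ^ B - ((S >>> off) % 2 ^ B + 1)) ((65536 ^ (B / 16 + 1) - 1) / 65535) 16 % 65535

/-- With `ℓ` a lower bound of `10 ^ 9 * log a` and `s` a lower bound of the number of primes below
`a`, check that `s` dominates `li̲` on `[a, b)`. -/
def blockCheck (b s ℓ : ℕ) : Bool :=
  Nat.ble (4 * 10 ^ 9) ℓ &&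
    Nat.ble (b * (8 * ℓ ^ 2 * 10 ^ 9 + 11 * ℓ * 10 ^ 18)) (8 * s * ℓ ^ 3 + 32 * b * 10 ^ 27)

/-- Run `blockCheck` over `n` successive blocks of length `B`, updating the bounds `s` and `ℓ`, and
check that the final bounds are at least `s'` and `ℓ'`. -/
def blocksCheck (S A B s' ℓ' : ℕ) : ℕ → ℕ → ℕ → ℕ → Bool
  | 0, _, s, ℓ => Nat.ble s' s && Nat.ble ℓ' ℓ
  | n + 1, off, s, ℓ =>
    blockCheck (A + off + B) s ℓ &&
      blocksCheck S A B s' ℓ' n (off + B) (s + countZeros S off B)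
        (ℓ + 10 ^ 9 * (2 * B) / (2 * (A + off) + B))

/-- Sieve `[A, A + n * B)` by the primes up to `R + 1` and check all blocks of length `B` in it. -/
def segmentCheck (A B n R s ℓ s' ℓ' : ℕ) : Bool :=
  Nat.ble (A + n * B) ((R + 2) ^ 2) &&
    blocksCheck (sieveMask A (n * B) (primeList R 2 1)) A B s' ℓ' n 0 s ℓ

theorem mem_primeList {q : ℕ} (hq : q.Prime) (n d P : ℕ)
    (hP : ∀ r : ℕ, r.Prime → r ∣ P → r < d) (hd : 0 < d) (hdq : d ≤ q) (hqn : q < d + n) :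
    q ∈ primeList n d P := by
  induction n generalizing d P with
  | zero => omega
  | succ n ih =>
    have hcop : q = d → Nat.gcd d P = 1 := by
      rintro rfl
      exact (hq.coprime_iff_not_dvd).2 fun h ↦ lt_irrefl _ (hP q hq h)
    have hP' : ∀ r : ℕ, r.Prime → r ∣ P → r < d + 1 := fun r hr h ↦ (hP r hr h).trans d.lt_succ_self
    have hPd : ∀ r : ℕ, r.Prime → r ∣ P * d → r < d + 1 := fun r hr h ↦
      (hr.dvd_mul.1 h).elim (hP' r hr) fun h ↦ Nat.lt_succ_of_le (Nat.le_of_dvd hd h)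
    rw [primeList]
    by_cases hg : Nat.gcd d P = 1
    · rw [hg]
      rcases hdq.eq_or_lt with rfl | hlt
      · simp
      · exact List.mem_cons_of_mem _ (ih (d + 1) (P * d) hPd d.succ_pos hlt (by omega))
    · have hlt : d < q := lt_of_le_of_ne hdq fun h ↦ hg (hcop h.symm)
      rw [show Nat.beq (Nat.gcd d P) 1 = false from
        Bool.eq_false_iff.2 fun h ↦ hg (Nat.eq_of_beq_eq_true h)]
      exact ih (d + 1) P hP' d.succ_pos hlt (by omega)

theorem testBit_geomSum {p : ℕ} (hp : 0 < p) (k i : ℕ) (hi : i < k) :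
    (∑ j ∈ Finset.range k, (2 ^ p) ^ j).testBit (p * i) = true := by
  induction k generalizing i with
  | zero => omega
  | succ k ih =>
    have h : ∑ j ∈ Finset.range (k + 1), (2 ^ p) ^ j
        = 2 ^ p * (∑ j ∈ Finset.range k, (2 ^ p) ^ j) + 1 := by
      rw [Finset.sum_range_succ', Finset.mul_sum]
      simp [pow_succ']
    rw [h, Nat.testBit_two_pow_mul_add _ (Nat.one_lt_two_pow hp.ne')]
    cases i with
    | zero => simp [hp]
    | succ i =>
      have : ¬ p * (i + 1) < p := by nlinarith
      rw [if_neg this, mul_add, mul_one, Nat.add_sub_cancel]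
      exact ih i (by omega)

theorem testBit_progressionMask {p : ℕ} (hp : 0 < p) (o k i : ℕ) (hi : i < k) :
    (progressionMask p o k).testBit (o + p * i) = true := by
  have h := Nat.geomSum_eq (m := 2 ^ p) (Nat.le_self_pow hp.ne' 2) k
  rw [progressionMask, pow_mul, ← h, Nat.testBit_shiftLeft]
  simp [testBit_geomSum hp k i hi]

theorem testBit_sieveMask {p A W i : ℕ} {l : List ℕ} (hp : 0 < p) (hpl : p ∈ l) (hi : i < W)
    (hdvd : p ∣ A + i) : (sieveMask A W l).testBit i = true := by
  induction l with
  | nil => simp at hpl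
  | cons q l ih =>
    rw [sieveMask, List.foldr_cons, Nat.testBit_or, Bool.or_eq_true]
    rcases List.mem_cons.1 hpl with rfl | h
    · left
      set o := (p - A % p) % p with ho
      have hmod : i % p = o := by
        have hA := Nat.mod_lt A hp
        have hr := Nat.mod_lt i hp
        have h0 : (A % p + i % p) % p = 0 := by rw [← Nat.add_mod, Nat.mod_eq_zero_of_dvd hdvd]
        rcases lt_or_ge (A % p + i % p) p with h | h
        · rw [Nat.mod_eq_of_lt h] at h0
          rw [ho, show A % p = 0 by omega, Nat.sub_zero, Nat.mod_self]
          omega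
        · rw [Nat.mod_eq_sub_mod h, Nat.mod_eq_of_lt (by omega)] at h0
          rw [ho, show p - A % p = i % p by omega, Nat.mod_mod]
      have hi' : i = o + p * (i / p) := by rw [← hmod, Nat.mod_add_div]
      rw [hi']
      exact testBit_progressionMask hp _ _ _ (Nat.lt_succ_of_le (Nat.div_le_div_right hi.le))
    · exact Or.inr (ih h)

theorem prime_of_testBit_sieveMask {A W R i : ℕ} (hA : 2 ≤ A) (hi : i < W)
    (hR : A + W ≤ (R + 2) ^ 2) (h : (sieveMask A W (primeList R 2 1)).testBit i = false) :
    (A + i).Prime := by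
  by_contra hn
  have hq : (A + i).minFac.Prime := Nat.minFac_prime (by omega)
  have hsq : (A + i).minFac ^ 2 ≤ A + i := Nat.minFac_sq_le_self (by omega) hn
  have hlt : (A + i).minFac < 2 + R := by
    have : (A + i).minFac ^ 2 < (R + 2) ^ 2 := by omega
    have := lt_of_pow_lt_pow_left₀ 2 (by omega) this
    omega
  have hmem := mem_primeList hq R 2 1 (fun r hr h1 ↦ (hr.one_lt.ne' (Nat.dvd_one.1 h1)).elim)
    two_pos hq.two_le hlt
  simp [testBit_sieveMask hq.pos hmem hi (Nat.minFac_dvd _)] at h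

theorem land_geomSum_modEq (v k : ℕ) :
    v &&& (∑ i ∈ Finset.range k, 65536 ^ i)
      ≡ ∑ i ∈ Finset.range k, (v.testBit (16 * i)).toNat [MOD 65535] := by
  induction k generalizing v with
  | zero => simp [Nat.ModEq]
  | succ k ih =>
    have h : ∑ j ∈ Finset.range (k + 1), 65536 ^ j
        = 2 ^ 16 * (∑ j ∈ Finset.range k, 65536 ^ j) + 1 := by
      rw [Finset.sum_range_succ', Finset.mul_sum]
      simp [pow_succ']
    have hv : v &&& (2 ^ 16 * (∑ j ∈ Finset.range k, 65536 ^ j) + 1)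
        = 2 ^ 16 * ((v >>> 16) &&& (∑ j ∈ Finset.range k, 65536 ^ j)) + (v.testBit 0).toNat := by
      have hb : (v.testBit 0).toNat < 2 ^ 16 := (Bool.toNat_lt _).trans (by norm_num)
      refine Nat.eq_of_testBit_eq fun i ↦ ?_
      rw [Nat.testBit_and, Nat.testBit_two_pow_mul_add _ (by norm_num),
        Nat.testBit_two_pow_mul_add _ hb]
      split_ifs with hi
      · rcases i with _ | i
        · cases v.testBit 0 <;> simp
        · have h1 : Nat.testBit 1 (i + 1) = false := by simp [Nat.testBit_add]
          cases v.testBit 0 <;> simp [h1]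
      · rw [Nat.testBit_and, Nat.testBit_shiftRight]
        congr 2
        omega
    rw [h, hv, Finset.sum_range_succ']
    refine Nat.ModEq.add ?_ rfl
    have h1 := ih (v >>> 16)
    have h2 : 2 ^ 16 ≡ 1 [MOD 65535] := by decide
    have h3 := h2.mul h1
    rw [one_mul] at h3
    refine h3.trans ?_
    simp only [Nat.testBit_shiftRight, mul_add, mul_one, add_comm]
    rfl

theorem foldBits_modEq (v k : ℕ) :
    foldBits v (∑ i ∈ Finset.range k, 65536 ^ i) 16
      ≡ ((Finset.range (16 * k)).filter fun i ↦ v.testBit i).card [MOD 65535] := by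
  have key : ∀ m, foldBits v (∑ i ∈ Finset.range k, 65536 ^ i) m
      ≡ ∑ j ∈ Finset.range m, ∑ i ∈ Finset.range k, (v.testBit (16 * i + j)).toNat
        [MOD 65535] := by
    intro m
    induction m with
    | zero => rfl
    | succ m ih =>
      rw [foldBits, Finset.sum_range_succ]
      refine ih.add ((land_geomSum_modEq _ _).trans ?_)
      simp only [Nat.testBit_shiftRight, add_comm]
      rfl
  have hsum : ∀ k, ∑ j ∈ Finset.range 16, ∑ i ∈ Finset.range k, (v.testBit (16 * i + j)).toNat
      = ∑ i ∈ Finset.range (16 * k), (v.testBit i).toNat := by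
    intro k
    rw [Finset.sum_comm]
    induction k with
    | zero => simp
    | succ k ih => rw [Finset.sum_range_succ, ih, mul_add, mul_one, Finset.sum_range_add]
  have hcard : ((Finset.range (16 * k)).filter fun i ↦ v.testBit i).card
      = ∑ i ∈ Finset.range (16 * k), (v.testBit i).toNat := by
    rw [Finset.card_filter]
    refine Finset.sum_congr rfl fun i _ ↦ ?_
    cases v.testBit i <;> rfl
  rw [hcard, ← hsum]
  exact key 16

theorem countZeros_le (S off B : ℕ) :
    countZeros S off B
      ≤ ((Finset.range B).filter fun i ↦ S.testBit (off + i) = false).card := by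
  have hM : (65536 ^ (B / 16 + 1) - 1) / 65535
      = ∑ i ∈ Finset.range (B / 16 + 1), 65536 ^ i := by
    rw [Nat.geomSum_eq (by norm_num)]
  set v := 2 ^ B - ((S >>> off) % 2 ^ B + 1) with hv
  have hcard := foldBits_modEq v (B / 16 + 1)
  rw [countZeros, hM, ← hv, hcard]
  refine (Nat.mod_le _ _).trans (Finset.card_le_card fun i hi ↦ ?_)
  have hi := (Finset.mem_filter.1 hi).2
  rw [hv, Nat.testBit_two_pow_sub_succ (Nat.mod_lt _ (by positivity))] at hi
  simp only [Nat.testBit_mod_two_pow, Nat.testBit_shiftRight, Bool.and_eq_true,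
    decide_eq_true_eq, Bool.not_eq_true'] at hi
  simp_all

theorem primeCounting'_add_countZeros_le {A W R off B : ℕ} (hA : 2 ≤ A) (hoff : off + B ≤ W)
    (hR : A + W ≤ (R + 2) ^ 2) :
    Nat.primeCounting' (A + off) + countZeros (sieveMask A W (primeList R 2 1)) off B
      ≤ Nat.primeCounting' (A + off + B) := by
  rw [Nat.primeCounting', Nat.count_add _ (A + off) B, Nat.count_eq_card_filter_range _ B]
  refine Nat.add_le_add_left ((countZeros_le _ _ _).trans (Finset.card_le_card fun i hi ↦ ?_)) _
  rw [Finset.mem_filter, Finset.mem_range] at hi ⊢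
  exact ⟨hi.1, add_assoc A off i ▸ prime_of_testBit_sieveMask hA (by omega) hR hi.2⟩

end Sieve

section Real

open Real

theorem three_sixteenths_mul_one_sub_log :
    0.501369 < 3 / 16 * (1 - log (3 / 16)) ∧ 3 / 16 * (1 - log (3 / 16)) < 0.501371 ∧
      1.673 < -log (3 / 16) := by
  have h : log (3 / 16) = log 3 - 4 * log 2 := by
    rw [log_div (by norm_num) (by norm_num), show (16 : ℝ) = 2 ^ 4 by norm_num, log_pow]
    norm_num
  have h2 := log_two_gt_d9
  have h2' := log_two_lt_d9
  have h3 := log_three_gt_d9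
  have h3' := log_three_lt_d9
  rw [h]
  refine ⟨?_, ?_, ?_⟩ <;> linarith

/-- `t ↦ t (1 - log t)` lies below its tangent lines. -/
theorem mul_one_sub_log_le {s t : ℝ} (hs : 0 < s) (ht : 0 < t) :
    s * (1 - log s) ≤ t * (1 - log t) - log t * (s - t) := by
  have h := one_sub_inv_le_log_of_pos (div_pos hs ht)
  rw [log_div hs.ne' ht.ne', inv_div] at h
  have := mul_le_mul_of_nonneg_left h hs.le
  have h2 : s * (1 - t / s) = s - t := by field_simp
  nlinarith

theorem le_three_sixteenths {κ : ℝ} (hκ0 : 0 < κ) (hκ1 : κ < 1)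
    (hsol : κ * (1 - log κ) = 1 / 2) : κ ≤ 3 / 16 := by
  by_contra! h
  have h1 := mul_one_sub_log_le (s := 3 / 16) (by norm_num) hκ0
  have h2 := three_sixteenths_mul_one_sub_log.1
  have h3 := log_neg hκ0 hκ1
  nlinarith

theorem three_div_le {κ : ℝ} (hκ0 : 0 < κ) (hsol : κ * (1 - log κ) = 1 / 2) :
    3 / κ ≤ 16.0738 := by
  have h1 := mul_one_sub_log_le hκ0 (t := 3 / 16) (by norm_num)
  obtain ⟨-, h2, h3⟩ := three_sixteenths_mul_one_sub_log
  have h : 0.18668 ≤ κ := by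
    by_contra! h
    nlinarith
  rw [div_le_iff₀ hκ0]
  linarith

/-- `li̲(x)` interpolates concavely between the partial sums of the asymptotic series, so it lies
below the extension of its third linear piece. -/
theorem liApprox_le {κ x : ℝ} (hκ0 : 0 < κ) (hκ : κ ≤ 3 / 16) (hx : 0 ≤ x) (hL : 2 ≤ log x)
    (ht : κ * log x < 3) :
    liApprox κ (κ * log x - ⌊κ * log x⌋₊) x
      ≤ x * (1 / log x + 11 / 8 / log x ^ 2 - 4 / log x ^ 3) := by
  set L := log x with hLdef
  have hL0 : 0 < L := by linarith
  have ht0 : 0 ≤ κ * L := by positivity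
  set t := κ * L with htdef
  have ht' : t ≤ 3 / 16 * L := mul_le_mul_of_nonneg_right hκ hL0.le
  obtain ⟨u, hu⟩ : ∃ u, u = 1 / L := ⟨_, rfl⟩
  have hu0 : 0 < u := by rw [hu]; positivity
  have hu2 : u ≤ 1 / 2 := by rw [hu]; gcongr
  have huL : u * L = 1 := by rw [hu]; field_simp
  have hrhs : x * (1 / L + 11 / 8 / L ^ 2 - 4 / L ^ 3)
      = x / L * (1 + u + (3 / 16 * L - 2) * 2 * u ^ 2) := by
    rw [hu]; field_simp; ring
  have hm : ⌊t⌋₊ < 3 := (Nat.floor_lt ht0).2 (by exact_mod_cast ht)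
  have hm1 := Nat.floor_le ht0
  have hm2 := Nat.lt_floor_add_one t
  have hmono : (t - 2) * 2 * u ^ 2 ≤ (3 / 16 * L - 2) * 2 * u ^ 2 := by gcongr
  rw [hrhs, liApprox, ← hLdef, ← htdef]
  refine mul_le_mul_of_nonneg_left (le_trans ?_ (add_le_add_right hmono _)) (by positivity)
  generalize ⌊t⌋₊ = m at *
  interval_cases m
  · norm_num at hm2 ⊢
    nlinarith [mul_nonneg (sub_nonneg.2 hm2.le) (sub_nonneg.2 hu2),
      mul_nonneg hu0.le (sub_nonneg.2 hu2)]
  · have : (t - 1) * 1 / L ^ 1 = (t - 1) * u := by rw [hu]; field_simp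
    norm_num [← hu] at hm1 hm2 this ⊢
    nlinarith [mul_nonneg (mul_nonneg (sub_nonneg.2 hm2.le) (sub_nonneg.2 hu2)) hu0.le]
  · have : (t - 2) * 2 / L ^ 2 = (t - 2) * 2 * u ^ 2 := by rw [hu]; field_simp
    have h2 : L⁻¹ = u := by rw [hu, one_div]
    norm_num [Finset.sum_range_succ, Nat.factorial, h2] at this ⊢
    linarith

theorem le_of_blockCheck {b s ℓ : ℕ} {x : ℝ} (h : blockCheck b s ℓ = true) (hx0 : 0 ≤ x)
    (hx : x ≤ b) (hℓ : (ℓ : ℝ) ≤ 10 ^ 9 * log x) :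
    x * (1 / log x + 11 / 8 / log x ^ 2 - 4 / log x ^ 3) ≤ s := by
  rw [blockCheck, Bool.and_eq_true, Nat.ble_eq, Nat.ble_eq] at h
  obtain ⟨h4, h⟩ := h
  have h4' : (4 * 10 ^ 9 : ℝ) ≤ ℓ := by exact_mod_cast h4
  have h' : (b * (8 * ℓ ^ 2 * 10 ^ 9 + 11 * ℓ * 10 ^ 18) : ℝ)
      ≤ 8 * s * ℓ ^ 3 + 32 * b * 10 ^ 27 := by exact_mod_cast h
  set L := log x
  obtain ⟨l, hl⟩ : ∃ l : ℝ, l = ℓ / 10 ^ 9 := ⟨_, rfl⟩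
  have hℓl : (ℓ : ℝ) = 10 ^ 9 * l := by rw [hl]; field_simp
  have hl4 : 4 ≤ l := by linarith
  have hlL : l ≤ L := by linarith
  have hpos : 0 < l := by linarith
  have hLpos : 0 < L := by linarith
  have hu : 1 / l ≤ 1 / 4 := by gcongr
  have hvu : 1 / L ≤ 1 / l := by gcongr
  have hv : 0 < 1 / L := by positivity
  have heq : ∀ y : ℝ, 1 / y + 11 / 8 / y ^ 2 - 4 / y ^ 3
      = 1 / y + 11 / 8 * (1 / y) ^ 2 - 4 * (1 / y) ^ 3 := by
    intro y; ring
  have hmono : 1 / L + 11 / 8 / L ^ 2 - 4 / L ^ 3 ≤ 1 / l + 11 / 8 / l ^ 2 - 4 / l ^ 3 := by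
    rw [heq, heq]
    generalize 1 / L = v at *
    generalize 1 / l = u at *
    have : 0 ≤ (u - v) * (1 + 11 / 8 * (u + v) - 4 * (u ^ 2 + u * v + v ^ 2)) := by
      apply mul_nonneg (by linarith)
      nlinarith
    nlinarith
  have hnn : 0 ≤ 1 / l + 11 / 8 / l ^ 2 - 4 / l ^ 3 := by
    rw [heq]
    have : 0 < 1 / l := by positivity
    generalize 1 / l = u at *
    nlinarith [mul_nonneg this.le (sub_nonneg.2 hu),
      mul_nonneg (mul_nonneg this.le this.le) (sub_nonneg.2 hu)]
  calc x * (1 / L + 11 / 8 / L ^ 2 - 4 / L ^ 3)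
      ≤ b * (1 / l + 11 / 8 / l ^ 2 - 4 / l ^ 3) :=
        (mul_le_mul_of_nonneg_left hmono hx0).trans (mul_le_mul_of_nonneg_right hx hnn)
    _ = b * (8 * l ^ 2 + 11 * l - 32) / (8 * l ^ 3) := by field_simp; ring
    _ ≤ s := by
      rw [div_le_iff₀ (by positivity)]
      rw [hℓl] at h'
      linarith

theorem add_div_le_log_add {a B ℓ : ℕ} (ha : 0 < a) (hℓ : (ℓ : ℝ) ≤ 10 ^ 9 * log a) :
    ((ℓ + 10 ^ 9 * (2 * B) / (2 * a + B) : ℕ) : ℝ) ≤ 10 ^ 9 * log ((a + B : ℕ) : ℝ) := by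
  have ha' : (0 : ℝ) < a := by exact_mod_cast ha
  have h1 := le_log_one_add_of_nonneg (x := (B : ℝ) / a) (by positivity)
  have h2 : log ((a + B : ℕ) : ℝ) = log a + log (1 + B / a) := by
    rw [← log_mul ha'.ne' (by positivity)]
    congr 1
    push_cast
    field_simp
  have h3 : 2 * ((B : ℝ) / a) / (B / a + 2) = 2 * B / (2 * a + B) := by
    field_simp
    ring
  have h4 : ((10 ^ 9 * (2 * B) / (2 * a + B) : ℕ) : ℝ) ≤ 10 ^ 9 * (2 * B / (2 * a + B)) := by
    refine Nat.cast_div_le.trans (le_of_eq ?_)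
    push_cast
    ring
  rw [h2]
  push_cast at h4 ⊢
  rw [h3] at h1
  linarith

/-- The information carried through the verification: bounds for the prime count and the logarithm
at `a`, and the inequality to be proved on `[128, a)`. -/
structure VerifiedUpTo (a s ℓ : ℕ) : Prop where
  le_primeCounting' : s ≤ Nat.primeCounting' a
  le_log : (ℓ : ℝ) ≤ 10 ^ 9 * log a
  bound : ∀ x : ℝ, 128 ≤ x → x < a →
    x * (1 / log x + 11 / 8 / log x ^ 2 - 4 / log x ^ 3) ≤ Nat.primeCounting ⌊x⌋₊

theorem primeCounting'_le_primeCounting_floor {a : ℕ} {x : ℝ} (h : a ≤ x) :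
    Nat.primeCounting' a ≤ Nat.primeCounting ⌊x⌋₊ :=
  Nat.monotone_primeCounting' ((Nat.le_floor h).trans (Nat.le_succ _))

theorem VerifiedUpTo.of_blocksCheck {A W R B s' ℓ' n off s ℓ : ℕ} (hA : 2 ≤ A)
    (hR : A + W ≤ (R + 2) ^ 2) (hoff : off + n * B ≤ W)
    (h : VerifiedUpTo (A + off) s ℓ)
    (hc : blocksCheck (sieveMask A W (primeList R 2 1)) A B s' ℓ' n off s ℓ = true) :
    VerifiedUpTo (A + off + n * B) s' ℓ' := by
  induction n generalizing off s ℓ with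
  | zero =>
    rw [blocksCheck, Bool.and_eq_true, Nat.ble_eq, Nat.ble_eq] at hc
    rw [zero_mul, add_zero]
    exact ⟨hc.1.trans h.1, le_trans (by exact_mod_cast hc.2) h.2, h.3⟩
  | succ n ih =>
    rw [blocksCheck, Bool.and_eq_true] at hc
    have hlen : off + B + n * B ≤ W := by linarith
    have key := ih (off := off + B) hlen ⟨?_, ?_, fun x hx hxb ↦ ?_⟩ hc.2
    · convert key using 1
      ring
    · rw [← add_assoc]
      exact (Nat.add_le_add_right h.1 _).trans
        (primeCounting'_add_countZeros_le hA (by nlinarith) hR)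
    · rw [← add_assoc]
      exact add_div_le_log_add (by omega) h.2
    · rw [← add_assoc] at hxb
      rcases lt_or_ge x ((A + off : ℕ) : ℝ) with hlt | hge
      · exact h.3 x hx hlt
      · have h0 : (0 : ℝ) < ((A + off : ℕ) : ℝ) := by exact_mod_cast (by omega : 0 < A + off)
        refine (le_of_blockCheck hc.1 (by linarith) hxb.le (h.2.trans ?_)).trans ?_
        · gcongr
        · exact_mod_cast h.1.trans (primeCounting'_le_primeCounting_floor hge)

/-- A successful segment check extends the verified range. -/
theorem VerifiedUpTo.of_segmentCheck {A B n R s ℓ s' ℓ' : ℕ} (h : VerifiedUpTo A s ℓ)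
    (hA : 2 ≤ A) (hc : segmentCheck A B n R s ℓ s' ℓ' = true) :
    VerifiedUpTo (A + n * B) s' ℓ' := by
  rw [segmentCheck, Bool.and_eq_true, Nat.ble_eq] at hc
  exact VerifiedUpTo.of_blocksCheck (off := 0) hA hc.1 (by simp) h hc.2

theorem verifiedUpTo_128 : VerifiedUpTo 128 31 4852030262 where
  le_primeCounting' := by decide +kernel
  le_log := by
    rw [show ((128 : ℕ) : ℝ) = 2 ^ 7 by norm_num, log_pow]
    have := log_two_gt_d9
    norm_num
    linarith
  bound x hx hx' := absurd hx (by exact_mod_cast hx'.not_ge)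

end Real

section Verification

theorem segmentCheck_128 :
    segmentCheck 128 4 96 21 31 4852030262 97 6238286434 = true := by
  decide +kernel

theorem segmentCheck_512 :
    segmentCheck 512 16 32 30 97 6238286434 172 6931403089 = true := by
  decide +kernel

theorem segmentCheck_1024 :
    segmentCheck 1024 32 224 89 172 6931403089 1028 9010804479 = true := by
  decide +kernel

theorem segmentCheck_8192 :
    segmentCheck 8192 128 448 254 1028 9010804479 6542 11090235793 = true := by
  decide +kernel

theorem segmentCheck_65536 :
    segmentCheck 65536 512 1920 1022 6542 11090235793 82025 13862821060 = true := by
  decide +kernel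

theorem segmentCheck_1048576 :
    segmentCheck 1048576 4096 256 1447 82025 13862821060 155611 14555967639 = true := by
  decide +kernel

theorem segmentCheck_2097152 :
    segmentCheck 2097152 4096 256 1772 155611 14555967639 226549 14961432537 = true := by
  decide +kernel

theorem segmentCheck_3145728 :
    segmentCheck 3145728 4096 256 2046 226549 14961432537 295947 15249114460 = true := by
  decide +kernel

theorem segmentCheck_4194304 :
    segmentCheck 4194304 4096 256 2288 295947 15249114460 364195 15472257869 = true := by
  decide +kernel

theorem segmentCheck_5242880 :
    segmentCheck 5242880 4096 256 2507 364195 15472257869 431502 15654579298 = true := by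
  decide +kernel

theorem segmentCheck_6291456 :
    segmentCheck 6291456 4096 256 2708 431502 15654579298 498177 15808729846 = true := by
  decide +kernel

theorem segmentCheck_7340032 :
    segmentCheck 7340032 4096 256 2895 498177 15808729846 564163 15942261109 = true := by
  decide +kernel

theorem segmentCheck_8388608 :
    segmentCheck 8388608 4096 256 3070 564163 15942261109 629686 16060044018 = true := by
  decide +kernel

theorem segmentCheck_9437184 :
    segmentCheck 9437184 4096 32 3092 629686 16060044018 637820 16073837325 = true := by
  decide +kernel

theorem verifiedUpTo_9568256 : VerifiedUpTo 9568256 637820 16073837325 := by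
  have h1 := verifiedUpTo_128.of_segmentCheck (by norm_num) segmentCheck_128
  have h2 := h1.of_segmentCheck (by norm_num) segmentCheck_512
  have h3 := h2.of_segmentCheck (by norm_num) segmentCheck_1024
  have h4 := h3.of_segmentCheck (by norm_num) segmentCheck_8192
  have h5 := h4.of_segmentCheck (by norm_num) segmentCheck_65536
  have h6 := h5.of_segmentCheck (by norm_num) segmentCheck_1048576
  have h7 := h6.of_segmentCheck (by norm_num) segmentCheck_2097152
  have h8 := h7.of_segmentCheck (by norm_num) segmentCheck_3145728
  have h9 := h8.of_segmentCheck (by norm_num) segmentCheck_4194304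
  have h10 := h9.of_segmentCheck (by norm_num) segmentCheck_5242880
  have h11 := h10.of_segmentCheck (by norm_num) segmentCheck_6291456
  have h12 := h11.of_segmentCheck (by norm_num) segmentCheck_7340032
  have h13 := h12.of_segmentCheck (by norm_num) segmentCheck_8388608
  exact h13.of_segmentCheck (by norm_num) segmentCheck_9437184

end Verification

theorem three_mul_succ_le_primeCounting :
    ∀ n < 128, 2 ≤ n → 3 * (n + 1) ≤ 16 * Nat.primeCounting n := by
  decide +kernel

theorem liApprox_le_primeCounting_of_lt {κ x : ℝ} (hκ0 : 0 < κ) (hκ : κ ≤ 3 / 16)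
    (hx : Real.exp 1 ≤ x) (hx' : x < 128) :
    liApprox κ (κ * Real.log x - ⌊κ * Real.log x⌋₊) x ≤ (Nat.primeCounting ⌊x⌋₊ : ℝ) := by
  have hx2 : 2 < x := by linarith [Real.exp_one_gt_d9]
  have hL0 : 0 < Real.log x := Real.log_pos (by linarith)
  have hL : Real.log x ≤ 5 := by
    have h := Real.log_le_log (by linarith) hx'.le
    rw [show (128 : ℝ) = 2 ^ 7 by norm_num, Real.log_pow] at h
    norm_num at h
    linarith [Real.log_two_lt_d9]
  have hfloor : ⌊κ * Real.log x⌋₊ = 0 := Nat.floor_eq_zero.2 (by nlinarith)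
  have hlt : ⌊x⌋₊ < 128 := (Nat.floor_lt (by linarith)).2 (by exact_mod_cast hx')
  have key := three_mul_succ_le_primeCounting _ hlt (Nat.le_floor (by exact_mod_cast hx2.le))
  have key' : (3 * (⌊x⌋₊ + 1) : ℝ) ≤ 16 * Nat.primeCounting ⌊x⌋₊ := by exact_mod_cast key
  have hval : liApprox κ (κ * Real.log x - ⌊κ * Real.log x⌋₊) x = κ * x := by
    rw [liApprox, hfloor]
    simp
    field_simp
  rw [hval]
  nlinarith [Nat.lt_floor_add_one x]

/-- With `κ̲ ∈ (0,1)` the solution of `κ(1−log κ) = 1/2`,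
`li̲(x) ≤ π(x)` for all real `x` with `e ≤ x < e^(3/κ̲)`, where `π` is the prime
counting function and `li̲(x) = li_{κ̲,α̲}(x)` with `α̲ = κ̲·log x − ⌊κ̲·log x⌋`. -/
theorem liUnder_le_primeCounting (κ : ℝ) (hκ0 : 0 < κ) (hκ1 : κ < 1)
    (hsol : κ * (1 - Real.log κ) = 1 / 2) (x : ℝ) (hx : Real.exp 1 ≤ x)
    (hx' : x < Real.exp (3 / κ)) :
    liApprox κ (κ * Real.log x - ⌊κ * Real.log x⌋₊) x ≤ (Nat.primeCounting ⌊x⌋₊ : ℝ) := by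
  have hκ := le_three_sixteenths hκ0 hκ1 hsol
  rcases lt_or_ge x 128 with hlt | hge
  · exact liApprox_le_primeCounting_of_lt hκ0 hκ hx hlt
  have hx0 : 0 < x := by linarith
  have hlog : Real.log x < 3 / κ := (Real.log_lt_iff_lt_exp hx0).2 hx'
  have hL : 2 ≤ Real.log x := by
    have h := Real.log_le_log (by norm_num) hge
    rw [show (128 : ℝ) = 2 ^ 7 by norm_num, Real.log_pow] at h
    norm_num at h
    linarith [Real.log_two_gt_d9]
  have hxN : x < (9568256 : ℕ) := by
    refine (Real.log_lt_log_iff hx0 (by norm_num)).1 ?_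
    have h := verifiedUpTo_9568256.le_log
    have h3 := three_div_le hκ0 hsol
    norm_num at h h3 ⊢
    linarith
  refine (liApprox_le hκ0 hκ hx0.le hL ?_).trans (verifiedUpTo_9568256.bound x hge hxN)
  rwa [lt_div_iff₀ hκ0, mul_comm] at hlog
end
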